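/- arXiv:1002.2137 — 6 statements merged into one kernel-verified Lean document; each statement's English description precedes it below -/
import Mathlib

section
/- Let u and v be C¹ functions on ℝ^N with values in [−1,1] which are respectively a viscosity subsolution and a viscosity supersolution of F(∇w, D²w) + f(w) = 0 in ℝ^N. Let b < c be reals, set Ω = [b,c] × ℝ^{N−1}, and let m > 0 be such that |∇u(x)| ≥ m and |∇v(x)| ≥ m for every x ∈ Ω. Assume that either u ≤ −1 + δ₀ throughout Ω or v ≥ 1 − δ₀ throughout Ω. Then u − v ≤ sup_{∂Ω} (u − v)⁺ on Ω, where ∂Ω = ({b} ∪ {c}) × ℝ^{N−1} and (u−v)⁺ denotes the positive part of u − v. -/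
noncomputable section

open Metric Filter Topology Real

/-- `ℝ^N` as a Euclidean space. -/
abbrev ESp (N : ℕ) := EuclideanSpace ℝ (Fin N)

/-- The Hessian matrix of a function `φ : ℝ^N → ℝ` at a point `x`. -/
def hessianMatrix {N : ℕ} (φ : ESp N → ℝ) (x : ESp N) : Matrix (Fin N) (Fin N) ℝ :=
  Matrix.of fun i j =>
    fderiv ℝ (fun y => fderiv ℝ φ y (EuclideanSpace.single j (1 : ℝ))) x
      (EuclideanSpace.single i (1 : ℝ))

/-- `F̃` is positively homogeneous of degree one and uniformly elliptic with constants
`0 < a ≤ A`, i.e. `a tr(P) ≤ F̃(M+P) - F̃(M) ≤ A tr(P)` for symmetric `M` and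
positive semidefinite symmetric `P`. -/
def UniformlyElliptic (N : ℕ) (a A : ℝ) (Ftil : Matrix (Fin N) (Fin N) ℝ → ℝ) : Prop :=
  (∀ t : ℝ, 0 ≤ t → ∀ M : Matrix (Fin N) (Fin N) ℝ, M.IsSymm → Ftil (t • M) = t * Ftil M) ∧
  ∀ M P : Matrix (Fin N) (Fin N) ℝ, M.IsSymm → P.IsSymm → P.PosSemidef →
    a * P.trace ≤ Ftil (M + P) - Ftil M ∧ Ftil (M + P) - Ftil M ≤ A * P.trace

/-- `v` is a viscosity supersolution of `|∇u|^α F̃(D²u) = g(x,u)` in `Ω`. -/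
def ViscSuper {N : ℕ} (α : ℝ) (Ftil : Matrix (Fin N) (Fin N) ℝ → ℝ)
    (g : ESp N → ℝ → ℝ) (Ω : Set (ESp N)) (v : ESp N → ℝ) : Prop :=
  ∀ x₀ ∈ Ω,
    (∃ δ > (0:ℝ), ∃ c : ℝ, ball x₀ δ ⊆ Ω ∧ (∀ x ∈ ball x₀ δ, v x = c) ∧
      ∀ x ∈ ball x₀ δ, 0 ≤ g x c) ∨
    (∀ φ : ESp N → ℝ, ContDiff ℝ 2 φ →
      IsLocalMin (fun x => v x - φ x) x₀ → gradient φ x₀ ≠ 0 →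
      ‖gradient φ x₀‖ ^ α * Ftil (hessianMatrix φ x₀) ≤ g x₀ (v x₀))

/-- `v` is a viscosity subsolution of `|∇u|^α F̃(D²u) = g(x,u)` in `Ω`. -/
def ViscSub {N : ℕ} (α : ℝ) (Ftil : Matrix (Fin N) (Fin N) ℝ → ℝ)
    (g : ESp N → ℝ → ℝ) (Ω : Set (ESp N)) (v : ESp N → ℝ) : Prop :=
  ∀ x₀ ∈ Ω,
    (∃ δ > (0:ℝ), ∃ c : ℝ, ball x₀ δ ⊆ Ω ∧ (∀ x ∈ ball x₀ δ, v x = c) ∧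
      ∀ x ∈ ball x₀ δ, g x c ≤ 0) ∨
    (∀ φ : ESp N → ℝ, ContDiff ℝ 2 φ →
      IsLocalMax (fun x => v x - φ x) x₀ → gradient φ x₀ ≠ 0 →
      g x₀ (v x₀) ≤ ‖gradient φ x₀‖ ^ α * Ftil (hessianMatrix φ x₀))

/-- `v` is a viscosity solution of `|∇u|^α F̃(D²u) = g(x,u)` in `Ω`. -/
def ViscSol {N : ℕ} (α : ℝ) (Ftil : Matrix (Fin N) (Fin N) ℝ → ℝ)
    (g : ESp N → ℝ → ℝ) (Ω : Set (ESp N)) (v : ESp N → ℝ) : Prop :=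
  ViscSub α Ftil g Ω v ∧ ViscSuper α Ftil g Ω v

/-- `|∇u| ≥ m` in `Ω` in the viscosity sense. -/
def GradGE {N : ℕ} (m : ℝ) (Ω : Set (ESp N)) (u : ESp N → ℝ) : Prop :=
  ∀ φ : ESp N → ℝ, ContDiff ℝ 2 φ → ∀ x₀ ∈ Ω,
    (IsLocalMin (fun x => u x - φ x) x₀ ∨ IsLocalMax (fun x => u x - φ x) x₀) →
    m ≤ ‖gradient φ x₀‖

section Regularity

variable {E : Type*} [NormedAddCommGroup E] [InnerProductSpace ℝ E]

/-- A convex function on a finite-dimensional space has a subgradient at every point. -/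
theorem exists_subgradient [FiniteDimensional ℝ E] {g : E → ℝ} (hg : ConvexOn ℝ Set.univ g) (x : E) :
    ∃ p : E →L[ℝ] ℝ, ∀ z, g x + p z ≤ g (x + z) := by
  have hcont : Continuous g := hg.locallyLipschitz.continuous
  have hconv : Convex ℝ {p : E × ℝ | g p.1 < p.2} := by
    simpa using hg.convex_strict_epigraph
  have hopen : IsOpen {p : E × ℝ | g p.1 < p.2} :=
    isOpen_lt (hcont.comp continuous_fst) continuous_snd
  obtain ⟨L, hL⟩ := geometric_hahn_banach_point_open hconv hopen
    (show (x, g x) ∉ {p : E × ℝ | g p.1 < p.2} by simp)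
  have hsplit : ∀ y t, L (y, t) = L (y, 0) + t * L (0, 1) := by
    intro y t
    have : ((y, t) : E × ℝ) = (y, 0) + t • (0, 1) := by simp
    rw [this, map_add, map_smul, smul_eq_mul]
  have hpos : 0 < L (0, 1) := by
    have h := hL (x, g x + 1) (by simp)
    rw [hsplit x (g x), hsplit x (g x + 1)] at h
    linarith
  have hle : ∀ y, L (x, 0) + g x * L (0, 1) ≤ L (y, 0) + g y * L (0, 1) := by
    intro y
    refine le_of_forall_pos_le_add fun ε hε => ?_
    have h := hL (y, g y + ε / L (0, 1)) (by simp only [Set.mem_ofPred_eq]; linarith [div_pos hε hpos])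
    rw [hsplit x (g x), hsplit y] at h
    have : ε / L (0, 1) * L (0, 1) = ε := div_mul_cancel₀ _ hpos.ne'
    nlinarith
  refine ⟨-(L (0, 1))⁻¹ • L.comp (.inl ℝ E ℝ), fun z => ?_⟩
  have h := hle (x + z)
  have hadd : L (x + z, 0) = L (x, 0) + L (z, 0) := by
    rw [← map_add]; simp
  rw [hadd] at h
  have h2 : 0 ≤ (L (0, 1))⁻¹ * (L (z, 0) + g (x + z) * L (0, 1) - g x * L (0, 1)) :=
    mul_nonneg (inv_nonneg.2 hpos.le) (by linarith)
  have h3 : (L (0, 1))⁻¹ * (L (z, 0) + g (x + z) * L (0, 1) - g x * L (0, 1)) =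
      (L (0, 1))⁻¹ * L (z, 0) + g (x + z) - g x := by
    field_simp
  have h4 : (-(L (0, 1))⁻¹ • L.comp (.inl ℝ E ℝ)) z = -((L (0, 1))⁻¹ * L (z, 0)) := by
    simp
  rw [h4]
  linarith

/-- `h` has slope `p` at `x` up to a quadratic error with constant `Λ`. -/
def QuadraticSlope (Λ : ℝ) (h : E → ℝ) (x : E) (p : E →L[ℝ] ℝ) : Prop :=
  ∀ z, |h (x + z) - h x - p z| ≤ Λ * ‖z‖ ^ 2

theorem QuadraticSlope.norm_sub_le {Λ : ℝ} (hΛ : 0 ≤ Λ) {h : E → ℝ} {x y : E}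
    {p q : E →L[ℝ] ℝ} (hx : QuadraticSlope Λ h x p) (hy : QuadraticSlope Λ h y q) :
    ‖p - q‖ ≤ 6 * Λ * ‖x - y‖ := by
  have key : ∀ z, (q - p) z ≤ 3 * Λ * (‖z‖ ^ 2 + ‖x - y‖ ^ 2) := by
    intro z
    have h1 := (abs_le.1 (hy z)).1
    have h2 := (abs_le.1 (hx (y - x + z))).2
    have h3 := (abs_le.1 (hx (y - x))).1
    rw [show x + (y - x + z) = y + z by abel] at h2
    rw [show x + (y - x) = y by abel] at h3
    rw [map_add] at h2
    have h4 : ‖y - x + z‖ ^ 2 ≤ 2 * (‖x - y‖ ^ 2 + ‖z‖ ^ 2) := by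
      have := norm_add_le (y - x) z
      rw [norm_sub_rev y x] at this
      nlinarith [norm_nonneg (y - x + z), sq_nonneg (‖x - y‖ - ‖z‖)]
    have h5 := mul_le_mul_of_nonneg_left h4 hΛ
    rw [norm_sub_rev y x] at h3
    rw [sub_apply]
    linarith
  have key2 : ∀ z, (q - p) z ≤ 6 * Λ * ‖x - y‖ * ‖z‖ := by
    intro z
    by_cases hz : z = 0
    · simp [hz]
    have hz' : 0 < ‖z‖ := norm_pos_iff.2 hz
    rw [mul_right_comm]
    suffices H : ∀ t, ‖x - y‖ < t → (q - p) z ≤ 6 * Λ * ‖z‖ * t by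
      have hlim : Tendsto (fun t : ℝ => 6 * Λ * ‖z‖ * t) (𝓝[>] ‖x - y‖)
          (𝓝 (6 * Λ * ‖z‖ * ‖x - y‖)) :=
        ((continuous_const.mul continuous_id).tendsto _).mono_left nhdsWithin_le_nhds
      exact ge_of_tendsto hlim (eventually_nhdsWithin_of_forall H)
    intro t ht
    have ht0 : 0 < t := (norm_nonneg _).trans_lt ht
    have h := key ((t / ‖z‖) • z)
    rw [map_smul, smul_eq_mul, norm_smul, Real.norm_of_nonneg (by positivity),
      div_mul_cancel₀ _ hz'.ne'] at h
    have h2 : t ^ 2 + ‖x - y‖ ^ 2 ≤ 2 * t ^ 2 := by nlinarith [norm_nonneg (x - y)]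
    have h3 := h.trans (mul_le_mul_of_nonneg_left h2 (by positivity))
    rw [div_mul_eq_mul_div, div_le_iff₀ hz'] at h3
    nlinarith
  refine ContinuousLinearMap.opNorm_le_bound _ (by positivity) fun z => ?_
  rw [Real.norm_eq_abs, abs_le]
  constructor
  · have := key2 z
    simp only [sub_apply] at this ⊢
    linarith
  · have := key2 (-z)
    rw [norm_neg, map_neg] at this
    simp only [sub_apply] at this ⊢
    linarith

theorem QuadraticSlope.hasFDerivAt {Λ : ℝ} {h : E → ℝ} {x : E} {p : E →L[ℝ] ℝ}
    (hx : QuadraticSlope Λ h x p) : HasFDerivAt h p x := by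
  rw [hasFDerivAt_iff_isLittleO_nhds_zero]
  have h1 : (fun z => h (x + z) - h x - p z) =O[𝓝 0] fun z => ‖z‖ ^ 2 :=
    Asymptotics.IsBigO.of_bound Λ (Eventually.of_forall fun z => by
      simpa using hx z)
  refine h1.trans_isLittleO ?_
  exact (Asymptotics.isLittleO_norm_pow_id one_lt_two)

/-- Second-order Taylor expansion at a point where the derivative is differentiable. -/
theorem second_order_taylor {h : E → ℝ} {P : E → E →L[ℝ] ℝ} (hP : ∀ x, HasFDerivAt h (P x) x)
    {x : E} {X : E →L[ℝ] E →L[ℝ] ℝ} (hX : HasFDerivAt P X x) {τ : ℝ} (hτ : 0 < τ) :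
    ∀ᶠ z in 𝓝 (0 : E), |h (x + z) - h x - P x z - 1 / 2 * X z z| ≤ τ * ‖z‖ ^ 2 := by
  have hsymm : ∀ v w, X v w = X w v := second_derivative_symmetric hP hX
  rw [hasFDerivAt_iff_isLittleO_nhds_zero] at hX
  obtain ⟨r, hr, hball⟩ := Metric.eventually_nhds_iff_ball.1 (hX.bound hτ)
  refine Metric.eventually_nhds_iff_ball.2 ⟨r, hr, fun z hz => ?_⟩
  have hder : ∀ y ∈ closedBall (0 : E) ‖z‖, HasFDerivWithinAt
      (fun z => h (x + z) - h x - P x z - 1 / 2 * X z z) (P (x + y) - P x - X y)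
      (closedBall (0 : E) ‖z‖) y := by
    intro y _
    have h1 : HasFDerivAt (fun z => h (x + z)) (P (x + y)) y := by
      exact (hP (x + y)).comp y ((hasFDerivAt_id y).const_add x)
    have h2 : HasFDerivAt (fun z => X z z) (X y + X.flip y) y := by
      have := X.hasFDerivAt_of_bilinear (hasFDerivAt_id y) (hasFDerivAt_id y)
      refine this.congr_fderiv ?_
      ext v
      simp
    have h3 := (((h1.sub_const (h x)).sub (P x).hasFDerivAt).sub (h2.const_mul (1 / 2)))
    refine (h3.congr_fderiv ?_).hasFDerivWithinAt
    ext v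
    simp [hsymm v y]
    ring
  have hbd : ∀ y ∈ closedBall (0 : E) ‖z‖, ‖P (x + y) - P x - X y‖ ≤ τ * ‖z‖ := by
    intro y hy
    have hy' : ‖y‖ ≤ ‖z‖ := by simpa using hy
    have hz' : ‖z‖ < r := by simpa using hz
    refine (hball y (by simpa using hy'.trans_lt hz')).trans ?_
    gcongr
  have := (convex_closedBall (0 : E) ‖z‖).norm_image_sub_le_of_norm_hasFDerivWithin_le hder hbd
    (x := 0) (y := z) (by simp) (by simp)
  simp only [map_zero, add_zero, sub_self, sub_zero, Real.norm_eq_abs, mul_zero] at this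
  rw [pow_two, ← mul_assoc]
  exact this

/-- A convex function with a quadratic upper bound on its second differences is `C^{1,1}`. -/
theorem ConvexOn.exists_quadraticSlope [FiniteDimensional ℝ E] {g : E → ℝ}
    (hg : ConvexOn ℝ Set.univ g) {Λ : ℝ}
    (hΛ : 0 ≤ Λ) (hsc : ∀ x z, g (x + z) + g (x - z) ≤ 2 * g x + Λ * ‖z‖ ^ 2) (x : E) :
    ∃ p, QuadraticSlope Λ g x p := by
  obtain ⟨p, hp⟩ := exists_subgradient hg x
  refine ⟨p, fun z => abs_le.2 ⟨?_, ?_⟩⟩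
  · have := hp z
    nlinarith [mul_nonneg hΛ (sq_nonneg ‖z‖)]
  · have := hp (-z)
    rw [map_neg, ← sub_eq_add_neg, ← sub_eq_add_neg] at this
    linarith [hsc x z]

theorem norm_add_sq_add_norm_sub_sq (x z : E) :
    ‖x + z‖ ^ 2 + ‖x - z‖ ^ 2 = 2 * ‖x‖ ^ 2 + 2 * ‖z‖ ^ 2 := by
  have := parallelogram_law_with_norm ℝ x z
  nlinarith

/-- The largest convex minorant of a function with a convex minorant; it inherits quadratic upper
bounds on second differences. -/
theorem exists_convex_between {k G : E → ℝ} (hk : ConvexOn ℝ Set.univ k) (hkG : ∀ x, k x ≤ G x)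
    {Λ : ℝ} (hsc : ∀ x z, G (x + z) + G (x - z) ≤ 2 * G x + Λ * ‖z‖ ^ 2) :
    ∃ g : E → ℝ, ConvexOn ℝ Set.univ g ∧ (∀ x, k x ≤ g x) ∧ (∀ x, g x ≤ G x) ∧
      ∀ x z, g (x + z) + g (x - z) ≤ 2 * g x + Λ * ‖z‖ ^ 2 := by
  set S : Set (E → ℝ) := {l | ConvexOn ℝ Set.univ l ∧ ∀ x, l x ≤ G x} with hS
  set g : E → ℝ := fun x => sSup ((fun l : E → ℝ => l x) '' S) with hgdef
  have hne : ∀ x, ((fun l : E → ℝ => l x) '' S).Nonempty := fun x => ⟨k x, k, ⟨hk, hkG⟩, rfl⟩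
  have hle : ∀ l ∈ S, ∀ x, l x ≤ g x := fun l hl x =>
    le_csSup ⟨G x, by rintro _ ⟨l', hl', rfl⟩; exact hl'.2 x⟩ ⟨l, hl, rfl⟩
  have hgG : ∀ x, g x ≤ G x := fun x =>
    csSup_le (hne x) (by rintro _ ⟨l', hl', rfl⟩; exact hl'.2 x)
  have hgconv : ConvexOn ℝ Set.univ g := by
    refine ⟨convex_univ, fun x _ y _ a b ha hb hab => csSup_le (hne _) ?_⟩
    rintro _ ⟨l, hl, rfl⟩
    refine (hl.1.2 (Set.mem_univ x) (Set.mem_univ y) ha hb hab).trans ?_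
    have h1 := hle l hl x
    have h2 := hle l hl y
    simp only [smul_eq_mul]
    gcongr
  refine ⟨g, hgconv, hle k ⟨hk, hkG⟩, hgG, fun x z => ?_⟩
  have htr : ∀ w : E, ConvexOn ℝ Set.univ fun y => g (y + w) := fun w => by
    have := hgconv.translate_left w
    rwa [Set.preimage_univ] at this
  have hmem : (fun y => (1 / 2 : ℝ) • (g (y + z) + g (y + -z)) + -(Λ / 2 * ‖z‖ ^ 2)) ∈ S := by
    refine ⟨(((htr z).add (htr (-z))).smul (by norm_num)).add_const _, fun y => ?_⟩
    have := hsc y z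
    have h1 := hgG (y + z)
    have h2 := hgG (y - z)
    simp only [smul_eq_mul, ← sub_eq_add_neg]
    linarith
  have := hle _ hmem x
  simp only [smul_eq_mul, ← sub_eq_add_neg] at this
  linarith

end Regularity

section Contact

open MeasureTheory

variable {E : Type*} [NormedAddCommGroup E] [InnerProductSpace ℝ E] [FiniteDimensional ℝ E]
  [MeasurableSpace E] [BorelSpace E]

/-- If a semiconvex function lies below a semiconcave one, then at almost every contact point the
two functions are separated by a second-order jet. -/
theorem ae_exists_jet_between {κ : ℝ} (hκ : 0 ≤ κ) {U G : E → ℝ}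
    (hU : ConvexOn ℝ Set.univ fun x => U x + κ * ‖x‖ ^ 2)
    (hG : ∀ x z, G (x + z) + G (x - z) ≤ 2 * G x + 2 * κ * ‖z‖ ^ 2)
    (hUG : ∀ x, U x ≤ G x) :
    ∀ᵐ x ∂(volume : Measure E), U x = G x → ∃ (p : E →L[ℝ] ℝ) (X : E →L[ℝ] E →L[ℝ] ℝ),
      (∀ y z, X y z = X z y) ∧ ∀ τ > 0, ∀ᶠ z in 𝓝 (0 : E),
        U (x + z) ≤ U x + p z + 1 / 2 * X z z + τ * ‖z‖ ^ 2 ∧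
        U x + p z + 1 / 2 * X z z - τ * ‖z‖ ^ 2 ≤ G (x + z) := by
  obtain ⟨g, hg, hUg, hgG, hsc⟩ := exists_convex_between (G := fun x => G x + κ * ‖x‖ ^ 2)
    (Λ := 4 * κ) hU (fun x => by linarith [hUG x]) (fun x z => by
      have h1 := hG x z
      have h2 := congrArg (fun t => κ * t) (norm_add_sq_add_norm_sub_sq x z)
      linarith)
  choose P hP using hg.exists_quadraticSlope (by positivity) hsc
  have hlip : LipschitzWith (Real.toNNReal (6 * (4 * κ))) P :=
    LipschitzWith.of_dist_le_mul fun x y => by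
      rw [dist_eq_norm, dist_eq_norm, Real.coe_toNNReal _ (by positivity)]
      exact (hP x).norm_sub_le (by positivity) (hP y)
  obtain ⟨B, hB⟩ : ∃ B : E →L[ℝ] E →L[ℝ] ℝ, ∀ x y, B x y = inner ℝ x y :=
    ⟨(isBoundedBilinearMap_inner (𝕜 := ℝ) (E := E)).toContinuousLinearMap, fun _ _ => rfl⟩
  have hder : ∀ x, HasFDerivAt (fun x => g x - κ * ‖x‖ ^ 2) (P x - (2 * κ) • B x) x := by
    intro x
    have h1 := ((hasStrictFDerivAt_norm_sq x).hasFDerivAt.const_mul κ)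
    refine ((hP x).hasFDerivAt.sub h1).congr_fderiv ?_
    ext v
    simp [hB]
    ring
  filter_upwards [hlip.ae_differentiableAt (μ := volume)] with x hx hUGx
  have hX : HasFDerivAt (fun x => P x - (2 * κ) • B x)
      (fderiv ℝ P x - (2 * κ) • B) x :=
    hx.hasFDerivAt.sub (B.hasFDerivAt.const_smul (2 * κ))
  have hgx : g x - κ * ‖x‖ ^ 2 = U x := by
    have h1 := hUg x
    have h2 := hgG x
    linarith
  refine ⟨P x - (2 * κ) • B x, _, second_derivative_symmetric hder hX, fun τ hτ => ?_⟩
  filter_upwards [second_order_taylor hder hX hτ] with z hz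
  rw [hgx, abs_le] at hz
  have h1 := hUg (x + z)
  have h2 := hgG (x + z)
  constructor <;> linarith [hz.1, hz.2]

/-- A Lipschitz relation whose range contains a ball has a domain of positive measure. -/
theorem measure_domain_ne_zero {L : ℝ} (hL : 0 ≤ L) {δ : ℝ} (hδ : 0 < δ) {R : E → E → Prop}
    (hlip : ∀ x q x' q', R x q → R x' q' → ‖q - q'‖ ≤ L * ‖x - x'‖)
    (hsurj : ∀ q, ‖q‖ ≤ δ → ∃ x, R x q) :
    (volume : Measure E) {x | ∃ q, ‖q‖ ≤ δ ∧ R x q} ≠ 0 := by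
  intro h0
  set C : Set E := {x | ∃ q, ‖q‖ ≤ δ ∧ R x q} with hC
  choose! T hT using fun (x : E) (hx : x ∈ C) => hx
  have hTl : LipschitzOnWith L.toNNReal T C := LipschitzOnWith.of_dist_le_mul fun x hx y hy => by
    rw [dist_eq_norm, dist_eq_norm, Real.coe_toNNReal _ hL]
    exact hlip x _ y _ (hT x hx).2 (hT y hy).2
  have hsub : closedBall (0 : E) δ ⊆ T '' C := by
    intro q hq
    have hq' : ‖q‖ ≤ δ := by simpa using hq
    obtain ⟨x, hx⟩ := hsurj q hq'
    have hxC : x ∈ C := ⟨q, hq', hx⟩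
    refine ⟨x, hxC, ?_⟩
    have := hlip x _ x _ (hT x hxC).2 hx
    rw [sub_self, norm_zero, mul_zero] at this
    exact sub_eq_zero.1 (norm_le_zero_iff.1 this)
  have hC0 : μH[Module.finrank ℝ E] C = 0 := by
    exact Measure.absolutelyContinuous_isAddHaarMeasure μH[Module.finrank ℝ E] volume h0
  have himg : μH[Module.finrank ℝ E] (T '' C) = 0 := by
    refine nonpos_iff_eq_zero.1 ((hTl.hausdorffMeasure_image_le (by positivity)).trans ?_)
    rw [hC0, mul_zero]
  have hball : μH[Module.finrank ℝ E] (closedBall (0 : E) δ) = 0 := measure_mono_null hsub himg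
  exact (measure_closedBall_pos _ _ hδ).ne' hball

end Contact

section SupConvolution

variable {E : Type*} [NormedAddCommGroup E]

/-- The sup-convolution of `u`, restricted to `K`, with a paraboloid of opening `κ`. -/
def supConv (K : Set E) (κ : ℝ) (u : E → ℝ) (x : E) : ℝ :=
  sSup ((fun y => u y - κ * ‖x - y‖ ^ 2) '' K)

variable {K : Set E} {κ : ℝ} {u : E → ℝ}

theorem exists_isMaxOn_supConv (hK : IsCompact K) (hne : K.Nonempty) (hu : ContinuousOn u K)
    (x : E) : ∃ y ∈ K, supConv K κ u x = u y - κ * ‖x - y‖ ^ 2 ∧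
      ∀ z ∈ K, u z - κ * ‖x - z‖ ^ 2 ≤ supConv K κ u x := by
  have hc : ContinuousOn (fun y => u y - κ * ‖x - y‖ ^ 2) K := by fun_prop
  obtain ⟨y, hy, hmax⟩ := hK.exists_isMaxOn hne hc
  have hlub : IsGreatest ((fun y => u y - κ * ‖x - y‖ ^ 2) '' K) (u y - κ * ‖x - y‖ ^ 2) :=
    ⟨⟨y, hy, rfl⟩, by rintro _ ⟨z, hz, rfl⟩; exact hmax hz⟩
  have heq : supConv K κ u x = u y - κ * ‖x - y‖ ^ 2 := hlub.csSup_eq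
  refine ⟨y, hy, heq, fun z hz => ?_⟩
  rw [heq]
  exact hmax hz

theorem le_supConv (hK : IsCompact K) (hu : ContinuousOn u K) {y : E} (hy : y ∈ K) (x : E) :
    u y - κ * ‖x - y‖ ^ 2 ≤ supConv K κ u x := by
  obtain ⟨_, _, _, h⟩ := exists_isMaxOn_supConv (κ := κ) hK ⟨y, hy⟩ hu x
  exact h y hy

variable [InnerProductSpace ℝ E]

theorem convexOn_supConv (hK : IsCompact K) (hne : K.Nonempty) (hu : ContinuousOn u K) :
    ConvexOn ℝ Set.univ fun x => supConv K κ u x + κ * ‖x‖ ^ 2 := by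
  have key : ∀ x y : E, u y - κ * ‖x - y‖ ^ 2 + κ * ‖x‖ ^ 2
      = u y - κ * ‖y‖ ^ 2 + 2 * κ * inner ℝ x y := fun x y => by
    rw [norm_sub_sq_real]; ring
  refine ⟨convex_univ, fun x _ z _ a b ha hb hab => ?_⟩
  obtain ⟨y, hy, heq, -⟩ := exists_isMaxOn_supConv (κ := κ) hK hne hu (a • x + b • z)
  have h1 := mul_le_mul_of_nonneg_left (le_supConv (κ := κ) hK hu hy x) ha
  have h2 := mul_le_mul_of_nonneg_left (le_supConv (κ := κ) hK hu hy z) hb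
  have k1 := congrArg (fun t => a * t) (key x y)
  have k2 := congrArg (fun t => b * t) (key z y)
  simp only [smul_eq_mul] at *
  rw [heq, key, inner_add_left, real_inner_smul_left, real_inner_smul_left]
  have hb' : b = 1 - a := by linarith
  subst hb'
  linarith

theorem supConv_second_difference (hK : IsCompact K) (hne : K.Nonempty) (hu : ContinuousOn u K)
    (x z : E) :
    2 * supConv K κ u x - 2 * κ * ‖z‖ ^ 2 ≤ supConv K κ u (x + z) + supConv K κ u (x - z) := by
  obtain ⟨y, hy, heq, -⟩ := exists_isMaxOn_supConv (κ := κ) hK hne hu x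
  have h1 := le_supConv (κ := κ) hK hu hy (x + z)
  have h2 := le_supConv (κ := κ) hK hu hy (x - z)
  have h3 := congrArg (fun t => κ * t) (norm_add_sq_add_norm_sub_sq (x - y) z)
  rw [show x + z - y = x - y + z by abel] at h1
  rw [show x - z - y = x - y - z by abel] at h2
  rw [heq]
  linarith

/-- The difference of a sup-convolution and an inf-convolution, tilted by a linear function,
attains its maximum. -/
theorem exists_max_supConv_add {w : E → ℝ} (hκ : 0 < κ) (hK : IsCompact K) (hne : K.Nonempty)
    (hu : ContinuousOn u K) (hw : ContinuousOn w K) (q : E) :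
    ∃ x, ∀ x', supConv K κ u x' + supConv K κ w x' ≤
      supConv K κ u x + supConv K κ w x + inner ℝ q (x' - x) := by
  have hc : ContinuousOn (fun s : E × E => u s.1 + w s.2 - κ / 2 * ‖s.1 - s.2‖ ^ 2
      - inner ℝ q ((1 / 2 : ℝ) • (s.1 + s.2))) (K ×ˢ K) := by
    have h1 : ContinuousOn (fun s : E × E => u s.1) (K ×ˢ K) :=
      hu.comp continuousOn_fst fun s hs => hs.1
    have h2 : ContinuousOn (fun s : E × E => w s.2) (K ×ˢ K) :=
      hw.comp continuousOn_snd fun s hs => hs.2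
    have h3 : Continuous fun s : E × E => κ / 2 * ‖s.1 - s.2‖ ^ 2 := by fun_prop
    have h4 : Continuous fun s : E × E => inner ℝ q ((1 / 2 : ℝ) • (s.1 + s.2)) := by fun_prop
    exact ((h1.add h2).sub h3.continuousOn).sub h4.continuousOn
  obtain ⟨⟨y, z⟩, ⟨hy, hz⟩, hmax⟩ := (hK.prod hK).exists_isMaxOn (hne.prod hne) hc
  have expand : ∀ x y z : E, κ * ‖x - y‖ ^ 2 + κ * ‖x - z‖ ^ 2 + inner ℝ q x =
      2 * κ * ‖x - (1 / 2 : ℝ) • (y + z) + (1 / (4 * κ)) • q‖ ^ 2 + κ / 2 * ‖y - z‖ ^ 2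
        + inner ℝ q ((1 / 2 : ℝ) • (y + z)) - ‖q‖ ^ 2 / (8 * κ) := by
    intro x y z
    simp only [← real_inner_self_eq_norm_sq, inner_add_left, inner_add_right, inner_sub_left,
      inner_sub_right, real_inner_smul_left, real_inner_smul_right]
    rw [real_inner_comm y x, real_inner_comm z x, real_inner_comm z y, real_inner_comm x q,
      real_inner_comm y q, real_inner_comm z q]
    field_simp
    ring
  refine ⟨(1 / 2 : ℝ) • (y + z) - (1 / (4 * κ)) • q, fun x' => ?_⟩
  set x := (1 / 2 : ℝ) • (y + z) - (1 / (4 * κ)) • q with hx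
  obtain ⟨y', hy', hey, -⟩ := exists_isMaxOn_supConv (κ := κ) hK hne hu x'
  obtain ⟨z', hz', hez, -⟩ := exists_isMaxOn_supConv (κ := κ) hK hne hw x'
  have h1 := le_supConv (κ := κ) hK hu hy x
  have h2 := le_supConv (κ := κ) hK hw hz x
  have h3 := hmax (show (y', z') ∈ K ×ˢ K from ⟨hy', hz'⟩)
  have e1 := expand x y z
  have e2 := expand x' y' z'
  rw [show x - (1 / 2 : ℝ) • (y + z) + (1 / (4 * κ)) • q = 0 by rw [hx]; abel, norm_zero] at e1
  have h4 : 0 ≤ 2 * κ * ‖x' - (1 / 2 : ℝ) • (y' + z') + (1 / (4 * κ)) • q‖ ^ 2 := by positivity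
  simp only [Set.mem_ofPred_eq] at h3
  rw [hey, hez, inner_sub_right]
  linarith

end SupConvolution

section CommonJet

open MeasureTheory

variable {E : Type*} [NormedAddCommGroup E]

/-- Near the diagonal, `u y - w z` stays below `μ` as soon as one of the points is on the boundary
of `K`, provided this holds on the diagonal. -/
theorem exists_dist_lower_bound {K : Set E} (hK : IsCompact K) {u w : E → ℝ}
    (hu : ContinuousOn u K) (hw : ContinuousOn w K) {μ : ℝ}
    (hbd : ∀ x ∈ K, x ∉ interior K → u x - w x < μ) :
    ∃ r > 0, ∀ y ∈ K, ∀ z ∈ K, ¬(y ∈ interior K ∧ z ∈ interior K) → μ ≤ u y - w z →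
      r ≤ ‖y - z‖ := by
  set B : Set (E × E) := {s | s ∈ (K ×ˢ K) ∩ (interior K ×ˢ interior K)ᶜ ∧
    μ ≤ u s.1 - w s.2} with hB
  have hcomp : IsCompact ((K ×ˢ K) ∩ (interior K ×ˢ interior K)ᶜ) :=
    (hK.prod hK).inter_right (isOpen_interior.prod isOpen_interior).isClosed_compl
  have hcont : ContinuousOn (fun s : E × E => u s.1 - w s.2)
      ((K ×ˢ K) ∩ (interior K ×ˢ interior K)ᶜ) :=
    (hu.comp continuousOn_fst fun s hs => hs.1.1).sub
      (hw.comp continuousOn_snd fun s hs => hs.1.2)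
  have hBc : IsCompact B := by
    have := hcont.preimage_isClosed_of_isClosed hcomp.isClosed (isClosed_Ici (a := μ))
    exact hcomp.of_isClosed_subset this fun s hs => hs.1
  rcases B.eq_empty_or_nonempty with he | hne
  · refine ⟨1, one_pos, fun y hy z hz hint hμ => absurd (?_ : (y, z) ∈ B) (by simp [he])⟩
    exact ⟨⟨⟨hy, hz⟩, hint⟩, hμ⟩
  · obtain ⟨s, hs, hmin⟩ := hBc.exists_isMinOn hne
      (f := fun s : E × E => ‖s.1 - s.2‖) (by fun_prop)
    refine ⟨‖s.1 - s.2‖, ?_, fun y hy z hz hint hμ => ?_⟩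
    · refine norm_pos_iff.2 fun h0 => ?_
      have heq : s.1 = s.2 := sub_eq_zero.1 h0
      have h1 : s.1 ∉ interior K := fun h => hs.1.2 ⟨h, heq ▸ h⟩
      have h2 := hbd _ hs.1.1.1 h1
      have h3 := hs.2
      rw [← heq] at h3
      linarith
    · exact hmin (show (y, z) ∈ B from ⟨⟨⟨hy, hz⟩, hint⟩, hμ⟩)

variable [InnerProductSpace ℝ E]

/-- The lower envelope of the affine functions of slope at most `δ` lying above `D`. -/
def affineEnvelope (δ : ℝ) (D : E → ℝ) (x : E) : ℝ :=
  sInf ((fun s : E × ℝ => s.2 + inner ℝ s.1 x) ''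
    {s | ‖s.1‖ ≤ δ ∧ ∀ y, D y ≤ s.2 + inner ℝ s.1 y})

variable {δ : ℝ} {D : E → ℝ}

theorem affineEnvelope_le {q : E} {c : ℝ} (hq : ‖q‖ ≤ δ) (h : ∀ y, D y ≤ c + inner ℝ q y)
    (x : E) : affineEnvelope δ D x ≤ c + inner ℝ q x := by
  refine csInf_le ⟨D x, ?_⟩ ⟨(q, c), ⟨hq, h⟩, rfl⟩
  rintro _ ⟨s, hs, rfl⟩
  exact hs.2 x

theorem le_affineEnvelope {t : ℝ} {x q₀ : E} {c₀ : ℝ} (hq₀ : ‖q₀‖ ≤ δ)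
    (h₀ : ∀ y, D y ≤ c₀ + inner ℝ q₀ y)
    (h : ∀ q c, ‖q‖ ≤ δ → (∀ y, D y ≤ c + inner ℝ q y) → t ≤ c + inner ℝ q x) :
    t ≤ affineEnvelope δ D x := by
  refine le_csInf ⟨_, (q₀, c₀), ⟨hq₀, h₀⟩, rfl⟩ ?_
  rintro _ ⟨s, hs, rfl⟩
  exact h s.1 s.2 hs.1 hs.2

/-- A form of the theorem on sums: if `u - w` is larger inside the compact set `K` than on its
boundary, then `u` from above and `w` from below are touched, at nearby interior points, by
quadratic functions with almost the same derivatives. -/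
theorem exists_common_jet [FiniteDimensional ℝ E] {K : Set E} (hK : IsCompact K) {u w : E → ℝ}
    (hu : ContinuousOn u K) (hw : ContinuousOn w K) {μ : ℝ}
    (hbd : ∀ x ∈ K, x ∉ interior K → u x - w x < μ) {xb : E} (hxb : xb ∈ K)
    (hμ : μ < u xb - w xb) {τ : ℝ} (hτ : 0 < τ) :
    ∃ y₀ ∈ interior K, ∃ z₀ ∈ interior K, ∃ (q : E) (p : E →L[ℝ] ℝ) (X : E →L[ℝ] E →L[ℝ] ℝ),
      ‖q‖ ≤ τ ∧ μ ≤ u y₀ - w z₀ ∧ (∀ y z, X y z = X z y) ∧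
      (∀ᶠ z in 𝓝 (0 : E), u (y₀ + z) ≤ u y₀ + p z + 1 / 2 * X z z + τ * ‖z‖ ^ 2) ∧
      ∀ᶠ z in 𝓝 (0 : E), w z₀ + p z - inner ℝ q z + 1 / 2 * X z z - τ * ‖z‖ ^ 2 ≤
        w (z₀ + z) := by
  borelize E
  have hne : K.Nonempty := ⟨xb, hxb⟩
  obtain ⟨r, hr, hdist⟩ := exists_dist_lower_bound hK hu hw hbd
  obtain ⟨R, hR⟩ : ∃ R, ∀ x ∈ K, ‖x‖ ≤ R := hK.isBounded.exists_norm_le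
  have hR0 : 0 ≤ R := (norm_nonneg _).trans (hR xb hxb)
  obtain ⟨yM, -, hyM⟩ := hK.exists_isMaxOn hne hu
  obtain ⟨zM, -, hzM⟩ := hK.exists_isMinOn hne hw
  set M := u yM - w zM with hM
  have hMle : ∀ y ∈ K, ∀ z ∈ K, u y - w z ≤ M := fun y hy z hz => by
    have h1 : u y ≤ u yM := hyM hy
    have h2 : w zM ≤ w z := hzM hz
    linarith
  obtain ⟨κ, hκ1, hκr⟩ : ∃ κ : ℝ, 1 ≤ κ ∧ M - μ < κ * (r ^ 2 / 4) := by
    refine ⟨max 1 ((M - μ) / (r ^ 2 / 4) + 1), le_max_left _ _, ?_⟩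
    rw [← div_lt_iff₀ (by positivity)]
    exact (lt_add_one _).trans_le (le_max_right _ _)
  obtain ⟨δ, hδ, hδτ, hδ1, hδμ⟩ : ∃ δ : ℝ, 0 < δ ∧ δ ≤ τ ∧ δ ≤ 1 ∧
      δ * (2 * R + 1) ≤ u xb - w xb - μ := by
    refine ⟨min τ (min 1 ((u xb - w xb - μ) / (2 * R + 1))), ?_, min_le_left _ _,
      (min_le_right _ _).trans (min_le_left _ _), ?_⟩
    · have : 0 < u xb - w xb - μ := by linarith
      positivity
    · rw [← le_div_iff₀ (by positivity)]
      exact (min_le_right _ _).trans (min_le_right _ _)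
  have hκ0 : 0 < κ := one_pos.trans_le hκ1
  have hw' : ContinuousOn (fun y => -w y) K := hw.neg
  set U := supConv K κ u with hUdef
  set V := supConv K κ (fun y => -w y) with hVdef
  set D : E → ℝ := fun x => U x + V x with hD
  set Rel : E → E → Prop := fun x q => ∀ x', D x' ≤ D x + inner ℝ q (x' - x) with hRel
  have hslope : ∀ x q, Rel x q → QuadraticSlope (4 * κ) D x (innerSL ℝ q) := by
    intro x q h z
    have h1 := h (x + z)
    have h2 := h (x - z)
    have h3 := supConv_second_difference (κ := κ) hK hne hu x z
    have h4 := supConv_second_difference (κ := κ) hK hne hw' x z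
    rw [show x + z - x = z by abel] at h1
    rw [show x - z - x = -z by abel, inner_neg_right] at h2
    have h5 : 0 ≤ κ * ‖z‖ ^ 2 := by positivity
    rw [innerSL_apply_apply, abs_le]
    simp only [hD] at h1 h2 ⊢
    constructor <;> linarith
  have hmeas := measure_domain_ne_zero (L := 6 * (4 * κ)) (by positivity) hδ (R := Rel)
    (fun x q x' q' h h' => by
      have := (hslope x q h).norm_sub_le (by positivity) (hslope x' q' h')
      rwa [← map_sub, innerSL_apply_norm] at this)
    (fun q _ => exists_max_supConv_add hκ0 hK hne hu hw' q)
  have haff : ∀ {x q}, Rel x q → ∀ y, D y ≤ (D x - inner ℝ q x) + inner ℝ q y := by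
    intro x q h y
    have := h y
    rw [inner_sub_right] at this
    linarith
  obtain ⟨x₁, h₁⟩ := exists_max_supConv_add hκ0 hK hne hu hw' (0 : E)
  have haff₁ := haff (x := x₁) (q := 0) h₁
  have h0δ : ‖(0 : E)‖ ≤ δ := by simpa using hδ.le
  have hDΓ : ∀ x, D x ≤ affineEnvelope δ D x := fun x =>
    le_affineEnvelope h0δ haff₁ fun q c _ h => h x
  have hjet := ae_exists_jet_between (κ := κ) hκ0.le (U := U)
    (G := fun x => -V x + affineEnvelope δ D x) (convexOn_supConv hK hne hu) (fun x z => by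
      have h1 := supConv_second_difference (κ := κ) hK hne hw' x z
      have h2 : (affineEnvelope δ D (x + z) + affineEnvelope δ D (x - z)) / 2 ≤
          affineEnvelope δ D x := by
        refine le_affineEnvelope h0δ haff₁ fun q c hq h => ?_
        have h3 := affineEnvelope_le hq h (x + z)
        have h4 := affineEnvelope_le hq h (x - z)
        rw [inner_add_right] at h3
        rw [inner_sub_right] at h4
        linarith
      linarith) (fun x => by
      have := hDΓ x
      simp only [hD] at this
      linarith)
  obtain ⟨x, ⟨q, hq, hxq⟩, hx⟩ : ∃ x ∈ {x | ∃ q, ‖q‖ ≤ δ ∧ Rel x q}, U x =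
      -V x + affineEnvelope δ D x → ∃ (p : E →L[ℝ] ℝ) (X : E →L[ℝ] E →L[ℝ] ℝ),
      (∀ y z, X y z = X z y) ∧ ∀ τ > 0, ∀ᶠ z in 𝓝 (0 : E),
        U (x + z) ≤ U x + p z + 1 / 2 * X z z + τ * ‖z‖ ^ 2 ∧
        U x + p z + 1 / 2 * X z z - τ * ‖z‖ ^ 2 ≤ -V (x + z) + affineEnvelope δ D (x + z) := by
    by_contra hcon
    refine hmeas (measure_mono_null (fun x hx => ?_) (ae_iff.1 hjet))
    exact fun h => hcon ⟨x, hx, h⟩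
  have hΓle := affineEnvelope_le hq (haff hxq)
  have hDx : D x = U x + V x := rfl
  obtain ⟨p, X, hsymm, hpX⟩ := hx (by
    have h1 := hDΓ x
    have h2 := hΓle x
    linarith)
  obtain ⟨y₀, hy₀, hUy, -⟩ := exists_isMaxOn_supConv (κ := κ) hK hne hu x
  obtain ⟨z₀, hz₀, hVz, -⟩ := exists_isMaxOn_supConv (κ := κ) hK hne hw' x
  rw [← hUdef] at hUy
  rw [← hVdef] at hVz
  have hlow : μ + κ / 4 * ‖y₀ - z₀‖ ^ 2 ≤ u y₀ - w z₀ := by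
    have h1 := hxq xb
    have h2 : u xb - w xb ≤ D xb := by
      have h3 := le_supConv (κ := κ) hK hu hxb xb
      have h4 := le_supConv (κ := κ) hK hw' hxb xb
      simp only [sub_self, norm_zero] at h3 h4
      simp only [hD]
      linarith
    have h5 : inner ℝ q (xb - x) ≤ δ * (‖x - y₀‖ + 2 * R) := by
      refine (real_inner_le_norm _ _).trans ?_
      gcongr
      calc ‖xb - x‖ = ‖xb - y₀ - (x - y₀)‖ := by congr 1; abel
        _ ≤ ‖xb‖ + ‖y₀‖ + ‖x - y₀‖ := (norm_sub_le _ _).trans (by gcongr; exact norm_sub_le _ _)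
        _ ≤ ‖x - y₀‖ + 2 * R := by linarith [hR xb hxb, hR y₀ hy₀]
    have h6 : δ * ‖x - y₀‖ ≤ κ / 2 * ‖x - y₀‖ ^ 2 + δ := by
      nlinarith [sq_nonneg (‖x - y₀‖ - δ), sq_nonneg ‖x - y₀‖]
    have h7 : ‖y₀ - z₀‖ ^ 2 ≤ 2 * (‖x - y₀‖ ^ 2 + ‖x - z₀‖ ^ 2) := by
      have h8 : ‖y₀ - z₀‖ ≤ ‖x - z₀‖ + ‖x - y₀‖ := by
        calc ‖y₀ - z₀‖ = ‖x - z₀ - (x - y₀)‖ := by congr 1; abel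
          _ ≤ _ := norm_sub_le _ _
      nlinarith [norm_nonneg (y₀ - z₀), sq_nonneg (‖x - y₀‖ - ‖x - z₀‖)]
    have h9 := mul_le_mul_of_nonneg_left h7 hκ0.le
    have h10 : 0 ≤ κ * ‖x - z₀‖ ^ 2 := by positivity
    linarith
  have hμle : μ ≤ u y₀ - w z₀ := by
    have : 0 ≤ κ / 4 * ‖y₀ - z₀‖ ^ 2 := by positivity
    linarith
  have hint : y₀ ∈ interior K ∧ z₀ ∈ interior K := by
    by_contra hcon
    have h1 := hdist y₀ hy₀ z₀ hz₀ hcon hμle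
    have h2 := hMle y₀ hy₀ z₀ hz₀
    have h3 : r ^ 2 ≤ ‖y₀ - z₀‖ ^ 2 := by gcongr
    nlinarith
  have hnear : ∀ y ∈ interior K, ∀ᶠ z in 𝓝 (0 : E), y + z ∈ K := fun y hy => by
    have : Tendsto (fun z : E => y + z) (𝓝 0) (𝓝 y) := by
      have h : Continuous fun z : E => y + z := by fun_prop
      simpa using h.tendsto 0
    exact this.eventually (mem_interior_iff_mem_nhds.1 hy)
  refine ⟨y₀, hint.1, z₀, hint.2, q, p, X, hq.trans hδτ, hμle, hsymm, ?_, ?_⟩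
  · filter_upwards [hnear y₀ hint.1, hpX τ hτ] with z hzK hz
    have h1 := le_supConv (κ := κ) hK hu hzK (x + z)
    rw [show x + z - (y₀ + z) = x - y₀ by abel] at h1
    linarith [hz.1]
  · filter_upwards [hnear z₀ hint.2, hpX τ hτ] with z hzK hz
    have h1 := le_supConv (κ := κ) hK hw' hzK (x + z)
    rw [show x + z - (z₀ + z) = x - z₀ by abel] at h1
    have h2 := hΓle (x + z)
    rw [inner_add_right] at h2
    linarith [hz.2]

end CommonJet

section TestFunctions

variable {N : ℕ}

theorem norm_gradient (φ : ESp N → ℝ) (x : ESp N) : ‖gradient φ x‖ = ‖fderiv ℝ φ x‖ := by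
  simp [gradient]

theorem fderiv_eq_zero_of_const_ball {u : ESp N → ℝ} {x : ESp N} {δ c : ℝ} (hδ : 0 < δ)
    (h : ∀ y ∈ ball x δ, u y = c) : fderiv ℝ u x = 0 := by
  have : u =ᶠ[𝓝 x] fun _ => c := by
    filter_upwards [ball_mem_nhds x hδ] with y hy using h y hy
  rw [this.fderiv_eq]
  simp

theorem ViscSub.le_of_isLocalMax {α : ℝ} {Ftil : Matrix (Fin N) (Fin N) ℝ → ℝ}
    {g : ESp N → ℝ → ℝ} {Ω : Set (ESp N)} {u : ESp N → ℝ} (hu : ViscSub α Ftil g Ω u)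
    {x : ESp N} (hx : x ∈ Ω) (hd : DifferentiableAt ℝ u x) (h0 : fderiv ℝ u x ≠ 0)
    {φ : ESp N → ℝ} (hφ : ContDiff ℝ 2 φ) (hmax : IsLocalMax (fun y => u y - φ y) x) :
    fderiv ℝ φ x = fderiv ℝ u x ∧
      g x (u x) ≤ ‖fderiv ℝ u x‖ ^ α * Ftil (hessianMatrix φ x) := by
  have hφd : DifferentiableAt ℝ φ x := hφ.differentiable (by norm_num) x
  have heq : fderiv ℝ φ x = fderiv ℝ u x := by
    have h := hmax.fderiv_eq_zero
    rw [fderiv_fun_sub hd hφd] at h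
    exact (sub_eq_zero.1 h).symm
  refine ⟨heq, ?_⟩
  rcases hu x hx with ⟨δ, hδ, c, -, hc, -⟩ | h
  · exact absurd (fderiv_eq_zero_of_const_ball hδ hc) h0
  · have h1 := h φ hφ hmax (norm_ne_zero_iff.1 (by
      rw [norm_gradient, heq]; exact norm_ne_zero_iff.2 h0))
    rwa [norm_gradient, heq] at h1

theorem ViscSuper.le_of_isLocalMin {α : ℝ} {Ftil : Matrix (Fin N) (Fin N) ℝ → ℝ}
    {g : ESp N → ℝ → ℝ} {Ω : Set (ESp N)} {v : ESp N → ℝ} (hv : ViscSuper α Ftil g Ω v)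
    {x : ESp N} (hx : x ∈ Ω) (hd : DifferentiableAt ℝ v x) (h0 : fderiv ℝ v x ≠ 0)
    {φ : ESp N → ℝ} (hφ : ContDiff ℝ 2 φ) (hmin : IsLocalMin (fun y => v y - φ y) x) :
    fderiv ℝ φ x = fderiv ℝ v x ∧
      ‖fderiv ℝ v x‖ ^ α * Ftil (hessianMatrix φ x) ≤ g x (v x) := by
  have hφd : DifferentiableAt ℝ φ x := hφ.differentiable (by norm_num) x
  have heq : fderiv ℝ φ x = fderiv ℝ v x := by
    have h := hmin.fderiv_eq_zero
    rw [fderiv_fun_sub hd hφd] at h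
    exact (sub_eq_zero.1 h).symm
  refine ⟨heq, ?_⟩
  rcases hv x hx with ⟨δ, hδ, c, -, hc, -⟩ | h
  · exact absurd (fderiv_eq_zero_of_const_ball hδ hc) h0
  · have h1 := h φ hφ hmin (norm_ne_zero_iff.1 (by
      rw [norm_gradient, heq]; exact norm_ne_zero_iff.2 h0))
    rwa [norm_gradient, heq] at h1

variable [NeZero N]

/-- A quadratic polynomial centred at `x₀` plus an exponential barrier in the first coordinate and
a quadratic penalization at infinity. -/
def barrierTest (p : ESp N →L[ℝ] ℝ) (X : ESp N →L[ℝ] ESp N →L[ℝ] ℝ) (x₀ : ESp N)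
    (τ s k b η : ℝ) (y : ESp N) : ℝ :=
  p (y - x₀) + 1 / 2 * X (y - x₀) (y - x₀) + τ * ‖y - x₀‖ ^ 2 + s * exp (k * (y 0 - b))
    + η * ‖y‖ ^ 2

/-- The matrix of a bilinear form in the standard basis. -/
def bilinMatrix (X : ESp N →L[ℝ] ESp N →L[ℝ] ℝ) : Matrix (Fin N) (Fin N) ℝ :=
  Matrix.of fun i j => X (EuclideanSpace.single i 1) (EuclideanSpace.single j 1)

variable {p : ESp N →L[ℝ] ℝ} {X : ESp N →L[ℝ] ESp N →L[ℝ] ℝ} {x₀ : ESp N} {τ s k b η : ℝ}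

theorem contDiff_barrierTest : ContDiff ℝ 2 (barrierTest p X x₀ τ s k b η) := by
  have h0 : ContDiff ℝ 2 fun y : ESp N => y 0 :=
    (EuclideanSpace.proj (𝕜 := ℝ) (0 : Fin N)).contDiff
  have hs : ContDiff ℝ 2 fun y : ESp N => y - x₀ := contDiff_id.sub contDiff_const
  have hX : ContDiff ℝ 2 fun y : ESp N => X (y - x₀) (y - x₀) :=
    (X.contDiff.comp hs).clm_apply hs
  exact ((((p.contDiff.comp hs).add (contDiff_const.mul hX)).add
    (contDiff_const.mul (hs.norm_sq ℝ))).add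
    (contDiff_const.mul (contDiff_const.mul (h0.sub contDiff_const)).exp)).add
    (contDiff_const.mul (contDiff_id.norm_sq ℝ))

theorem hasFDerivAt_barrierTest (hX : ∀ y z, X y z = X z y) (y : ESp N) :
    HasFDerivAt (barrierTest p X x₀ τ s k b η)
      (p + X (y - x₀) + (2 * τ) • innerSL ℝ (y - x₀)
        + (s * k * exp (k * (y 0 - b))) • EuclideanSpace.proj (0 : Fin N)
        + (2 * η) • innerSL ℝ y) y := by
  have hs : HasFDerivAt (fun y : ESp N => y - x₀) (ContinuousLinearMap.id ℝ (ESp N)) y :=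
    (hasFDerivAt_id y).sub_const x₀
  have h1 : HasFDerivAt (fun y => p (y - x₀)) p y := p.hasFDerivAt.comp y hs
  have h2 := X.hasFDerivAt_of_bilinear hs hs
  have h3 := hs.norm_sq
  have h4 : HasFDerivAt (fun y : ESp N => exp (k * (y 0 - b)))
      (exp (k * (y 0 - b)) • k • EuclideanSpace.proj (𝕜 := ℝ) (0 : Fin N)) y :=
    ((((EuclideanSpace.proj (𝕜 := ℝ) (0 : Fin N)).hasFDerivAt).sub_const b).const_mul k).exp
  have h5 := (hasStrictFDerivAt_norm_sq y).hasFDerivAt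
  refine (((((h1.add (h2.const_mul (1 / 2))).add (h3.const_mul τ)).add (h4.const_mul s)).add
    (h5.const_mul η))).congr_fderiv ?_
  ext v
  simp [hX v]
  ring

theorem hessianMatrix_barrierTest (hX : ∀ y z, X y z = X z y) (y : ESp N) :
    hessianMatrix (barrierTest p X x₀ τ s k b η) y = bilinMatrix X
      + (s * k ^ 2 * exp (k * (y 0 - b))) • Matrix.single 0 0 (1 : ℝ)
      + (2 * τ + 2 * η) • (1 : Matrix (Fin N) (Fin N) ℝ) := by
  ext i j
  have hfd : (fun y => fderiv ℝ (barrierTest p X x₀ τ s k b η) y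
      (EuclideanSpace.single j (1 : ℝ))) = fun y : ESp N => p (EuclideanSpace.single j 1)
        + X (EuclideanSpace.single j 1) (y - x₀) + (2 * τ) * (y - x₀) j
        + (s * k * exp (k * (y 0 - b))) * (EuclideanSpace.single j (1 : ℝ) : ESp N) 0
        + (2 * η) * y j := by
    ext y
    rw [(hasFDerivAt_barrierTest hX y).fderiv]
    simp [hX _ (y - x₀), EuclideanSpace.inner_single_right]
  have hproj : ∀ l : Fin N, HasFDerivAt (fun y : ESp N => y l)
      (EuclideanSpace.proj (𝕜 := ℝ) l) y := fun l =>
    (EuclideanSpace.proj (𝕜 := ℝ) l).hasFDerivAt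
  have h1 : HasFDerivAt (fun y : ESp N => X (EuclideanSpace.single j 1) (y - x₀))
      (X (EuclideanSpace.single j 1)) y :=
    (X (EuclideanSpace.single j 1)).hasFDerivAt.comp y ((hasFDerivAt_id y).sub_const x₀)
  have h2 : HasFDerivAt (fun y : ESp N => (y - x₀) j) (EuclideanSpace.proj (𝕜 := ℝ) j) y :=
    (hproj j).sub_const (x₀ j)
  have h3 := (((hproj 0).sub_const b).const_mul k).exp
  have h4 := ((((h1.const_add (p (EuclideanSpace.single j 1))).add (h2.const_mul (2 * τ))).add
    ((h3.const_mul (s * k)).mul_const ((EuclideanSpace.single j (1 : ℝ) : ESp N) 0))).add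
    ((hproj j).const_mul (2 * η)))
  rw [hessianMatrix, Matrix.of_apply, hfd]
  erw [h4.fderiv]
  rw [bilinMatrix]
  simp only [Matrix.add_apply, Matrix.smul_apply, Matrix.of_apply, Matrix.single_apply,
    Matrix.one_apply, smul_eq_mul]
  clear h1 h2 h3 h4 hproj hfd
  simp only [hX (EuclideanSpace.single i 1) (EuclideanSpace.single j 1)]
  by_cases hi : 0 = i <;> by_cases hj : 0 = j
  · subst hi hj
    simp
    ring
  · subst hi
    simp [hj, Ne.symm hj]
  · subst hj
    simp [hi, Ne.symm hi]
  · by_cases hij : i = j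
    · subst hij
      simp [hi]
      ring
    · simp [hi, hj, hij, Ne.symm hij]

end TestFunctions

section StripComparison

theorem UniformlyElliptic.mul_le_of_add_eq {N : ℕ} [NeZero N] {a A : ℝ}
    {Ftil : Matrix (Fin N) (Fin N) ℝ → ℝ} (hF : UniformlyElliptic N a A Ftil)
    {M₁ M₂ : Matrix (Fin N) (Fin N) ℝ} (h₁ : M₁.IsSymm) (h₂ : M₂.IsSymm) {e r : ℝ}
    (he : 0 ≤ e) (hr : 0 ≤ r)
    (h : M₂ + r • (1 : Matrix (Fin N) (Fin N) ℝ) = M₁ + e • Matrix.single 0 0 (1 : ℝ)) :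
    a * e ≤ Ftil M₂ - Ftil M₁ + A * (N * r) := by
  have hone : (r • (1 : Matrix (Fin N) (Fin N) ℝ)).PosSemidef := Matrix.PosSemidef.one.smul hr
  have hsingle : (e • Matrix.single (0 : Fin N) 0 (1 : ℝ)).PosSemidef := by
    rw [← Matrix.diagonal_single]
    exact (Matrix.PosSemidef.diagonal (Pi.single_nonneg.2 zero_le_one)).smul he
  have hs1 : (r • (1 : Matrix (Fin N) (Fin N) ℝ)).IsSymm := Matrix.isSymm_one.smul r
  have hs2 : (e • Matrix.single (0 : Fin N) 0 (1 : ℝ)).IsSymm := by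
    rw [← Matrix.diagonal_single]
    exact (Matrix.isSymm_diagonal _).smul e
  have h3 := (hF.2 M₂ _ h₂ hs1 hone).2
  have h4 := (hF.2 M₁ _ h₁ hs2 hsingle).1
  rw [h] at h3
  simp only [Matrix.trace_smul, Matrix.trace_one, Fintype.card_fin, smul_eq_mul,
    Matrix.trace_single_eq_same, mul_one] at h3 h4
  linarith [mul_comm r (N : ℝ)]

theorem exists_abs_rpow_neg_sub_le {m : ℝ} (hm : 0 < m) {α : ℝ} (hα : -1 < α) :
    ∃ L, 0 ≤ L ∧ ∀ s, m ≤ s → ∀ t, m ≤ t → |s ^ (-α) - t ^ (-α)| ≤ L * |s - t| := by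
  refine ⟨|α| * m ^ (-α - 1), by positivity, fun s hs t ht => ?_⟩
  have hd : ∀ x ∈ Set.Ici m,
      HasDerivWithinAt (fun x : ℝ => x ^ (-α)) (-α * x ^ (-α - 1)) (Set.Ici m) x := fun x hx =>
    (hasDerivAt_rpow_const (Or.inl (hm.trans_le hx).ne')).hasDerivWithinAt
  refine (convex_Ici m).norm_image_sub_le_of_norm_hasDerivWithin_le hd (fun x hx => ?_) ht hs
  rw [norm_mul, norm_neg, norm_eq_abs, norm_eq_abs,
    abs_of_nonneg (rpow_nonneg (hm.le.trans hx) _)]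
  exact mul_le_mul_of_nonneg_left (rpow_le_rpow_of_nonpos hm hx (by linarith)) (abs_nonneg _)

theorem bilinMatrix_isSymm {N : ℕ} {X : ESp N →L[ℝ] ESp N →L[ℝ] ℝ}
    (hX : ∀ y z, X y z = X z y) : (bilinMatrix X).IsSymm :=
  Matrix.IsSymm.ext fun _ _ => hX _ _

theorem hessianMatrix_barrierTest_isSymm {N : ℕ} [NeZero N] {p : ESp N →L[ℝ] ℝ}
    {X : ESp N →L[ℝ] ESp N →L[ℝ] ℝ} {x₀ : ESp N} {τ s k b η : ℝ} (hX : ∀ y z, X y z = X z y)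
    (y : ESp N) : (hessianMatrix (barrierTest p X x₀ τ s k b η) y).IsSymm := by
  rw [hessianMatrix_barrierTest hX, ← Matrix.diagonal_single]
  exact ((bilinMatrix_isSymm hX).add ((Matrix.isSymm_diagonal _).smul _)).add
    (Matrix.isSymm_one.smul _)

/-- The difference of the second-order terms of a sub- and a supersolution is controlled by the
difference of the gradient norms `P` and `Q`. -/
theorem sub_le_of_rpow_mul {α L Cf P Q F₁ F₂ r s D : ℝ} (hP : 0 < P) (hQ : 0 < Q)
    (h₁ : -r ≤ P ^ α * F₁) (h₂ : Q ^ α * F₂ ≤ -s) (hrs : r ≤ s) (hr : |r| ≤ Cf)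
    (hL : |P ^ (-α) - Q ^ (-α)| ≤ L * |P - Q|) (hD : |P - Q| ≤ D) (hL0 : 0 ≤ L) :
    F₂ - F₁ ≤ Cf * (L * D) := by
  have hP' : P ^ (-α) * P ^ α = 1 := by rw [← rpow_add hP]; simp
  have hQ' : Q ^ (-α) * Q ^ α = 1 := by rw [← rpow_add hQ]; simp
  have h3 : -r * P ^ (-α) ≤ F₁ := by
    have := mul_le_mul_of_nonneg_left h₁ (rpow_pos_of_pos hP (-α)).le
    rw [← mul_assoc, hP'] at this
    linarith
  have h4 : F₂ ≤ -s * Q ^ (-α) := by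
    have := mul_le_mul_of_nonneg_left h₂ (rpow_pos_of_pos hQ (-α)).le
    rw [← mul_assoc, hQ'] at this
    linarith
  have h5 := mul_le_mul_of_nonneg_right hrs (rpow_pos_of_pos hQ (-α)).le
  have h6 : r * (P ^ (-α) - Q ^ (-α)) ≤ Cf * (L * D) :=
    calc r * (P ^ (-α) - Q ^ (-α)) ≤ |r| * |P ^ (-α) - Q ^ (-α)| := by
          rw [← abs_mul]; exact le_abs_self _
      _ ≤ Cf * (L * D) := by
          refine mul_le_mul hr (hL.trans (mul_le_mul_of_nonneg_left hD hL0)) (abs_nonneg _)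
            ((abs_nonneg _).trans hr)
  linarith

theorem exp_barrier_le_of_jets {N : ℕ} [NeZero N] {a A α : ℝ}
    {Ftil : Matrix (Fin N) (Fin N) ℝ → ℝ} (hF : UniformlyElliptic N a A Ftil) {f : ℝ → ℝ}
    {u v : ESp N → ℝ} (hu : Differentiable ℝ u) (hv : Differentiable ℝ v)
    (husub : ViscSub α Ftil (fun _ s => -f s) Set.univ u)
    (hvsuper : ViscSuper α Ftil (fun _ s => -f s) Set.univ v)
    {m L Cf : ℝ} (hm : 0 < m) (hL0 : 0 ≤ L)
    (hL : ∀ s, m ≤ s → ∀ t, m ≤ t → |s ^ (-α) - t ^ (-α)| ≤ L * |s - t|)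
    {y₀ z₀ : ESp N} (hmu : m ≤ ‖fderiv ℝ u y₀‖) (hmv : m ≤ ‖fderiv ℝ v z₀‖)
    (hf : f (u y₀) ≤ f (v z₀)) (hCf : |f (u y₀)| ≤ Cf)
    {ε k b η τ R : ℝ} (hε : 0 ≤ ε) (hk : 0 ≤ k) (hη : 0 ≤ η) (hτ : 0 ≤ τ) (hzR : ‖z₀‖ ≤ R)
    {q : ESp N} (hq : ‖q‖ ≤ τ) {p : ESp N →L[ℝ] ℝ} {X : ESp N →L[ℝ] ESp N →L[ℝ] ℝ}
    (hX : ∀ y z, X y z = X z y)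
    (hju : ∀ᶠ z in 𝓝 (0 : ESp N), u (y₀ + z) ≤ u y₀ + p z + 1 / 2 * X z z + τ * ‖z‖ ^ 2)
    (hjv : ∀ᶠ z in 𝓝 (0 : ESp N),
      (v z₀ - ε * exp (k * (z₀ 0 - b)) + η * ‖z₀‖ ^ 2) + p z - inner ℝ q z + 1 / 2 * X z z
        - τ * ‖z‖ ^ 2
      ≤ v (z₀ + z) - ε * exp (k * ((z₀ + z) 0 - b)) + η * ‖z₀ + z‖ ^ 2) :
    a * (ε * k ^ 2 * exp (k * (z₀ 0 - b))) ≤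
      Cf * (L * (τ + ε * k * exp (k * (z₀ 0 - b)) + 2 * η * R)) + A * (N * (4 * τ + 2 * η)) := by
  set E := exp (k * (z₀ 0 - b)) with hE
  have hE0 : 0 < E := exp_pos _
  have hsub : ∀ x : ESp N, Tendsto (fun y => y - x) (𝓝 x) (𝓝 0) := fun x => by
    simpa using (continuous_id.sub continuous_const).tendsto (x := x) (f := fun y : ESp N => y - x)
  have hmax : IsLocalMax (fun y => u y - barrierTest p X y₀ τ 0 k b 0 y) y₀ := by
    filter_upwards [(hsub y₀).eventually hju] with y hy
    rw [add_sub_cancel] at hy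
    simp only [barrierTest, sub_self, map_zero, norm_zero, zero_mul, mul_zero, add_zero,
      zero_pow two_ne_zero]
    linarith
  have hmin : IsLocalMin
      (fun y => v y - barrierTest (p - innerSL ℝ q) X z₀ (-τ) ε k b (-η) y) z₀ := by
    filter_upwards [(hsub z₀).eventually hjv] with y hy
    rw [add_sub_cancel] at hy
    simp only [barrierTest, sub_self, map_zero, norm_zero, sub_apply, innerSL_apply_apply]
    linarith
  obtain ⟨hdu, hiu⟩ := husub.le_of_isLocalMax (Set.mem_univ _) (hu y₀)
    (norm_pos_iff.1 (hm.trans_le hmu)) contDiff_barrierTest hmax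
  obtain ⟨hdv, hiv⟩ := hvsuper.le_of_isLocalMin (Set.mem_univ _) (hv z₀)
    (norm_pos_iff.1 (hm.trans_le hmv)) contDiff_barrierTest hmin
  rw [(hasFDerivAt_barrierTest hX _).fderiv] at hdu hdv
  simp only [sub_self, map_zero, zero_mul, zero_smul, smul_zero, mul_zero, add_zero] at hdu hdv
  have hD : |‖fderiv ℝ u y₀‖ - ‖fderiv ℝ v z₀‖| ≤ τ + ε * k * E + 2 * η * R := by
    refine (abs_norm_sub_norm_le _ _).trans ?_
    have hproj : ‖(EuclideanSpace.proj 0 : ESp N →L[ℝ] ℝ)‖ ≤ 1 :=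
      ContinuousLinearMap.opNorm_le_bound _ zero_le_one fun x => by
        simpa using PiLp.norm_apply_le x 0
    have heq : fderiv ℝ u y₀ - fderiv ℝ v z₀ = innerSL ℝ q
        - (ε * k * E) • EuclideanSpace.proj (0 : Fin N) + (2 * η) • innerSL ℝ z₀ := by
      rw [← hdu, ← hdv]
      ext x
      simp
      ring
    rw [heq]
    refine (norm_add_le _ _).trans (add_le_add ((norm_sub_le _ _).trans (add_le_add ?_ ?_)) ?_)
    · rwa [innerSL_apply_norm]
    · rw [norm_smul, norm_of_nonneg (by positivity)]
      exact mul_le_of_le_one_right (by positivity) hproj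
    · rw [norm_smul, norm_of_nonneg (by positivity), innerSL_apply_norm]
      exact mul_le_mul_of_nonneg_left hzR (by positivity)
  have h1 := sub_le_of_rpow_mul (hm.trans_le hmu) (hm.trans_le hmv) hiu hiv hf hCf
    (hL _ hmu _ hmv) hD hL0
  have h2 := hF.mul_le_of_add_eq (e := ε * k ^ 2 * E) (r := 4 * τ + 2 * η)
    (M₁ := hessianMatrix (barrierTest p X y₀ τ 0 k b 0) y₀)
    (M₂ := hessianMatrix (barrierTest (p - innerSL ℝ q) X z₀ (-τ) ε k b (-η)) z₀)
    (hessianMatrix_barrierTest_isSymm hX _) (hessianMatrix_barrierTest_isSymm hX _) (by positivity) (by positivity)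
    (by
      rw [hessianMatrix_barrierTest hX, hessianMatrix_barrierTest hX, ← hE]
      module)
  linarith

end StripComparison

/-- **Comparison principle in a strip** (Proposition 3.2).
If `u` and `v` are C¹ sub- and supersolutions of `F(∇w,D²w) + f(w) = 0` in `ℝ^N`
with values in `[-1,1]`, whose gradients are bounded below by `m > 0` on the strip
`Ω = [b,c] × ℝ^{N-1}`, and if either `u ≤ -1 + δ₀` or `v ≥ 1 - δ₀` on `Ω`, then
`u - v ≤ sup_{∂Ω} (u - v)⁺` on `Ω`. -/
theorem strip_comparison
    (N : ℕ) [NeZero N] (a A α : ℝ) (ha : 0 < a) (haA : a ≤ A) (hα : -1 < α)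
    (Ftil : Matrix (Fin N) (Fin N) ℝ → ℝ) (hF : UniformlyElliptic N a A Ftil)
    (f : ℝ → ℝ) (hf : ContDiffOn ℝ 1 f (Set.Icc (-1) 1))
    (hfm1 : f (-1) = 0) (hf1 : f 1 = 0)
    (δ₀ : ℝ) (hδ₀ : δ₀ ∈ Set.Ioo (0:ℝ) 1)
    (hmonoNeg : AntitoneOn f (Set.Icc (-1) (-1 + δ₀)))
    (hmonoPos : AntitoneOn f (Set.Icc (1 - δ₀) 1))
    (u v : ESp N → ℝ)
    (hureg : ContDiff ℝ 1 u) (hvreg : ContDiff ℝ 1 v)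
    (hurange : ∀ x, u x ∈ Set.Icc (-1 : ℝ) 1) (hvrange : ∀ x, v x ∈ Set.Icc (-1 : ℝ) 1)
    (husub : ViscSub α Ftil (fun _ s => -f s) Set.univ u)
    (hvsuper : ViscSuper α Ftil (fun _ s => -f s) Set.univ v)
    (b c : ℝ) (hbc : b < c)
    (m : ℝ) (hm : 0 < m)
    (hugrad : ∀ x : ESp N, x 0 ∈ Set.Icc b c → m ≤ ‖gradient u x‖)
    (hvgrad : ∀ x : ESp N, x 0 ∈ Set.Icc b c → m ≤ ‖gradient v x‖)
    (hside : (∀ x : ESp N, x 0 ∈ Set.Icc b c → u x ≤ -1 + δ₀) ∨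
             (∀ x : ESp N, x 0 ∈ Set.Icc b c → 1 - δ₀ ≤ v x)) :
    ∀ x : ESp N, x 0 ∈ Set.Icc b c →
      u x - v x ≤
        sSup ((fun y => max (u y - v y) 0) '' {y : ESp N | y 0 = b ∨ y 0 = c}) := by
  intro xb hxb
  by_contra hcon
  push Not at hcon
  set T := (fun y => max (u y - v y) 0) '' {y : ESp N | y 0 = b ∨ y 0 = c}
  set S := sSup T
  have hbdd : BddAbove T := by
    refine ⟨2, ?_⟩
    rintro _ ⟨y, -, rfl⟩
    exact max_le (by linarith [(hurange y).2, (hvrange y).1]) zero_le_two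
  have hle : ∀ y : ESp N, y 0 = b ∨ y 0 = c → max (u y - v y) 0 ≤ S := fun y hy =>
    le_csSup hbdd ⟨y, hy, rfl⟩
  have hS0 : 0 ≤ S :=
    (le_max_right _ _).trans (hle (EuclideanSpace.single 0 b) (Or.inl (by simp)))
  obtain ⟨Δ, hΔ⟩ : ∃ Δ, Δ = u xb - v xb - S := ⟨_, rfl⟩
  have hΔ0 : 0 < Δ := by linarith
  have hA : 0 < A := ha.trans_le haA
  obtain ⟨Cf, hCf⟩ := isCompact_Icc.exists_bound_of_continuousOn hf.continuousOn
  have hCf0 : 0 ≤ Cf := (norm_nonneg _).trans (hCf 1 (by norm_num))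
  obtain ⟨L, hL0, hL⟩ := exists_abs_rpow_neg_sub_le hm hα
  obtain ⟨k, hk⟩ : ∃ k, k = Cf * L / a + 1 := ⟨_, rfl⟩
  have hk1 : 1 ≤ k := by rw [hk]; linarith [show 0 ≤ Cf * L / a by positivity]
  have hak : a * k = Cf * L + a := by rw [hk]; field_simp
  obtain ⟨E₁, hE₁⟩ : ∃ E₁, E₁ = exp (k * (c - b)) := ⟨_, rfl⟩
  have hE₁0 : 0 < E₁ := hE₁ ▸ exp_pos _
  obtain ⟨ε, hε⟩ : ∃ ε, ε = Δ / (4 * E₁) := ⟨_, rfl⟩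
  have hε0 : 0 < ε := by rw [hε]; positivity
  have hεE : ε * E₁ = Δ / 4 := by rw [hε]; field_simp
  have hexp : ∀ x : ESp N, x 0 ∈ Set.Icc b c →
      1 ≤ exp (k * (x 0 - b)) ∧ exp (k * (x 0 - b)) ≤ E₁ := fun x hx =>
    ⟨one_le_exp (mul_nonneg (by linarith) (by linarith [hx.1])), by
      rw [hE₁]
      exact exp_le_exp.2 (mul_le_mul_of_nonneg_left (by linarith [hx.2]) (by linarith))⟩
  have hexpε : ∀ x : ESp N, x 0 ∈ Set.Icc b c →
      0 < ε * exp (k * (x 0 - b)) ∧ ε * exp (k * (x 0 - b)) ≤ Δ / 4 := fun x hx =>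
    ⟨by positivity, hεE ▸ mul_le_mul_of_nonneg_left (hexp x hx).2 hε0.le⟩
  obtain ⟨τ, hτ⟩ : ∃ τ, τ = a * ε / (2 * (4 * A * N + Cf * L + 1)) := ⟨_, rfl⟩
  have hτ0 : 0 < τ := by rw [hτ]; positivity
  have hτle : (4 * A * N + Cf * L) * τ ≤ a * ε / 2 := by
    have : (4 * A * N + Cf * L + 1) * τ = a * ε / 2 := by rw [hτ]; field_simp
    linarith
  obtain ⟨B, hB⟩ : ∃ B, B = 3 + Δ / 4 := ⟨_, rfl⟩
  have hB0 : 0 < B := by rw [hB]; positivity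
  obtain ⟨R, hR0, hxbR, hR1, hR2⟩ : ∃ R : ℝ, 0 < R ∧ ‖xb‖ ≤ R ∧ B * ‖xb‖ ^ 2 / R ^ 2 < Δ / 8 ∧
      2 * A * N * B / R ^ 2 + 2 * Cf * L * B / R < a * ε / 2 := by
    have h2 : Tendsto (fun R : ℝ => R ^ 2) atTop atTop := tendsto_pow_atTop two_ne_zero
    have h3 : Tendsto (fun R : ℝ => B * ‖xb‖ ^ 2 / R ^ 2) atTop (𝓝 0) := h2.const_div_atTop _
    have h4 : Tendsto (fun R : ℝ => 2 * A * N * B / R ^ 2 + 2 * Cf * L * B / R) atTop (𝓝 0) := by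
      simpa using (h2.const_div_atTop (2 * A * N * B)).add
        (tendsto_id.const_div_atTop (2 * Cf * L * B))
    exact ((eventually_gt_atTop 0).and ((eventually_ge_atTop _).and
      ((h3.eventually_lt_const (by positivity)).and
        (h4.eventually_lt_const (by positivity))))).exists
  obtain ⟨η, hη⟩ : ∃ η, η = B / R ^ 2 := ⟨_, rfl⟩
  have hη0 : 0 < η := by rw [hη]; positivity
  have hηsq : ∀ x : ESp N, 0 ≤ η * ‖x‖ ^ 2 := fun x => by positivity
  have hηR : η * R ^ 2 = B := by rw [hη]; field_simp
  have hR1 : η * ‖xb‖ ^ 2 < Δ / 8 := by rwa [hη, div_mul_eq_mul_div]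
  have hR2 : A * N * (2 * η) + Cf * L * (2 * η * R) < a * ε / 2 := by
    convert hR2 using 1
    rw [hη]
    field_simp
  have hproj : Continuous fun x : ESp N => x 0 :=
    (EuclideanSpace.proj (𝕜 := ℝ) (0 : Fin N)).continuous
  let K : Set (ESp N) := (fun x : ESp N => x 0) ⁻¹' Set.Icc b c ∩ closedBall 0 R
  have hK : IsCompact K := (isCompact_closedBall 0 R).inter_left (isClosed_Icc.preimage hproj)
  have hKint : (fun x : ESp N => x 0) ⁻¹' Set.Ioo b c ∩ ball 0 R ⊆ interior K :=
    interior_maximal (Set.inter_subset_inter (Set.preimage_mono Set.Ioo_subset_Icc_self)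
      ball_subset_closedBall) ((isOpen_Ioo.preimage hproj).inter isOpen_ball)
  let w : ESp N → ℝ := fun x => v x - ε * exp (k * (x 0 - b)) + η * ‖x‖ ^ 2
  have hw : Continuous w := by
    have := hvreg.continuous
    fun_prop
  have hfrontier : ∀ x ∈ K, x ∉ interior K → u x - w x < S + Δ / 2 := by
    rintro x ⟨hx, hxR⟩ hxi
    have hx : x 0 ∈ Set.Icc b c := hx
    have he := hexpε x hx
    simp only [w]
    by_cases hxe : x 0 = b ∨ x 0 = c
    · have := (le_max_left _ _).trans (hle x hxe)
      linarith [he.2, hηsq x]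
    · push Not at hxe
      have hxn : ‖x‖ = R := by
        refine le_antisymm (mem_closedBall_zero_iff.1 hxR) (not_lt.1 fun hlt => hxi (hKint ?_))
        exact ⟨⟨lt_of_le_of_ne hx.1 hxe.1.symm, lt_of_le_of_ne hx.2 hxe.2⟩,
          mem_ball_zero_iff.2 hlt⟩
      rw [hxn, hηR]
      linarith [(hurange x).2, (hvrange x).1]
  have hxbμ : S + Δ / 2 < u xb - w xb := by
    simp only [w]
    linarith [(hexpε xb hxb).1]
  obtain ⟨y₀, hy₀, z₀, hz₀, q, p, X, hq, hyz, hX, hju, hjv⟩ :=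
    exists_common_jet hK hureg.continuous.continuousOn hw.continuousOn hfrontier
      ⟨hxb, mem_closedBall_zero_iff.2 hxbR⟩ hxbμ hτ0
  obtain ⟨hy₀, -⟩ := interior_subset hy₀
  obtain ⟨hz₀, hz₀R⟩ := interior_subset hz₀
  have hvu : v z₀ < u y₀ := by
    simp only [w] at hyz
    linarith [(hexpε z₀ hz₀).2, hηsq z₀]
  have hfle : f (u y₀) ≤ f (v z₀) := by
    rcases hside with h | h
    · exact hmonoNeg ⟨(hvrange z₀).1, hvu.le.trans (h y₀ hy₀)⟩ ⟨(hurange y₀).1, h y₀ hy₀⟩ hvu.le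
    · exact hmonoPos ⟨h z₀ hz₀, (hvrange z₀).2⟩ ⟨(h z₀ hz₀).trans hvu.le, (hurange y₀).2⟩ hvu.le
  have hmain := exp_barrier_le_of_jets hF (hureg.differentiable one_ne_zero)
    (hvreg.differentiable one_ne_zero) husub hvsuper hm hL0 hL
    (norm_gradient u y₀ ▸ hugrad y₀ hy₀) (norm_gradient v z₀ ▸ hvgrad z₀ hz₀) hfle
    (hCf _ (hurange y₀)) hε0.le (zero_le_one.trans hk1) hη0.le hτ0.le
    (mem_closedBall_zero_iff.1 hz₀R) hq hX hju hjv
  have hkE : 1 ≤ k * exp (k * (z₀ 0 - b)) := one_le_mul_of_one_le_of_one_le hk1 (hexp z₀ hz₀).1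
  have hsplit : a * (ε * k ^ 2 * exp (k * (z₀ 0 - b)))
      = Cf * L * (ε * k * exp (k * (z₀ 0 - b))) + a * ε * (k * exp (k * (z₀ 0 - b))) := by
    linear_combination (ε * k * exp (k * (z₀ 0 - b))) * hak
  have hlow := mul_le_mul_of_nonneg_left hkE (mul_pos ha hε0).le
  linarith
end
end

section
/- Let u : ℝ^N → ℝ with values in [−1,1] be a viscosity solution of F(∇u, D²u) + f(u) = 0 in ℝ^N with lim_{x₁→±∞} u(x₁, x′) = ±1 uniformly in x′, and, if α ≠ 0, assume that for every b < c there exists m > 0 with |∇u| ≥ m in [b,c] × ℝ^{N−1} in the viscosity sense. Let M₁ > 0 be such that u(x) ≥ 1 − δ₀ whenever x₁ ≥ M₁ and u(x) ≤ −1 + δ₀ whenever x₁ ≤ −M₁. Then for every vector ν = (ν₁, ν′) with ν₁ > 0 and every t > 2M₁/ν₁, one has u(x + tν) ≥ u(x) for all x ∈ ℝ^N. -/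
noncomputable section

open Metric Filter Topology Real

section TestFunctions

variable {N : ℕ} [NeZero N]

theorem hasFDerivAt_radial_test {W : ℝ → ℝ} (hW : ContDiff ℝ 2 W) (μ : ℝ) (x : ESp N) :
    HasFDerivAt (fun y : ESp N => W (y 0) + μ * ‖y‖ ^ 2)
      (deriv W (x 0) • (EuclideanSpace.proj 0 : ESp N →L[ℝ] ℝ) + (2 * μ) • innerSL ℝ x) x := by
  have h1 : HasFDerivAt (fun y : ESp N => W (y 0))
      (deriv W (x 0) • (EuclideanSpace.proj 0 : ESp N →L[ℝ] ℝ)) x := by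
    have hd : HasDerivAt W (deriv W (x 0)) (x 0) :=
      (hW.differentiable (by norm_num)).differentiableAt.hasDerivAt
    exact hd.comp_hasFDerivAt x (EuclideanSpace.proj 0 : ESp N →L[ℝ] ℝ).hasFDerivAt
  have h2 := ((hasStrictFDerivAt_norm_sq x).hasFDerivAt).const_mul μ
  refine (h1.add h2).congr_fderiv ?_
  ext v
  simp
  ring

theorem gradient_radial_test {W : ℝ → ℝ} (hW : ContDiff ℝ 2 W) (μ : ℝ) (x : ESp N) :
    gradient (fun y : ESp N => W (y 0) + μ * ‖y‖ ^ 2) x =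
      deriv W (x 0) • EuclideanSpace.single 0 (1 : ℝ) + (2 * μ) • x := by
  refine HasGradientAt.gradient ?_
  rw [hasGradientAt_iff_hasFDerivAt]
  refine (hasFDerivAt_radial_test hW μ x).congr_fderiv ?_
  ext v
  simp [EuclideanSpace.inner_single_left]

theorem hessianMatrix_radial_test {W : ℝ → ℝ} (hW : ContDiff ℝ 2 W) (μ : ℝ) (x : ESp N) :
    hessianMatrix (fun y : ESp N => W (y 0) + μ * ‖y‖ ^ 2) x =
      deriv (deriv W) (x 0) • Matrix.single 0 0 (1 : ℝ) + (2 * μ) • (1 : Matrix _ _ ℝ) := by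
  ext i j
  have h0 : (fun y : ESp N => fderiv ℝ (fun y : ESp N => W (y 0) + μ * ‖y‖ ^ 2) y
      (EuclideanSpace.single j (1 : ℝ))) = fun y : ESp N =>
        deriv W (y 0) * (EuclideanSpace.single j (1 : ℝ) : ESp N) 0 + (2 * μ) * y j := by
    funext y
    rw [(hasFDerivAt_radial_test hW μ y).fderiv]
    simp [EuclideanSpace.inner_single_right]
  have hW' : ContDiff ℝ 1 (deriv W) := by
    have : ContDiff ℝ (1 + 1) W := by simpa [one_add_one_eq_two] using hW
    exact (contDiff_succ_iff_deriv.1 this).2.2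
  have h1 : HasFDerivAt (fun y : ESp N => deriv W (y 0))
      (deriv (deriv W) (x 0) • (EuclideanSpace.proj 0 : ESp N →L[ℝ] ℝ)) x := by
    have hd : HasDerivAt (deriv W) (deriv (deriv W) (x 0)) (x 0) :=
      (hW'.differentiable (by norm_num)).differentiableAt.hasDerivAt
    exact hd.comp_hasFDerivAt x (EuclideanSpace.proj 0 : ESp N →L[ℝ] ℝ).hasFDerivAt
  have h2 : HasFDerivAt (fun y : ESp N => y j) (EuclideanSpace.proj j : ESp N →L[ℝ] ℝ) x :=
    (EuclideanSpace.proj j : ESp N →L[ℝ] ℝ).hasFDerivAt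
  have h3 := (h1.mul_const ((EuclideanSpace.single j (1 : ℝ) : ESp N) 0)).add
    (h2.const_mul (2 * μ))
  simp only [hessianMatrix, Matrix.of_apply]
  rw [h0]
  erw [h3.fderiv]
  simp [Matrix.single_apply, Matrix.one_apply]
  by_cases hi : i = 0 <;> by_cases hj : j = 0 <;> by_cases hij : i = j <;> simp_all [eq_comm]

theorem contDiff_radial_test {W : ℝ → ℝ} (hW : ContDiff ℝ 2 W) (μ : ℝ) :
    ContDiff ℝ 2 (fun y : ESp N => W (y 0) + μ * ‖y‖ ^ 2) := by
  have h1 : ContDiff ℝ 2 (fun y : ESp N => W (y 0)) :=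
    hW.comp (EuclideanSpace.proj 0 : ESp N →L[ℝ] ℝ).contDiff
  exact h1.add (contDiff_const.mul (contDiff_norm_sq ℝ))

end TestFunctions

section Reflection

variable {N : ℕ}

theorem fderiv_comp_neg_eq_neg (φ : ESp N → ℝ) (x : ESp N) :
    fderiv ℝ (fun y => φ (-y)) x = -fderiv ℝ φ (-x) := by
  have h := (ContinuousLinearEquiv.neg ℝ (M := ESp N)).comp_right_fderiv (f := φ) (x := x)
  ext v
  exact (congrArg (fun L : ESp N →L[ℝ] ℝ => L v) h).trans (by simp)

theorem fderiv_neg_comp_neg (φ : ESp N → ℝ) (x : ESp N) :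
    fderiv ℝ (fun y => -φ (-y)) x = fderiv ℝ φ (-x) := by
  rw [fderiv_fun_neg, fderiv_comp_neg_eq_neg, neg_neg]

theorem gradient_neg_comp_neg (φ : ESp N → ℝ) (x : ESp N) :
    gradient (fun y => -φ (-y)) x = gradient φ (-x) := by
  simp only [gradient, fderiv_neg_comp_neg]

theorem hessianMatrix_neg_comp_neg (φ : ESp N → ℝ) (x : ESp N) :
    hessianMatrix (fun y => -φ (-y)) x = -hessianMatrix φ (-x) := by
  ext i j
  simp only [hessianMatrix, Matrix.of_apply, fderiv_neg_comp_neg, Matrix.neg_apply]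
  rw [fderiv_comp_neg_eq_neg (fun y => fderiv ℝ φ y (EuclideanSpace.single j (1 : ℝ)))]
  simp

theorem UniformlyElliptic.neg_comp_neg {a A : ℝ} {Ftil : Matrix (Fin N) (Fin N) ℝ → ℝ}
    (hF : UniformlyElliptic N a A Ftil) :
    UniformlyElliptic N a A (fun M => -Ftil (-M)) := by
  refine ⟨fun t ht M hM => ?_, fun M P hM hP hP' => ?_⟩
  · have := hF.1 t ht (-M) hM.neg
    simp only [smul_neg] at this
    simp [this]
  · have := hF.2 (-(M + P)) P (hM.add hP).neg hP hP'
    rw [show -(M + P) + P = -M by abel] at this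
    exact ⟨by linarith [this.1], by linarith [this.2]⟩

theorem ViscSuper.neg_comp_neg {α : ℝ} {Ftil : Matrix (Fin N) (Fin N) ℝ → ℝ} {f : ℝ → ℝ}
    {u : ESp N → ℝ} (h : ViscSuper α Ftil (fun _ s => -f s) Set.univ u) :
    ViscSub α (fun M => -Ftil (-M)) (fun _ s => -(-f (-s))) Set.univ (fun x => -u (-x)) := by
  intro x₀ _
  rcases h (-x₀) trivial with ⟨δ, hδ, c, -, hc, hg⟩ | h
  · refine Or.inl ⟨δ, hδ, -c, Set.subset_univ _, fun x hx => ?_, fun x hx => ?_⟩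
    · exact congrArg Neg.neg (hc (-x) (by simpa [dist_neg_neg] using hx))
    · have := hg (-x₀) (by simpa using hδ)
      simpa using this
  · refine Or.inr fun φ hφ hmax hne => ?_
    have key := h (fun y => -φ (-y)) (hφ.comp contDiff_neg).neg ?_ ?_
    · rw [gradient_neg_comp_neg, hessianMatrix_neg_comp_neg, neg_neg] at key
      simp only [neg_neg]
      linarith
    · have : Tendsto (fun y : ESp N => -y) (𝓝 (-x₀)) (𝓝 x₀) := by
        simpa using (continuous_neg.tendsto (-x₀))
      filter_upwards [this.eventually hmax] with y hy
      simp only [neg_neg] at hy ⊢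
      linarith
    · rw [gradient_neg_comp_neg, neg_neg]
      exact hne

theorem ViscSub.neg_comp_neg {α : ℝ} {Ftil : Matrix (Fin N) (Fin N) ℝ → ℝ} {f : ℝ → ℝ}
    {u : ESp N → ℝ} (h : ViscSub α Ftil (fun _ s => -f s) Set.univ u) :
    ViscSuper α (fun M => -Ftil (-M)) (fun _ s => -(-f (-s))) Set.univ (fun x => -u (-x)) := by
  intro x₀ _
  rcases h (-x₀) trivial with ⟨δ, hδ, c, -, hc, hg⟩ | h
  · refine Or.inl ⟨δ, hδ, -c, Set.subset_univ _, fun x hx => ?_, fun x hx => ?_⟩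
    · exact congrArg Neg.neg (hc (-x) (by simpa [dist_neg_neg] using hx))
    · have := hg (-x₀) (by simpa using hδ)
      simpa using this
  · refine Or.inr fun φ hφ hmin hne => ?_
    have key := h (fun y => -φ (-y)) (hφ.comp contDiff_neg).neg ?_ ?_
    · rw [gradient_neg_comp_neg, hessianMatrix_neg_comp_neg, neg_neg] at key
      simp only [neg_neg]
      linarith
    · have : Tendsto (fun y : ESp N => -y) (𝓝 (-x₀)) (𝓝 x₀) := by
        simpa using (continuous_neg.tendsto (-x₀))
      filter_upwards [this.eventually hmin] with y hy
      simp only [neg_neg] at hy ⊢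
      linarith
    · rw [gradient_neg_comp_neg, neg_neg]
      exact hne

end Reflection

section General

variable {N : ℕ}

theorem UniformlyElliptic.apply_zero {a A : ℝ} {Ftil : Matrix (Fin N) (Fin N) ℝ → ℝ}
    (hF : UniformlyElliptic N a A Ftil) : Ftil 0 = 0 := by
  have := hF.1 0 le_rfl 0 Matrix.isSymm_zero
  simpa using this

theorem ViscSub.apply_of_isLocalMax {α : ℝ} {Ftil : Matrix (Fin N) (Fin N) ℝ → ℝ}
    {u : ESp N → ℝ} {g : ESp N → ℝ → ℝ} (h : ViscSub α Ftil g Set.univ u)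
    {φ : ESp N → ℝ} (hφ : ContDiff ℝ 2 φ) {x : ESp N}
    (hmax : IsLocalMax (fun y => u y - φ y) x) (hne : gradient φ x ≠ 0) :
    g x (u x) ≤ ‖gradient φ x‖ ^ α * Ftil (hessianMatrix φ x) := by
  rcases h x trivial with ⟨δ, hδ, c, -, hc, -⟩ | h
  · exfalso
    have hmin : IsLocalMin φ x := by
      filter_upwards [hmax, ball_mem_nhds x hδ] with y hy hyb
      have h1 := hc y hyb
      have h2 := hc x (mem_ball_self hδ)
      simp only [h1, h2] at hy
      linarith
    exact hne (by simp [gradient, hmin.fderiv_eq_zero])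
  · exact h φ hφ hmax hne

end General

section Ellipticity

variable {N : ℕ} [NeZero N] {a A : ℝ} {Ftil : Matrix (Fin N) (Fin N) ℝ → ℝ}

theorem isSymm_smul_single (m : ℝ) :
    (m • Matrix.single (0 : Fin N) 0 (1 : ℝ)).IsSymm := by
  simp [Matrix.IsSymm]

theorem posSemidef_smul_single {m : ℝ} (hm : 0 ≤ m) :
    (m • Matrix.single (0 : Fin N) 0 (1 : ℝ)).PosSemidef := by
  have h : Matrix.single (0 : Fin N) 0 (1 : ℝ) =
      Matrix.diagonal (Pi.single (0 : Fin N) (1 : ℝ)) := by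
    rw [Matrix.diagonal_single]
  rw [h]
  refine (Matrix.PosSemidef.diagonal ?_).smul hm
  intro i
  by_cases hi : i = 0
  · subst hi; simp
  · simp [hi]

theorem trace_smul_single (m : ℝ) :
    (m • Matrix.single (0 : Fin N) 0 (1 : ℝ)).trace = m := by
  simp

theorem UniformlyElliptic.apply_smul_single_sub (hF : UniformlyElliptic N a A Ftil)
    {m m' : ℝ} (h : m ≤ m') :
    a * (m' - m) ≤ Ftil (m' • Matrix.single 0 0 1) - Ftil (m • Matrix.single 0 0 1) ∧
      Ftil (m' • Matrix.single 0 0 1) - Ftil (m • Matrix.single 0 0 1) ≤ A * (m' - m) := by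
  have := hF.2 (m • Matrix.single 0 0 1) ((m' - m) • Matrix.single 0 0 1)
    (isSymm_smul_single m) (isSymm_smul_single _) (posSemidef_smul_single (sub_nonneg.2 h))
  rwa [trace_smul_single, ← add_smul, add_sub_cancel] at this

theorem UniformlyElliptic.abs_apply_smul_single_le (hF : UniformlyElliptic N a A Ftil)
    (ha : 0 < a) (m : ℝ) : |Ftil (m • Matrix.single 0 0 1)| ≤ A * |m| := by
  rcases le_total 0 m with hm | hm
  · have := hF.apply_smul_single_sub hm
    rw [zero_smul, hF.apply_zero] at this
    have h0 : 0 ≤ a * (m - 0) := mul_nonneg ha.le (by linarith)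
    rw [abs_of_nonneg hm, abs_of_nonneg (by linarith)]
    linarith
  · have := hF.apply_smul_single_sub hm
    rw [zero_smul, hF.apply_zero] at this
    have h0 : 0 ≤ a * (0 - m) := mul_nonneg ha.le (by linarith)
    rw [abs_of_nonpos hm, abs_of_nonpos (by linarith)]
    linarith

theorem UniformlyElliptic.apply_add_smul_one_le (hF : UniformlyElliptic N a A Ftil)
    (m : ℝ) {c : ℝ} (hc : 0 ≤ c) :
    Ftil (m • Matrix.single 0 0 1 + c • (1 : Matrix (Fin N) (Fin N) ℝ)) ≤
      Ftil (m • Matrix.single 0 0 1) + c * (A * N) := by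
  have := (hF.2 (m • Matrix.single 0 0 1) (c • (1 : Matrix (Fin N) (Fin N) ℝ))
    (isSymm_smul_single m) (by simp [Matrix.IsSymm]) (Matrix.PosSemidef.one.smul hc)).2
  rw [Matrix.trace_smul, Matrix.trace_one, Fintype.card_fin, smul_eq_mul] at this
  linarith

end Ellipticity

section Comparison

variable {N : ℕ} [NeZero N] {a A α : ℝ} {Ftil : Matrix (Fin N) (Fin N) ℝ → ℝ}
  {f : ℝ → ℝ} {u : ESp N → ℝ}

theorem exists_rpow_mul_perturbation_lt (α : ℝ) {q τ : ℝ} (hq : 0 < q) (hτ : 0 < τ) (P b' D : ℝ) :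
    ∃ η > 0, η ≤ 1 ∧ η ≤ q / 2 ∧ ∀ s s' b c : ℝ, q ≤ s → s ≤ P → |s' - s| ≤ η → |b| ≤ b' →
      0 ≤ c → c ≤ η → s' ^ α * (b + c * D) < s ^ α * b + τ := by
  set K : Set (ℝ × ℝ × ℝ) := Set.Icc (q / 2) (P + 1) ×ˢ Set.Icc (-b') b' ×ˢ Set.Icc 0 1
  have hK : IsCompact K := isCompact_Icc.prod (isCompact_Icc.prod isCompact_Icc)
  have hcont : ContinuousOn (fun z : ℝ × ℝ × ℝ => z.1 ^ α * (z.2.1 + z.2.2 * D)) K := by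
    refine ContinuousOn.mul (ContinuousOn.rpow_const continuousOn_fst fun z hz => Or.inl ?_)
      (by fun_prop)
    have := hz.1.1
    exact (by linarith : (0 : ℝ) < z.1).ne'
  obtain ⟨δ, hδ, h⟩ := Metric.uniformContinuousOn_iff.1
    (hK.uniformContinuousOn_of_continuous hcont) τ hτ
  refine ⟨min (δ / 2) (min 1 (q / 2)), by positivity, ?_, ?_, ?_⟩
  · exact (min_le_right _ _).trans (min_le_left _ _)
  · exact (min_le_right _ _).trans (min_le_right _ _)
  · intro s s' b c hs hsP hss hb hc hcη
    have h1 : |s' - s| ≤ δ / 2 := hss.trans (min_le_left _ _)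
    have h2 : |s' - s| ≤ 1 := hss.trans ((min_le_right _ _).trans (min_le_left _ _))
    have h3 : |s' - s| ≤ q / 2 := hss.trans ((min_le_right _ _).trans (min_le_right _ _))
    have h4 : c ≤ δ / 2 := hcη.trans (min_le_left _ _)
    have h5 : c ≤ 1 := hcη.trans ((min_le_right _ _).trans (min_le_left _ _))
    have hb' := abs_le.1 hb
    have h2' := abs_le.1 h2
    have h3' := abs_le.1 h3
    have key := h (s', b, c) ⟨⟨by linarith, by linarith⟩, ⟨hb'.1, hb'.2⟩, ⟨hc, h5⟩⟩
      (s, b, 0) ⟨⟨by linarith, by linarith⟩, ⟨hb'.1, hb'.2⟩, ⟨le_rfl, by norm_num⟩⟩ (by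
        rw [Prod.dist_eq, Prod.dist_eq]
        simp only [dist_self, Real.dist_eq, sub_zero]
        rw [abs_of_nonneg hc]
        exact max_lt (by linarith) (max_lt hδ (by linarith)))
    rw [Real.dist_eq] at key
    have := (abs_lt.1 key).2
    simp only [zero_mul, add_zero] at this
    linarith

theorem contDiff_one_deriv {W : ℝ → ℝ} (hW : ContDiff ℝ 2 W) : ContDiff ℝ 1 (deriv W) := by
  have : ContDiff ℝ (1 + 1) W := by simpa [one_add_one_eq_two] using hW
  exact (contDiff_succ_iff_deriv.1 this).2.2

theorem continuous_deriv_deriv {W : ℝ → ℝ} (hW : ContDiff ℝ 2 W) :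
    Continuous (deriv (deriv W)) :=
  (contDiff_one_deriv hW).continuous_deriv (by norm_num)

theorem ViscSub.le_of_strict_supersolution (ha : 0 < a) (haA : a ≤ A)
    (hF : UniformlyElliptic N a A Ftil)
    (hsub : ViscSub α Ftil (fun _ s => -f s) Set.univ u) (hu : Continuous u) {B : ℝ}
    (hB : ∀ x, u x ≤ B) {W : ℝ → ℝ} (hW : ContDiff ℝ 2 W) {l r q τ : ℝ} (hq : 0 < q) (hτ : 0 < τ)
    (hslope : ∀ y ∈ Set.Icc l r, q ≤ |deriv W y|)
    (hl : ∀ x : ESp N, x 0 = l → u x ≤ W l) (hr : ∀ x : ESp N, x 0 = r → u x ≤ W r)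
    (hstrict : ∀ x : ESp N, x 0 ∈ Set.Icc l r → W (x 0) < u x →
      |deriv W (x 0)| ^ α * Ftil (deriv (deriv W) (x 0) • Matrix.single 0 0 1) + τ ≤ -f (u x))
    {z : ESp N} (hz : z 0 ∈ Set.Icc l r) : u z ≤ W (z 0) := by
  by_contra! hlt
  have hcoord : Continuous fun x : ESp N => x 0 :=
    (EuclideanSpace.proj 0 : ESp N →L[ℝ] ℝ).continuous
  obtain ⟨P, hP⟩ := isCompact_Icc.exists_bound_of_continuousOn (s := Set.Icc l r)
    (hW.continuous_deriv (by norm_num)).continuousOn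
  obtain ⟨b, hb⟩ := isCompact_Icc.exists_bound_of_continuousOn (s := Set.Icc l r)
    (continuous_deriv_deriv hW).continuousOn
  obtain ⟨w, hw⟩ := isCompact_Icc.exists_bound_of_continuousOn (s := Set.Icc l r)
    hW.continuous.continuousOn
  obtain ⟨η, hη, hη1, hηq, hη'⟩ := exists_rpow_mul_perturbation_lt α hq hτ P (A * b) (A * N)
  set B' := B + w with hB'
  have hdiff : ∀ x : ESp N, x 0 ∈ Set.Icc l r → u x - W (x 0) ≤ B' := by
    intro x hx
    have h1 := (abs_le.1 (hw _ hx)).1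
    linarith [hB x]
  have hB'pos : 0 < B' := lt_of_lt_of_le (sub_pos.2 hlt) (hdiff z hz)
  obtain ⟨μ, hμ, hμη, hμB, hμz⟩ : ∃ μ > 0, 2 * μ ≤ η ∧ 4 * μ * B' ≤ η ^ 2 ∧
      μ * ‖z‖ ^ 2 < u z - W (z 0) := by
    have e1 : ∀ᶠ μ : ℝ in 𝓝[>] 0, 2 * μ < η :=
      (Continuous.tendsto' (by fun_prop) 0 0 (by simp)).mono_left nhdsWithin_le_nhds
        |>.eventually_lt_const hη
    have e2 : ∀ᶠ μ : ℝ in 𝓝[>] 0, 4 * μ * B' < η ^ 2 :=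
      (Continuous.tendsto' (by fun_prop) 0 0 (by simp)).mono_left nhdsWithin_le_nhds
        |>.eventually_lt_const (by positivity)
    have e3 : ∀ᶠ μ : ℝ in 𝓝[>] 0, μ * ‖z‖ ^ 2 < u z - W (z 0) :=
      (Continuous.tendsto' (by fun_prop) 0 0 (by simp)).mono_left nhdsWithin_le_nhds
        |>.eventually_lt_const (sub_pos.2 hlt)
    obtain ⟨μ, h1, h2, h3, h4⟩ := (e1.and (e2.and (e3.and self_mem_nhdsWithin))).exists
    exact ⟨μ, h4, h1.le, h2.le, h3⟩
  set ρ := B' / μ + 1 with hρ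
  have hρpos : 0 < ρ := by positivity
  have hρB : B' ≤ μ * ρ ^ 2 := by
    have : μ * ρ ^ 2 = B' + (B' ^ 2 / μ + B' + μ) := by rw [hρ]; field_simp; ring
    rw [this]
    have : 0 ≤ B' ^ 2 / μ + B' + μ := by positivity
    linarith
  set h : ESp N → ℝ := fun x => u x - (W (x 0) + μ * ‖x‖ ^ 2) with hh
  have hcont : Continuous h := by
    have := hW.continuous.comp hcoord
    exact hu.sub (this.add (by fun_prop))
  have hzpos : 0 < h z := by simp only [hh]; linarith
  have hKc : IsCompact ((fun x : ESp N => x 0) ⁻¹' Set.Icc l r ∩ closedBall 0 ρ) :=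
    (isCompact_closedBall 0 ρ).inter_left (isClosed_Icc.preimage hcoord)
  have hzρ : ‖z‖ ≤ ρ := by
    refine abs_le_of_sq_le_sq' ?_ hρpos.le |>.2
    have := hdiff z hz
    have : μ * ‖z‖ ^ 2 ≤ μ * ρ ^ 2 := by linarith
    exact le_of_mul_le_mul_left this hμ
  obtain ⟨x, ⟨hxs, hxρ⟩, hxmax⟩ := hKc.exists_isMaxOn ⟨z, hz, by simpa using hzρ⟩
    hcont.continuousOn
  have hxpos : 0 < h x := hzpos.trans_le (hxmax ⟨hz, by simpa using hzρ⟩)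
  have hxs' : x 0 ∈ Set.Icc l r := hxs
  have hxn : μ * ‖x‖ ^ 2 < B' := by
    have := hdiff x hxs'
    simp only [hh] at hxpos
    linarith
  have hnn : 0 ≤ μ * ‖x‖ ^ 2 := by positivity
  have hWu : W (x 0) < u x := by simp only [hh] at hxpos; linarith
  have hxl : l < x 0 := by
    refine lt_of_le_of_ne hxs'.1 fun e => ?_
    have := hl x e.symm
    rw [e] at this
    linarith
  have hxr : x 0 < r := by
    refine lt_of_le_of_ne hxs'.2 fun e => ?_
    have := hr x e
    rw [← e] at this
    linarith
  have hxb : ‖x‖ < ρ := by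
    refine lt_of_pow_lt_pow_left₀ 2 hρpos.le ?_
    exact lt_of_mul_lt_mul_left (hxn.trans_le hρB) hμ.le
  have hloc : IsLocalMax h x := by
    have h1 : ∀ᶠ y : ESp N in 𝓝 x, y 0 ∈ Set.Ioo l r :=
      hcoord.continuousAt.eventually_mem (Ioo_mem_nhds hxl hxr)
    have h2 : ∀ᶠ y : ESp N in 𝓝 x, ‖y‖ < ρ :=
      continuous_norm.continuousAt.eventually_lt continuousAt_const hxb
    filter_upwards [h1, h2] with y hy1 hy2
    exact hxmax ⟨Set.Ioo_subset_Icc_self hy1, by simpa using hy2.le⟩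
  set p := gradient (fun y : ESp N => W (y 0) + μ * ‖y‖ ^ 2) x with hp
  have hpd : abs (‖p‖ - |deriv W (x 0)|) ≤ η := by
    have h1 : ‖deriv W (x 0) • (EuclideanSpace.single 0 (1 : ℝ) : ESp N)‖ = |deriv W (x 0)| := by
      simp [norm_smul]
    rw [← h1]
    refine (abs_norm_sub_norm_le _ _).trans ?_
    rw [hp, gradient_radial_test hW, add_sub_cancel_left, norm_smul]
    refine abs_le_of_sq_le_sq' ?_ hη.le |>.2
    rw [Real.norm_eq_abs, mul_pow, sq_abs]
    nlinarith
  have hslx := hslope _ hxs'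
  have hpne : p ≠ 0 := by
    intro e
    rw [e, norm_zero, zero_sub, abs_neg, abs_abs] at hpd
    linarith
  have key := hsub.apply_of_isLocalMax (contDiff_radial_test hW μ) hloc hpne
  rw [hessianMatrix_radial_test hW] at key
  have hst := hstrict x hxs' hWu
  have hE := hF.apply_add_smul_one_le (deriv (deriv W) (x 0)) (c := 2 * μ) (by positivity)
  have hpp : 0 ≤ ‖p‖ ^ α := by positivity
  have hA : 0 ≤ A := ha.le.trans haA
  have hbb : |Ftil (deriv (deriv W) (x 0) • Matrix.single 0 0 1)| ≤ A * b :=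
    (hF.abs_apply_smul_single_le ha _).trans (mul_le_mul_of_nonneg_left (hb _ hxs') hA)
  have hfin := hη' |deriv W (x 0)| ‖p‖ _ (2 * μ) hslx (hP _ hxs') hpd hbb (by positivity) hμη
  have := mul_le_mul_of_nonneg_left hE hpp
  linarith

end Comparison

section NonstrictComparison

variable {N : ℕ} [NeZero N] {a A α : ℝ} {Ftil : Matrix (Fin N) (Fin N) ℝ → ℝ}
  {f : ℝ → ℝ} {u : ESp N → ℝ}

theorem ViscSuper.strict_subsolution_le (ha : 0 < a) (haA : a ≤ A)
    (hF : UniformlyElliptic N a A Ftil)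
    (hsup : ViscSuper α Ftil (fun _ s => -f s) Set.univ u) (hu : Continuous u) {B : ℝ}
    (hB : ∀ x, B ≤ u x) {W : ℝ → ℝ} (hW : ContDiff ℝ 2 W) {l r q τ : ℝ} (hq : 0 < q) (hτ : 0 < τ)
    (hslope : ∀ y ∈ Set.Icc l r, q ≤ |deriv W y|)
    (hl : ∀ x : ESp N, x 0 = l → W l ≤ u x) (hr : ∀ x : ESp N, x 0 = r → W r ≤ u x)
    (hstrict : ∀ x : ESp N, x 0 ∈ Set.Icc l r → u x < W (x 0) →
      -f (u x) + τ ≤ |deriv W (x 0)| ^ α * Ftil (deriv (deriv W) (x 0) • Matrix.single 0 0 1))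
    {z : ESp N} (hz : z 0 ∈ Set.Icc l r) : W (z 0) ≤ u z := by
  have hd : deriv (fun s => -W (-s)) = fun s => deriv W (-s) := by
    funext s
    rw [deriv.fun_neg, deriv_comp_neg, neg_neg]
  have hdd : deriv (deriv fun s => -W (-s)) = fun s => -deriv (deriv W) (-s) := by
    funext s
    rw [hd, deriv_comp_neg]
  have key := hsup.neg_comp_neg.le_of_strict_supersolution ha haA hF.neg_comp_neg
    (hu.comp continuous_neg).neg (B := -B) (fun x => neg_le_neg (hB _))
    (W := fun s => -W (-s)) (hW.comp contDiff_neg).neg (l := -r) (r := -l) hq hτ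
    (fun y hy => by
      rw [hd]
      exact hslope (-y) ⟨by linarith [hy.2], by linarith [hy.1]⟩)
    (fun x hx => by
      have := hr (-x) (by simp [hx])
      simpa using this)
    (fun x hx => by
      have := hl (-x) (by simp [hx])
      simpa using this)
    (fun x hx hlt => by
      have := hstrict (-x) ⟨by simpa using (by linarith [hx.2] : l ≤ -x 0),
        by simpa using (by linarith [hx.1] : -x 0 ≤ r)⟩ (by simpa using hlt)
      simp only [hdd, neg_smul, neg_neg]
      rw [hd]
      simp only [PiLp.neg_apply] at this
      linarith)
    (z := -z) ⟨by simpa using hz.2, by simpa using hz.1⟩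
  simpa using key

theorem hasDerivAt_quadratic_shift (σ l r s : ℝ) :
    HasDerivAt (fun s => s + σ * ((s - l) ^ 2 - (r - l) ^ 2) / 2) (1 + σ * (s - l)) s := by
  have h := (((((hasDerivAt_id s).sub_const l).pow 2).sub_const ((r - l) ^ 2)).const_mul σ).div_const
    2
  refine ((hasDerivAt_id s).add h).congr_deriv ?_
  simp
  ring

theorem deriv_comp_quadratic_shift {U : ℝ → ℝ} (hU : ContDiff ℝ 2 U) (σ l r : ℝ) :
    deriv (fun s => U (s + σ * ((s - l) ^ 2 - (r - l) ^ 2) / 2)) =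
      fun s => deriv U (s + σ * ((s - l) ^ 2 - (r - l) ^ 2) / 2) * (1 + σ * (s - l)) := by
  funext s
  exact (((hU.differentiable (by norm_num)) _).hasDerivAt.comp s
    (hasDerivAt_quadratic_shift σ l r s)).deriv

theorem deriv_deriv_comp_quadratic_shift {U : ℝ → ℝ} (hU : ContDiff ℝ 2 U) (σ l r s : ℝ) :
    deriv (deriv fun s => U (s + σ * ((s - l) ^ 2 - (r - l) ^ 2) / 2)) s =
      deriv (deriv U) (s + σ * ((s - l) ^ 2 - (r - l) ^ 2) / 2) * (1 + σ * (s - l)) ^ 2 +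
        deriv U (s + σ * ((s - l) ^ 2 - (r - l) ^ 2) / 2) * σ := by
  rw [deriv_comp_quadratic_shift hU]
  have h1 := (((contDiff_one_deriv hU).differentiable (by norm_num)) _).hasDerivAt.comp s
    (hasDerivAt_quadratic_shift σ l r s)
  have h2 : HasDerivAt (fun s => 1 + σ * (s - l)) σ s := by
    simpa using (((hasDerivAt_id s).sub_const l).const_mul σ).const_add 1
  refine (h1.mul h2).deriv.trans ?_
  simp only [Function.comp_apply]
  ring

theorem ViscSub.le_of_convex_supersolution (ha : 0 < a) (haA : a ≤ A) (hα : -1 < α)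
    (hF : UniformlyElliptic N a A Ftil)
    (hsub : ViscSub α Ftil (fun _ s => -f s) Set.univ u) (hu : Continuous u) {B : ℝ}
    (hB : ∀ x, u x ≤ B) {U : ℝ → ℝ} (hU : ContDiff ℝ 2 U) {l r q : ℝ} (hq : 0 < q)
    (hslope : ∀ y, q ≤ deriv U y) (hconv : ∀ y, 0 ≤ deriv (deriv U) y)
    (hl : ∀ x : ESp N, x 0 = l → u x ≤ U l) (hr : ∀ x : ESp N, x 0 = r → u x ≤ U r)
    (hode : ∀ x : ESp N, x 0 ∈ Set.Icc l r → ∀ y ≤ r, U y < u x →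
      deriv U y ^ α * (deriv (deriv U) y * Ftil (Matrix.single 0 0 1)) ≤ -f (u x))
    {z : ESp N} (hz : z 0 ∈ Set.Icc l r) : u z ≤ U (z 0) := by
  have hmono : Monotone U :=
    monotone_of_deriv_nonneg (hU.differentiable (by norm_num)) fun y => hq.le.trans (hslope y)
  have hκ : 0 ≤ Ftil (Matrix.single 0 0 1) := by
    have := (hF.apply_smul_single_sub zero_le_one).1
    rw [zero_smul, hF.apply_zero, one_smul] at this
    linarith
  have hlr : 0 ≤ r - l := by linarith [hz.1, hz.2]
  have main : ∀ᶠ σ : ℝ in 𝓝[>] 0,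
      u z ≤ U (z 0 + -σ * ((z 0 - l) ^ 2 - (r - l) ^ 2) / 2) := by
    have e1 : ∀ᶠ σ : ℝ in 𝓝[>] 0, σ * (r - l) < 1 / 2 :=
      (Continuous.tendsto' (by fun_prop) 0 0 (by simp)).mono_left nhdsWithin_le_nhds
        |>.eventually_lt_const (by norm_num)
    filter_upwards [e1, self_mem_nhdsWithin] with σ hσ1 hσ
    have hσ : 0 < σ := hσ
    have hfac : ∀ y ∈ Set.Icc l r, 1 / 2 ≤ 1 + -σ * (y - l) ∧ 1 + -σ * (y - l) ≤ 1 := by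
      intro y hy
      have h1 : 0 ≤ σ * (y - l) := mul_nonneg hσ.le (by linarith [hy.1])
      have h2 : σ * (y - l) ≤ σ * (r - l) := mul_le_mul_of_nonneg_left (by linarith [hy.2]) hσ.le
      constructor <;> linarith
    refine hsub.le_of_strict_supersolution ha haA hF hu hB
      (W := fun s => U (s + -σ * ((s - l) ^ 2 - (r - l) ^ 2) / 2))
      (hU.comp (by fun_prop)) (l := l) (r := r) (q := q / 2) (τ := a * σ * (q / 2) ^ (α + 1))
      (by positivity) (by positivity) ?_ ?_ ?_ ?_ hz
    · intro y hy
      rw [deriv_comp_quadratic_shift hU]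
      refine le_trans ?_ (le_abs_self _)
      have := mul_le_mul (hslope (y + -σ * ((y - l) ^ 2 - (r - l) ^ 2) / 2)) (hfac y hy).1
        (by norm_num) (hq.le.trans (hslope _))
      linarith
    · intro x hx
      refine (hl x hx).trans (hmono ?_)
      have : 0 ≤ σ * (r - l) ^ 2 := by positivity
      linarith
    · intro x hx
      refine (hr x hx).trans (hmono ?_)
      linarith
    · intro x hx hlt
      have hyr : x 0 + -σ * ((x 0 - l) ^ 2 - (r - l) ^ 2) / 2 ≤ r := by
        have h1 : 0 ≤ r - x 0 := by linarith [hx.2]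
        have h2 : σ * (r + x 0 - 2 * l) ≤ σ * (2 * (r - l)) :=
          mul_le_mul_of_nonneg_left (by linarith [hx.2]) hσ.le
        have h3 : σ * (r + x 0 - 2 * l) ≤ 1 := by linarith
        have h4 := mul_le_mul_of_nonneg_left h3 h1
        linarith
      rw [deriv_deriv_comp_quadratic_shift hU, deriv_comp_quadratic_shift hU]
      have ho := hode x hx _ hyr hlt
      obtain ⟨hw1, hw2⟩ := hfac _ hx
      set y := x 0 + -σ * ((x 0 - l) ^ 2 - (r - l) ^ 2) / 2
      set w := 1 + -σ * (x 0 - l)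
      have hp := hslope y
      have hm := hconv y
      set p := deriv U y
      set m := deriv (deriv U) y
      have hp0 : 0 < p := hq.trans_le hp
      have hw0 : 0 < w := by linarith
      have hE := (hF.apply_smul_single_sub (m := m * w ^ 2 + p * -σ) (m' := m * w ^ 2)
        (by nlinarith)).1
      rw [hF.1 (m * w ^ 2) (by positivity) (Matrix.single 0 0 1)
        (by simpa using isSymm_smul_single (N := N) 1)] at hE
      rw [abs_of_pos (mul_pos hp0 hw0)]
      have hpw : 0 < (p * w) ^ α := by positivity
      have h1 := mul_le_mul_of_nonneg_left hE hpw.le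
      have hws : w ^ α * w ^ 2 ≤ 1 := by
        rw [← Real.rpow_natCast, ← Real.rpow_add hw0]
        exact Real.rpow_le_one hw0.le hw2 (by push_cast; linarith)
      have hpm : 0 ≤ p ^ α * (m * Ftil (Matrix.single 0 0 1)) := by positivity
      have h2 : (p * w) ^ α * (m * w ^ 2 * Ftil (Matrix.single 0 0 1)) ≤ -f (u x) := by
        rw [Real.mul_rpow hp0.le hw0.le]
        have := mul_le_mul_of_nonneg_left hws hpm
        linarith
      have h3 : (q / 2) ^ (α + 1) ≤ (p * w) ^ α * p := by
        calc (q / 2) ^ (α + 1) ≤ (p * w) ^ (α + 1) :=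
              Real.rpow_le_rpow (by positivity) (by nlinarith) (by linarith)
          _ = (p * w) ^ α * (p * w) := Real.rpow_add_one (by positivity) _
          _ ≤ (p * w) ^ α * p := by
              refine mul_le_mul_of_nonneg_left ?_ hpw.le
              nlinarith
      have h4 := mul_le_mul_of_nonneg_left h3 (mul_pos ha hσ).le
      linarith
  have hlim : Tendsto (fun σ : ℝ => U (z 0 + -σ * ((z 0 - l) ^ 2 - (r - l) ^ 2) / 2)) (𝓝[>] 0)
      (𝓝 (U (z 0))) := by
    refine (Continuous.tendsto' (hU.continuous.comp (by fun_prop)) 0 _ ?_).mono_left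
      nhdsWithin_le_nhds
    simp
  exact ge_of_tendsto hlim main

theorem ViscSuper.convex_subsolution_le (ha : 0 < a) (haA : a ≤ A) (hα : -1 < α)
    (hF : UniformlyElliptic N a A Ftil)
    (hsup : ViscSuper α Ftil (fun _ s => -f s) Set.univ u) (hu : Continuous u) {B : ℝ}
    (hB : ∀ x, B ≤ u x) {U : ℝ → ℝ} (hU : ContDiff ℝ 2 U) {l r q : ℝ} (hq : 0 < q)
    (hslope : ∀ y, q ≤ deriv U y) (hconv : ∀ y, 0 ≤ deriv (deriv U) y)
    (hl : ∀ x : ESp N, x 0 = l → U l ≤ u x) (hr : ∀ x : ESp N, x 0 = r → U r ≤ u x)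
    (hode : ∀ x : ESp N, x 0 ∈ Set.Icc l r → ∀ y ≤ r, u x < U y →
      -f (u x) ≤ deriv U y ^ α * (deriv (deriv U) y * Ftil (Matrix.single 0 0 1)))
    {z : ESp N} (hz : z 0 ∈ Set.Icc l r) : U (z 0) ≤ u z := by
  have hmono : Monotone U :=
    monotone_of_deriv_nonneg (hU.differentiable (by norm_num)) fun y => hq.le.trans (hslope y)
  have hκ : 0 ≤ Ftil (Matrix.single 0 0 1) := by
    have := (hF.apply_smul_single_sub zero_le_one).1
    rw [zero_smul, hF.apply_zero, one_smul] at this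
    linarith
  have hlr : 0 ≤ r - l := by linarith [hz.1, hz.2]
  have main : ∀ᶠ σ : ℝ in 𝓝[>] 0,
      U (z 0 + σ * ((z 0 - l) ^ 2 - (r - l) ^ 2) / 2) ≤ u z := by
    have e1 : ∀ᶠ σ : ℝ in 𝓝[>] 0, σ * (r - l) < 1 :=
      (Continuous.tendsto' (by fun_prop) 0 0 (by simp)).mono_left nhdsWithin_le_nhds
        |>.eventually_lt_const (by norm_num)
    filter_upwards [e1, self_mem_nhdsWithin] with σ hσ1 hσ
    have hσ : 0 < σ := hσ
    have hfac : ∀ y ∈ Set.Icc l r, 1 ≤ 1 + σ * (y - l) ∧ 1 + σ * (y - l) ≤ 2 := by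
      intro y hy
      have h1 : 0 ≤ σ * (y - l) := mul_nonneg hσ.le (by linarith [hy.1])
      have h2 : σ * (y - l) ≤ σ * (r - l) := mul_le_mul_of_nonneg_left (by linarith [hy.2]) hσ.le
      constructor <;> linarith
    refine hsup.strict_subsolution_le ha haA hF hu hB
      (W := fun s => U (s + σ * ((s - l) ^ 2 - (r - l) ^ 2) / 2))
      (hU.comp (by fun_prop)) (l := l) (r := r) (q := q) (τ := a * σ * (q ^ (α + 1) / 2))
      hq (by positivity) ?_ ?_ ?_ ?_ hz
    · intro y hy
      rw [deriv_comp_quadratic_shift hU]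
      refine le_trans ?_ (le_abs_self _)
      have := mul_le_mul (hslope (y + σ * ((y - l) ^ 2 - (r - l) ^ 2) / 2)) (hfac y hy).1
        (by norm_num) (hq.le.trans (hslope _))
      linarith
    · intro x hx
      refine (hmono ?_).trans (hl x hx)
      have : 0 ≤ σ * (r - l) ^ 2 := by positivity
      linarith
    · intro x hx
      refine (hmono ?_).trans (hr x hx)
      linarith
    · intro x hx hlt
      have hyr : x 0 + σ * ((x 0 - l) ^ 2 - (r - l) ^ 2) / 2 ≤ r := by
        have h1 : (x 0 - l) ^ 2 ≤ (r - l) ^ 2 :=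
          pow_le_pow_left₀ (by linarith [hx.1]) (by linarith [hx.2]) 2
        have h2 := mul_le_mul_of_nonneg_left h1 hσ.le
        linarith [hx.2]
      rw [deriv_deriv_comp_quadratic_shift hU, deriv_comp_quadratic_shift hU]
      have ho := hode x hx _ hyr hlt
      obtain ⟨hw1, hw2⟩ := hfac _ hx
      set y := x 0 + σ * ((x 0 - l) ^ 2 - (r - l) ^ 2) / 2
      set w := 1 + σ * (x 0 - l)
      have hp := hslope y
      have hm := hconv y
      set p := deriv U y
      set m := deriv (deriv U) y
      have hp0 : 0 < p := hq.trans_le hp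
      have hw0 : 0 < w := by linarith
      have hE := (hF.apply_smul_single_sub (m := m * w ^ 2) (m' := m * w ^ 2 + p * σ)
        (by nlinarith)).1
      rw [hF.1 (m * w ^ 2) (by positivity) (Matrix.single 0 0 1)
        (by simpa using isSymm_smul_single (N := N) 1)] at hE
      rw [abs_of_pos (mul_pos hp0 hw0)]
      have hpw : 0 < (p * w) ^ α := by positivity
      have h1 := mul_le_mul_of_nonneg_left hE hpw.le
      have hws : 1 ≤ w ^ α * w ^ 2 := by
        rw [← Real.rpow_natCast, ← Real.rpow_add hw0]
        exact Real.one_le_rpow hw1 (by push_cast; linarith)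
      have hpm : 0 ≤ p ^ α * (m * Ftil (Matrix.single 0 0 1)) := by positivity
      have h2 : -f (u x) ≤ (p * w) ^ α * (m * w ^ 2 * Ftil (Matrix.single 0 0 1)) := by
        rw [Real.mul_rpow hp0.le hw0.le]
        have := mul_le_mul_of_nonneg_left hws hpm
        linarith
      have h3 : q ^ (α + 1) / 2 ≤ (p * w) ^ α * p := by
        have h5 : q ^ (α + 1) ≤ (p * w) ^ α * (2 * p) := by
          calc q ^ (α + 1) ≤ (p * w) ^ (α + 1) :=
                Real.rpow_le_rpow (by positivity) (by nlinarith) (by linarith)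
            _ = (p * w) ^ α * (p * w) := Real.rpow_add_one (by positivity) _
            _ ≤ (p * w) ^ α * (2 * p) := by
                refine mul_le_mul_of_nonneg_left ?_ hpw.le
                nlinarith
        linarith
      have h4 := mul_le_mul_of_nonneg_left h3 (mul_pos ha hσ).le
      linarith
  have hlim : Tendsto (fun σ : ℝ => U (z 0 + σ * ((z 0 - l) ^ 2 - (r - l) ^ 2) / 2)) (𝓝[>] 0)
      (𝓝 (U (z 0))) := by
    refine (Continuous.tendsto' (hU.continuous.comp (by fun_prop)) 0 _ ?_).mono_left
      nhdsWithin_le_nhds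
    simp
  exact le_of_tendsto hlim main

end NonstrictComparison

theorem exists_orderIso_hasDerivAt_symm {Q : ℝ → ℝ} (hQ : Continuous Q) {q q' : ℝ} (hq : 0 < q)
    (hlow : ∀ s, q ≤ Q s) (hupp : ∀ s, Q s ≤ q') (s₀ : ℝ) :
    ∃ e : ℝ ≃o ℝ, e s₀ = 0 ∧ ∀ y, HasDerivAt e.symm (Q (e.symm y)) y := by
  have hQpos : ∀ s, 0 < Q s := fun s => hq.trans_le (hlow s)
  have hq' : 0 < q' := (hQpos 0).trans_le (hupp 0)
  have hinv : Continuous fun s => (Q s)⁻¹ := hQ.inv₀ fun s => (hQpos s).ne'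
  set X : ℝ → ℝ := fun s => ∫ t in s₀..s, (Q t)⁻¹ with hX
  have hXd : ∀ s, HasDerivAt X (Q s)⁻¹ s := fun s =>
    (hinv.integral_hasStrictDerivAt s₀ s).hasDerivAt
  have hX0 : X s₀ = 0 := by simp [hX]
  have hXmono : StrictMono X := strictMono_of_deriv_pos fun s => by
    rw [(hXd s).deriv]; exact inv_pos.2 (hQpos s)
  have hlin : Monotone fun s => X s - s * q'⁻¹ := by
    have hd : ∀ s, HasDerivAt (fun s => X s - s * q'⁻¹) ((Q s)⁻¹ - 1 * q'⁻¹) s := fun s =>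
      (hXd s).sub ((hasDerivAt_id s).mul_const _)
    refine monotone_of_deriv_nonneg (fun s => (hd s).differentiableAt) fun s => ?_
    rw [(hd s).deriv, one_mul, sub_nonneg]
    exact inv_anti₀ (hQpos s) (hupp s)
  have hXc : Continuous X := continuous_iff_continuousAt.2 fun s => (hXd s).continuousAt
  have htop : Tendsto X atTop atTop := by
    refine tendsto_atTop_mono' _ (f₁ := fun s => (s - s₀) * q'⁻¹) ?_ ?_
    · filter_upwards [eventually_ge_atTop s₀] with s hs
      have := hlin hs
      simp only [hX0] at this
      linarith
    · exact (tendsto_atTop_add_const_right _ _ tendsto_id).atTop_mul_const (inv_pos.2 hq')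
  have hbot : Tendsto X atBot atBot := by
    refine tendsto_atBot_mono' _ (f₁ := fun s => (s - s₀) * q'⁻¹) ?_ ?_
    · filter_upwards [eventually_le_atBot s₀] with s hs
      have := hlin hs
      simp only [hX0] at this
      linarith
    · exact (tendsto_atBot_add_const_right _ _ tendsto_id).atBot_mul_const (inv_pos.2 hq')
  set e : ℝ ≃o ℝ := hXmono.orderIsoOfSurjective X (hXc.surjective htop hbot) with he
  refine ⟨e, hX0, fun y => ?_⟩
  have := HasDerivAt.of_local_left_inverse (f := X) (g := e.symm) (a := y)
    e.symm.continuous.continuousAt (hXd _) (inv_ne_zero (hQpos _).ne')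
    (Eventually.of_forall fun y => e.apply_symm_apply y)
  rwa [inv_inv] at this

theorem exists_convex_profile {κ α q : ℝ} (hκ : 0 < κ) (hα : -1 < α) (hq : 0 < q) {k : ℝ → ℝ}
    (hk : Continuous k) (hk0 : ∀ s, 0 ≤ k s) (hkl : ∀ s ≤ -1, k s = 0) {C : ℝ}
    (hkr : ∀ s, C ≤ s → k s = 0) (x₀ s₀ : ℝ) :
    ∃ U : ℝ → ℝ, ContDiff ℝ 2 U ∧ U x₀ = s₀ ∧ (∀ y, q ≤ deriv U y) ∧
      (∀ y, 0 ≤ deriv (deriv U) y) ∧ (∀ y, U y ≤ -1 → deriv U y = q) ∧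
      ∀ y, deriv U y ^ α * (deriv (deriv U) y * κ) = k (U y) := by
  have hα2 : 0 < α + 2 := by linarith
  set G : ℝ → ℝ := fun s => ∫ t in (-1)..s, k t with hG
  have hGd : ∀ s, HasDerivAt G (k s) s := fun s => (hk.integral_hasStrictDerivAt (-1) s).hasDerivAt
  have hGmono : Monotone G := monotone_of_deriv_nonneg (fun s => (hGd s).differentiableAt)
    fun s => by rw [(hGd s).deriv]; exact hk0 s
  have hGl : ∀ s ≤ -1, G s = 0 := by
    intro s hs
    have : G s = ∫ t in (-1)..s, (0 : ℝ) := by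
      refine intervalIntegral.integral_congr fun t ht => ?_
      rw [Set.uIcc_of_ge hs] at ht
      exact hkl t ht.2
    simpa using this
  have hG0 : ∀ s, 0 ≤ G s := by
    intro s
    rcases le_total s (-1) with h | h
    · rw [hGl s h]
    · rw [← hGl (-1) le_rfl]; exact hGmono h
  have hGC : ∀ s, G s ≤ G C := by
    intro s
    rcases le_total s C with h | h
    · exact hGmono h
    · have h1 : ∫ t in C..s, k t = ∫ t in C..s, (0 : ℝ) := by
        refine intervalIntegral.integral_congr fun t ht => ?_
        rw [Set.uIcc_of_le h] at ht
        exact hkr t ht.1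
      have h2 := intervalIntegral.integral_add_adjacent_intervals
        (hk.intervalIntegrable (μ := MeasureTheory.volume) (-1) C) (hk.intervalIntegrable C s)
      rw [h1, intervalIntegral.integral_zero, add_zero] at h2
      exact h2.symm.le
  set b : ℝ → ℝ := fun s => q ^ (α + 2) + (α + 2) / κ * G s with hb
  have hqp : 0 < q ^ (α + 2) := by positivity
  have hbq : ∀ s, q ^ (α + 2) ≤ b s := fun s =>
    le_add_of_nonneg_right (mul_nonneg (by positivity) (hG0 s))
  have hbpos : ∀ s, 0 < b s := fun s => hqp.trans_le (hbq s)
  set Q : ℝ → ℝ := fun s => b s ^ (α + 2)⁻¹ with hQ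
  have hQpow : ∀ s p, Q s ^ p = b s ^ ((α + 2)⁻¹ * p) := fun s p =>
    (Real.rpow_mul (hbpos s).le _ _).symm
  have hqq : (q ^ (α + 2)) ^ (α + 2)⁻¹ = q := Real.rpow_rpow_inv hq.le hα2.ne'
  have hQq : ∀ s, q ≤ Q s := fun s => by
    rw [← hqq]
    exact Real.rpow_le_rpow hqp.le (hbq s) (by positivity)
  have hQC : ∀ s, Q s ≤ Q C := fun s =>
    Real.rpow_le_rpow (hbpos s).le
      (add_le_add_right (mul_le_mul_of_nonneg_left (hGC s) (by positivity)) _) (by positivity)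
  have hQpos : ∀ s, 0 < Q s := fun s => hq.trans_le (hQq s)
  have hQd : ∀ s, HasDerivAt Q (k s / κ * Q s ^ (-(α + 1))) s := by
    intro s
    have h := (((hGd s).const_mul ((α + 2) / κ)).const_add (q ^ (α + 2))).rpow_const
      (p := (α + 2)⁻¹) (Or.inl (hbpos s).ne')
    refine h.congr_deriv ?_
    rw [hQpow, show (α + 2)⁻¹ * -(α + 1) = (α + 2)⁻¹ - 1 by field_simp; ring]
    rw [show (α + 2) / κ * k s * (α + 2)⁻¹ = k s / κ by field_simp]
  have hQc : Continuous Q := continuous_iff_continuousAt.2 fun s => (hQd s).continuousAt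
  have hQ1 : ContDiff ℝ 1 Q := by
    rw [contDiff_one_iff_deriv]
    refine ⟨fun s => (hQd s).differentiableAt, ?_⟩
    rw [show deriv Q = fun s => k s / κ * Q s ^ (-(α + 1)) from funext fun s => (hQd s).deriv]
    exact (hk.div_const _).mul (hQc.rpow_const fun s => Or.inl (hQpos s).ne')
  obtain ⟨e, he0, he⟩ := exists_orderIso_hasDerivAt_symm hQc hq hQq hQC s₀
  set U : ℝ → ℝ := fun y => e.symm (y - x₀) with hU
  have hUd : ∀ y, HasDerivAt U (Q (U y)) y := fun y => (he (y - x₀)).comp_sub_const y x₀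
  have hUd' : deriv U = fun y => Q (U y) := funext fun y => (hUd y).deriv
  have hUdd : ∀ y, deriv (deriv U) y = k (U y) / κ * Q (U y) ^ (-(α + 1)) * Q (U y) := by
    intro y
    rw [hUd']
    exact ((hQd (U y)).comp y (hUd y)).deriv
  have hU1 : ContDiff ℝ 1 U := by
    rw [contDiff_one_iff_deriv]
    refine ⟨fun y => (hUd y).differentiableAt, ?_⟩
    rw [hUd']
    exact hQc.comp (continuous_iff_continuousAt.2 fun y => (hUd y).continuousAt)
  refine ⟨U, ?_, ?_, ?_, ?_, ?_, ?_⟩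
  · rw [← one_add_one_eq_two, contDiff_succ_iff_deriv]
    refine ⟨fun y => (hUd y).differentiableAt, by simp, ?_⟩
    rw [hUd']
    exact hQ1.comp hU1
  · simp only [hU, sub_self]
    rw [e.symm_apply_eq, he0]
  · intro y
    rw [hUd']
    exact hQq _
  · intro y
    rw [hUdd]
    have := hk0 (U y)
    have := (hQpos (U y)).le
    positivity
  · intro y hy
    rw [hUd']
    simp only [hQ, hb, hGl _ hy, mul_zero, add_zero]
    exact hqq
  · intro y
    rw [hUdd, hUd']
    have h1 : Q (U y) ^ α * (Q (U y) ^ (-(α + 1)) * Q (U y)) = 1 := by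
      rw [← Real.rpow_add_one (hQpos _).ne', ← Real.rpow_add (hQpos _)]
      simp
    calc Q (U y) ^ α * (k (U y) / κ * Q (U y) ^ (-(α + 1)) * Q (U y) * κ)
        = (Q (U y) ^ α * (Q (U y) ^ (-(α + 1)) * Q (U y))) * (k (U y) / κ * κ) := by ring
      _ = k (U y) := by rw [h1, one_mul, div_mul_cancel₀ _ hκ.ne']

section Sliding

variable {N : ℕ} [NeZero N] {a A α : ℝ} {Ftil : Matrix (Fin N) (Fin N) ℝ → ℝ}
  {f : ℝ → ℝ} {u : ESp N → ℝ}

theorem exists_nonneg_extension_neg {f : ℝ → ℝ} (hf : ContinuousOn f (Set.Icc (-1) 1))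
    (hfm1 : f (-1) = 0) {s₀ : ℝ} (hs₀ : -1 ≤ s₀) (hs₀1 : s₀ ≤ 1)
    (hmono : AntitoneOn f (Set.Icc (-1) s₀)) :
    ∃ k : ℝ → ℝ, Continuous k ∧ (∀ s, 0 ≤ k s) ∧ (∀ s ≤ -1, k s = 0) ∧
      (∀ s, 2 * s₀ + 1 ≤ s → k s = 0) ∧ (∀ s ∈ Set.Icc (-1) s₀, k s = -f s) ∧
      ∀ s s', s ≤ s' → s' ≤ s₀ → k s ≤ k s' := by
  have harg : ∀ s, max (-1) (s₀ - |s - s₀|) ∈ Set.Icc (-1) s₀ := fun s =>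
    ⟨le_max_left _ _, max_le hs₀ (by linarith [abs_nonneg (s - s₀)])⟩
  have hle : ∀ s ≤ s₀, s₀ - |s - s₀| = s := fun s hs => by
    rw [abs_of_nonpos (by linarith)]; ring
  refine ⟨fun s => -f (max (-1) (s₀ - |s - s₀|)), ?_, ?_, ?_, ?_, ?_, ?_⟩
  · exact (hf.comp_continuous (by fun_prop) fun s =>
      ⟨(harg s).1, (harg s).2.trans hs₀1⟩).neg
  · intro s
    have := hmono ⟨le_rfl, hs₀⟩ (harg s) (harg s).1
    rw [hfm1] at this
    exact neg_nonneg.2 this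
  · intro s hs
    simp only [hle s (hs.trans hs₀), max_eq_left hs, hfm1, neg_zero]
  · intro s hs
    have h1 : s₀ - |s - s₀| ≤ -1 := by linarith [le_abs_self (s - s₀)]
    simp only [max_eq_left h1, hfm1, neg_zero]
  · intro s hs
    simp only [hle s hs.2, max_eq_right hs.1]
  · intro s s' h h'
    refine neg_le_neg (hmono (harg s) (harg s') ?_)
    rw [hle s (h.trans h'), hle s' h']
    exact max_le_max_left _ h

theorem ViscSol.le_comp_add_of_apply_le (ha : 0 < a) (haA : a ≤ A) (hα : -1 < α)
    (hF : UniformlyElliptic N a A Ftil) (hf : ContinuousOn f (Set.Icc (-1) 1))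
    (hfm1 : f (-1) = 0) {δ₀ : ℝ} (hδ₀ : δ₀ ∈ Set.Ioo (0 : ℝ) 1)
    (hmono : AntitoneOn f (Set.Icc (-1) (-1 + δ₀))) (hu : Continuous u)
    (hrange : ∀ x, u x ∈ Set.Icc (-1 : ℝ) 1)
    (hsol : ViscSol α Ftil (fun _ s => -f s) Set.univ u)
    (hlim : ∀ ε > (0 : ℝ), ∃ R : ℝ, ∀ x : ESp N, x 0 ≤ R → |u x + 1| < ε)
    {M : ℝ} (hM : 0 < M) (hMpos : ∀ x : ESp N, M ≤ x 0 → 1 - δ₀ ≤ u x)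
    (hMneg : ∀ x : ESp N, x 0 ≤ -M → u x ≤ -1 + δ₀)
    {v : ESp N} (hv : 2 * M < v 0) {x : ESp N} (hx : x 0 ≤ -M) : u x ≤ u (x + v) := by
  obtain ⟨hδ, hδ1⟩ := hδ₀
  have hκ : 0 < Ftil (Matrix.single 0 0 1) := by
    have := (hF.apply_smul_single_sub zero_le_one).1
    rw [zero_smul, hF.apply_zero, one_smul] at this
    linarith
  obtain ⟨k, hkc, hk0, hkl, hkr, hkf, hkm⟩ :=
    exists_nonneg_extension_neg hf hfm1 (by linarith) (by linarith) hmono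
  refine le_of_forall_pos_le_add fun η hη => ?_
  set ε := η / 2 with hε
  have hε0 : 0 < ε := by positivity
  obtain ⟨R, hR⟩ := hlim ε hε0
  set L := max M (-R) with hL
  have hML : M ≤ L := le_max_left _ _
  have hL0 : 0 < L := hM.trans_le hML
  have hRL : ∀ y : ESp N, y 0 ≤ -L → u y ≤ -1 + ε := fun y hy => by
    have := (abs_lt.1 (hR y (by linarith [le_max_right M (-R)]))).2
    linarith
  have hq : 0 < ε / L := by positivity
  obtain ⟨U, hU, hU0, hU1, hU2, hUq, hUk⟩ :=
    exists_convex_profile hκ hα hq hkc hk0 hkl hkr (-M) (-1 + δ₀)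
  have hUd := hU.differentiable (by norm_num)
  have hUm : Monotone U := monotone_of_deriv_nonneg hUd fun y => hq.le.trans (hU1 y)
  have hlower : U (x 0) ≤ u (x + v) := by
    set l := -M - δ₀ / (ε / L) with hl
    have hlM : l ≤ -M := by
      have : 0 < δ₀ / (ε / L) := by positivity
      linarith
    have hUl : U l ≤ -1 := by
      have := mul_sub_le_image_sub_of_le_deriv hUd hU1 hlM
      rw [hU0, show -M - l = δ₀ / (ε / L) by rw [hl]; ring, mul_div_cancel₀ _ hq.ne'] at this
      linarith
    rcases le_total (x 0) l with hxl | hxl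
    · exact ((hUm hxl).trans hUl).trans (hrange _).1
    · have hd : deriv (fun y => U (y - v 0)) = fun y => deriv U (y - v 0) :=
        funext fun y => deriv_comp_sub_const _ _ _
      have hdd : deriv (deriv fun y => U (y - v 0)) = fun y => deriv (deriv U) (y - v 0) := by
        rw [hd]
        exact funext fun y => deriv_comp_sub_const _ _ _
      have := hsol.2.convex_subsolution_le ha haA hα hF hu (fun y => (hrange y).1)
        (U := fun y => U (y - v 0)) (hU.comp (by fun_prop)) (l := l + v 0) (r := -M + v 0) hq
        (fun y => by rw [hd]; exact hU1 _) (fun y => by rw [hdd]; exact hU2 _)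
        (fun y _ => by
          rw [add_sub_cancel_right]
          exact hUl.trans (hrange _).1)
        (fun y hy => by
          rw [add_sub_cancel_right, hU0]
          linarith [hMpos y (by linarith)])
        (fun y _ s hs hlt => by
          have hUs : U (s - v 0) ≤ -1 + δ₀ := by
            rw [← hU0]
            exact hUm (by linarith)
          rw [hdd, hd]
          simp only [hUk]
          rw [← hkf (u y) ⟨(hrange y).1, hlt.le.trans hUs⟩]
          exact hkm _ _ hlt.le hUs)
        (z := x + v) ⟨by simpa using hxl, by
          rw [PiLp.add_apply]; linarith⟩
      simpa using this
  rcases le_total (x 0) (-L) with hxL | hxL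
  · linarith [hRL x hxL, (hrange (x + v)).1]
  · have hUL : -1 - ε ≤ U (-L) := by
      by_contra! hlt
      obtain ⟨y, hy, hUy⟩ := intermediate_value_Icc (neg_le_neg hML) hU.continuous.continuousOn
        (show (-1 : ℝ) ∈ Set.Icc (U (-L)) (U (-M)) from ⟨by linarith, by rw [hU0]; linarith⟩)
      have := (convex_Icc (-L) y).image_sub_le_mul_sub_of_deriv_le hU.continuous.continuousOn
        hUd.differentiableOn (C := ε / L)
        (fun s hs => (hUq s ((hUm (interior_subset hs).2).trans hUy.le)).le)
        (-L) ⟨le_rfl, hy.1⟩ y ⟨hy.1, le_rfl⟩ hy.1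
      have h1 : ε / L * (y - -L) ≤ ε / L * L :=
        mul_le_mul_of_nonneg_left (by linarith [hy.2]) hq.le
      rw [div_mul_cancel₀ _ hL0.ne'] at h1
      linarith
    have hd : deriv (fun y => U y + 2 * ε) = deriv U := funext fun y => deriv_add_const _
    have hupper := hsol.1.le_of_convex_supersolution ha haA hα hF hu (fun y => (hrange y).2)
      (U := fun y => U y + 2 * ε) (hU.add contDiff_const) (l := -L) (r := -M) hq
      (fun y => by rw [hd]; exact hU1 _) (fun y => by rw [hd]; exact hU2 _)
      (fun y hy => by linarith [hRL y hy.le])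
      (fun y hy => by
        rw [hU0]
        linarith [hMneg y hy.le])
      (fun y hy s _ hlt => by
        have huy := hMneg y hy.2
        rw [hd, hUk, ← hkf (u y) ⟨(hrange y).1, huy⟩]
        exact hkm _ _ (by linarith) huy)
      (z := x) ⟨hxL, hx⟩
    linarith

end Sliding

/-- **Claim 1 of the proof of Theorem 4.1.** With `M₁` such that `u ≥ 1 - δ₀`
on `{x₁ ≥ M₁}` and `u ≤ -1 + δ₀` on `{x₁ ≤ -M₁}`, for every direction `ν` with
`ν₁ > 0` and every `t > 2M₁/ν₁`, one has `u(x + tν) ≥ u(x)` in `ℝ^N`. -/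
theorem sliding_claim_one
    (N : ℕ) [NeZero N] (a A α : ℝ) (ha : 0 < a) (haA : a ≤ A) (hα : -1 < α)
    (Ftil : Matrix (Fin N) (Fin N) ℝ → ℝ) (hF : UniformlyElliptic N a A Ftil)
    (f : ℝ → ℝ) (hf : ContDiffOn ℝ 1 f (Set.Icc (-1) 1))
    (hfm1 : f (-1) = 0) (hf1 : f 1 = 0)
    (δ₀ : ℝ) (hδ₀ : δ₀ ∈ Set.Ioo (0:ℝ) 1)
    (hmonoNeg : AntitoneOn f (Set.Icc (-1) (-1 + δ₀)))
    (hmonoPos : AntitoneOn f (Set.Icc (1 - δ₀) 1))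
    (u : ESp N → ℝ) (hu : Continuous u)
    (hrange : ∀ x, u x ∈ Set.Icc (-1 : ℝ) 1)
    (hsol : ViscSol α Ftil (fun _ s => -f s) Set.univ u)
    (hlimPos : ∀ ε > (0:ℝ), ∃ R : ℝ, ∀ x : ESp N, R ≤ x 0 → |u x - 1| < ε)
    (hlimNeg : ∀ ε > (0:ℝ), ∃ R : ℝ, ∀ x : ESp N, x 0 ≤ R → |u x + 1| < ε)
    (hgrad : α ≠ 0 → ∀ b c : ℝ, b < c →
      ∃ m > (0:ℝ), GradGE m {x : ESp N | x 0 ∈ Set.Icc b c} u)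
    (M₁ : ℝ) (hM₁ : 0 < M₁)
    (hMpos : ∀ x : ESp N, M₁ ≤ x 0 → 1 - δ₀ ≤ u x)
    (hMneg : ∀ x : ESp N, x 0 ≤ -M₁ → u x ≤ -1 + δ₀) :
    ∀ ν : ESp N, 0 < ν 0 → ∀ t : ℝ, 2 * M₁ / ν 0 < t →
      ∀ x : ESp N, u x ≤ u (x + t • ν) := by
  intro ν hν t ht x
  have hv : 2 * M₁ < (t • ν) 0 := by
    have := (div_lt_iff₀ hν).1 ht
    simpa using this
  have hfc := hf.continuousOn
  rcases le_total (x 0) (-M₁) with hx | hx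
  · exact hsol.le_comp_add_of_apply_le ha haA hα hF hfc hfm1 hδ₀ hmonoNeg hu hrange hlimNeg hM₁
      hMpos hMneg hv hx
  · have key := ViscSol.le_comp_add_of_apply_le (α := α) (Ftil := fun M => -Ftil (-M))
      (f := fun s => -f (-s)) (u := fun x => -u (-x)) ha haA hα hF.neg_comp_neg
      (hfc.comp continuousOn_neg fun s hs => ⟨by linarith [hs.2], by linarith [hs.1]⟩).neg
      (by simp [hf1]) hδ₀
      (fun s hs s' hs' h => neg_le_neg (hmonoPos ⟨by linarith [hs'.2], by linarith [hs'.1]⟩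
        ⟨by linarith [hs.2], by linarith [hs.1]⟩ (neg_le_neg h)))
      (hu.comp continuous_neg).neg
      (fun y => ⟨by linarith [(hrange (-y)).2], by linarith [(hrange (-y)).1]⟩)
      ⟨hsol.2.neg_comp_neg, hsol.1.neg_comp_neg⟩
      (fun ε hε => by
        obtain ⟨R, hR⟩ := hlimPos ε hε
        refine ⟨-R, fun y hy => ?_⟩
        have := hR (-y) (by simpa using (by linarith : R ≤ -y 0))
        rwa [← abs_neg, show -(-u (-y) + 1) = u (-y) - 1 by ring])
      hM₁
      (fun y hy => by
        have := hMneg (-y) (by simpa using hy)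
        linarith)
      (fun y hy => by
        have := hMpos (-y) (by simpa using (by linarith : M₁ ≤ -y 0))
        linarith)
      hv (x := -(x + t • ν)) (by
        simp only [PiLp.neg_apply, PiLp.add_apply]
        linarith)
    simp only [neg_neg] at key
    rw [show -(-(x + t • ν) + t • ν) = x by abel] at key
    exact neg_le_neg_iff.1 key
end
end

section
/- For integers k ≤ m define u_{k,m} : ℝ → ℝ by u_{k,m}(x) = 1 for x ≥ (2m+2)π, u_{k,m}(x) = cos x for (2k+1)π ≤ x ≤ (2m+2)π, and u_{k,m}(x) = −1 for x ≤ (2k+1)π. Then each u_{k,m} is C¹ on ℝ, and the function x ↦ |u_{k,m}′(x)|² u_{k,m}′(x) is C¹ on ℝ with derivative equal to −3·(u_{k,m}(x) − u_{k,m}(x)³); that is, u_{k,m} is a weak solution of |u′|² u″ + u − u³ = 0 on ℝ. Moreover, for every integer i ≥ 1 one has u_{0,0} ≥ u_{0,i} on ℝ and u_{0,0}(2π) = u_{0,i}(2π), yet u_{0,0} is not identically equal to u_{0,i}; hence the strong comparison principle fails for this equation without the assumption that the gradient does not vanish. -/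
noncomputable section

open Real Filter Topology

/-- The function `u_{k,m}`: equal to `1` for `x ≥ (2m+2)π`, to `cos x` for
`(2k+1)π ≤ x ≤ (2m+2)π` and to `-1` for `x ≤ (2k+1)π`. -/
def ukm (k m : ℤ) (x : ℝ) : ℝ :=
  if (2 * (m : ℝ) + 2) * π ≤ x then 1
  else if x ≤ (2 * (k : ℝ) + 1) * π then -1
  else Real.cos x

/-- Precomposing with the projection onto `[a, b]` preserves differentiability when the derivative
vanishes at `a` and `b`. -/
theorem hasDerivAt_comp_clamp {a b : ℝ} (hab : a ≤ b) {f f' : ℝ → ℝ}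
    (hf : ∀ x, HasDerivAt f (f' x) x) (ha : f' a = 0) (hb : f' b = 0) (x : ℝ) :
    HasDerivAt (fun y => f (max a (min y b))) (f' (max a (min x b))) x := by
  by_cases h0 : f' (max a (min x b)) = 0
  · have hd := hf (max a (min x b))
    rw [h0] at hd ⊢
    have hc : Tendsto (fun y => max a (min y b)) (𝓝 x) (𝓝 (max a (min x b))) :=
      Continuous.tendsto (by fun_prop) x
    have ho := (hasDerivAt_iff_isLittleO.mp hd).comp_tendsto hc
    rw [hasDerivAt_iff_isLittleO]
    simp only [smul_zero, sub_zero, Function.comp_def] at ho ⊢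
    refine ho.trans_isBigO (Asymptotics.IsBigO.of_bound 1 (Eventually.of_forall fun y => ?_))
    rw [one_mul, Real.norm_eq_abs, Real.norm_eq_abs]
    calc |max a (min y b) - max a (min x b)|
        ≤ |min y b - min x b| := by
          simpa [max_comm a] using abs_max_sub_max_le_abs (min y b) (min x b) a
      _ ≤ |y - x| := by simpa using abs_min_sub_min_le_max y b x b
  · have hax : a < x := by
      by_contra! h
      exact h0 (by rw [max_eq_left ((min_le_left _ _).trans h), ha])
    have hxb : x < b := by
      by_contra! h
      exact h0 (by rw [min_eq_right h, max_eq_right hab, hb])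
    rw [min_eq_left hxb.le, max_eq_right hax.le]
    refine (hf x).congr_of_eventuallyEq ?_
    filter_upwards [Ioo_mem_nhds hax hxb] with y hy
    rw [min_eq_left hy.2.le, max_eq_right hy.1.le]

theorem ukm_eq_cos_clamp {k m : ℤ} (hkm : k ≤ m) :
    ukm k m = fun x => cos (max ((2 * (k : ℝ) + 1) * π) (min x ((2 * (m : ℝ) + 2) * π))) := by
  have hkm' : (k : ℝ) ≤ m := by exact_mod_cast hkm
  have hab : (2 * (k : ℝ) + 1) * π ≤ (2 * (m : ℝ) + 2) * π := by
    gcongr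
    linarith
  funext x
  unfold ukm
  split_ifs with h1 h2
  · rw [min_eq_right h1, max_eq_right hab,
      show (2 * (m : ℝ) + 2) * π = ((m + 1 : ℤ) : ℝ) * (2 * π) by push_cast; ring,
      cos_int_mul_two_pi]
  · rw [max_eq_left ((min_le_left _ _).trans h2),
      show (2 * (k : ℝ) + 1) * π = (k : ℝ) * (2 * π) + π by ring, cos_int_mul_two_pi_add_pi]
  · rw [min_eq_left (not_le.mp h1).le, max_eq_right (not_le.mp h2).le]

theorem ukm_weak_solution {k m : ℤ} (hkm : k ≤ m) :
    ContDiff ℝ 1 (ukm k m) ∧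
      (∀ x : ℝ, HasDerivAt (fun y => |deriv (ukm k m) y| ^ 2 * deriv (ukm k m) y)
        (-3 * (ukm k m x - (ukm k m x) ^ 3)) x) ∧
      Continuous (fun x => -3 * (ukm k m x - (ukm k m x) ^ 3)) := by
  have hkm' : (k : ℝ) ≤ m := by exact_mod_cast hkm
  have hu := ukm_eq_cos_clamp hkm
  have ha : sin ((2 * (k : ℝ) + 1) * π) = 0 := by
    simpa using sin_int_mul_pi (2 * k + 1)
  have hb : sin ((2 * (m : ℝ) + 2) * π) = 0 := by
    simpa using sin_int_mul_pi (2 * m + 2)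
  have hab : (2 * (k : ℝ) + 1) * π ≤ (2 * (m : ℝ) + 2) * π := by
    gcongr
    linarith
  generalize (2 * (k : ℝ) + 1) * π = a at *
  generalize (2 * (m : ℝ) + 2) * π = b at *
  have hd : ∀ x, HasDerivAt (ukm k m) (-sin (max a (min x b))) x := fun x => by
    rw [hu]
    exact hasDerivAt_comp_clamp (f' := fun t => -sin t) hab hasDerivAt_cos
      (by simp [ha]) (by simp [hb]) x
  have hderiv : deriv (ukm k m) = fun x => -sin (max a (min x b)) := funext fun x => (hd x).deriv
  refine ⟨contDiff_one_iff_deriv.mpr ⟨fun x => (hd x).differentiableAt, ?_⟩, fun x => ?_, ?_⟩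
  · rw [hderiv]
    fun_prop
  · have hcube : ∀ t, HasDerivAt (fun t => |-sin t| ^ 2 * -sin t) (-3 * (cos t - cos t ^ 3)) t := by
      intro t
      have h := ((hasDerivAt_sin t).pow 3).neg
      refine (h.congr_deriv ?_).congr_of_eventuallyEq (Eventually.of_forall fun y => ?_)
      · have := sin_sq t
        norm_num
        rw [this]
        ring
      · simp only [sq_abs, Pi.neg_apply, Pi.pow_apply]
        ring
    have hvanish : ∀ t, sin t = 0 → -3 * (cos t - cos t ^ 3) = 0 := fun t ht => by
      have := cos_sq' t
      rw [ht] at this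
      linear_combination 3 * cos t * this
    rw [hderiv, hu]
    exact hasDerivAt_comp_clamp (f := fun t => |-sin t| ^ 2 * -sin t)
      (f' := fun t => -3 * (cos t - cos t ^ 3)) hab hcube (hvanish a ha) (hvanish b hb) x
  · rw [hu]
    fun_prop

theorem ukm_le_one (k m : ℤ) (x : ℝ) : ukm k m x ≤ 1 := by
  unfold ukm
  split_ifs
  · exact le_rfl
  · norm_num
  · exact cos_le_one x

/-- **The counterexample to the strong comparison principle without the gradient
condition.** Each `u_{k,m}` (for `k ≤ m`) is C¹, and `x ↦ |u'|² u'` is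
differentiable with continuous derivative `-3(u - u³)`, i.e. `u_{k,m}` is a weak
solution of `|u'|² u'' + u - u³ = 0` on `ℝ`. Moreover `u_{0,0} ≥ u_{0,i}`,
`u_{0,0}(2π) = u_{0,i}(2π)` and yet `u_{0,0} ≢ u_{0,i}` for every `i ≥ 1`. -/
theorem counterexample_strong_comparison :
    (∀ k m : ℤ, k ≤ m →
      ContDiff ℝ 1 (ukm k m) ∧
      (∀ x : ℝ, HasDerivAt (fun y => |deriv (ukm k m) y| ^ 2 * deriv (ukm k m) y)
        (-3 * (ukm k m x - (ukm k m x) ^ 3)) x) ∧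
      Continuous (fun x => -3 * (ukm k m x - (ukm k m x) ^ 3))) ∧
    (∀ i : ℤ, 1 ≤ i →
      (∀ x : ℝ, ukm 0 i x ≤ ukm 0 0 x) ∧
      ukm 0 0 (2 * π) = ukm 0 i (2 * π) ∧
      ukm 0 0 ≠ ukm 0 i) := by
  refine ⟨fun k m hkm => ukm_weak_solution hkm, fun i hi => ?_⟩
  have hi' : (1 : ℝ) ≤ i := by exact_mod_cast hi
  have hpi := pi_pos
  have hlt : 4 * π ≤ (2 * (i : ℝ) + 2) * π := by
    gcongr
    linarith
  refine ⟨fun x => ?_, ?_, fun h => ?_⟩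
  · by_cases hx : 2 * π ≤ x
    · have h1 : ukm 0 0 x = 1 := by simp [ukm, hx]
      exact h1 ▸ ukm_le_one 0 i x
    · have hxi : ¬ (2 * (i : ℝ) + 2) * π ≤ x := by linarith
      simp [ukm, hx, hxi]
  · have h1 : ¬ (2 * (i : ℝ) + 2) * π ≤ 2 * π := by linarith
    have h2 : ¬ 2 * π ≤ π := by linarith
    simp only [ukm, h1, if_false]
    simp [h2]
  · have h3 := congrFun h (3 * π)
    have h1 : ¬ (2 * (i : ℝ) + 2) * π ≤ 3 * π := by linarith
    have h2 : ¬ 3 * π ≤ π := by linarith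
    have h4 : 2 * π ≤ 3 * π := by linarith
    have hc : cos (3 * π) = -1 := by
      rw [show 3 * π = π + 2 * π by ring, cos_add_two_pi, cos_pi]
    simp only [ukm, h1, if_false] at h3
    norm_num [h2, h4, hc] at h3
end
end

section
/- Let u be a weak solution of −|u′|^α u″ = f_{a,A}(u) on an interval I. Then for all x, y ∈ I one has the energy identity |u′(x)|^{2+α} − |u′(y)|^{2+α} = −(2+α) · ∫_{u(y)}^{u(x)} f_{a,A}(s) ds. -/
noncomputable section

open Real Filter Topology intervalIntegral

/-- The normalized nonlinearity `f_{a,A}`: `f/a` where `f > 0`, `f/A` where `f < 0`,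
and `0` where `f = 0`. -/
def faA (a A : ℝ) (f : ℝ → ℝ) (t : ℝ) : ℝ :=
  if 0 < f t then f t / a else if f t < 0 then f t / A else 0

/-- `u` is a weak solution of `-|u'|^α u'' = f_{a,A}(u)` on all of `ℝ`:
`u` is C¹ and `x ↦ |u'|^α u'` is differentiable with (continuous) derivative
`-(1+α)·f_{a,A}(u(x))`. -/
def IsWeakSolR (α a A : ℝ) (f : ℝ → ℝ) (u : ℝ → ℝ) : Prop :=
  Differentiable ℝ u ∧ Continuous (deriv u) ∧
  ∀ x : ℝ, HasDerivAt (fun y => |deriv u y| ^ α * deriv u y)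
    (-(1 + α) * faA a A f (u x)) x

theorem faA_eq_max_add_min (a A : ℝ) (f : ℝ → ℝ) (t : ℝ) :
    faA a A f t = max (f t) 0 / a + min (f t) 0 / A := by
  unfold faA
  split_ifs with h₁ h₂
  · simp [max_eq_left h₁.le, min_eq_right h₁.le]
  · simp [max_eq_right h₂.le, min_eq_left h₂.le]
  · simp [le_antisymm (not_lt.mp h₁) (not_lt.mp h₂)]

theorem continuous_faA (a A : ℝ) {f : ℝ → ℝ} (hf : Continuous f) :
    Continuous (faA a A f) := by
  rw [funext (faA_eq_max_add_min a A f)]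
  fun_prop

theorem abs_rpow_abs_mul_self {α : ℝ} (hα : -1 < α) (w : ℝ) :
    |(|w| ^ α * w)| = |w| ^ (1 + α) := by
  rcases eq_or_ne w 0 with rfl | hw
  · simp [Real.zero_rpow (by linarith : 1 + α ≠ 0)]
  · rw [abs_mul, abs_of_nonneg (by positivity), add_comm,
      Real.rpow_add_one (abs_ne_zero.mpr hw)]

/-- `|w| ^ (2 + α)` as a power of the flux `|w| ^ α * w`. -/
theorem abs_flux_rpow {α : ℝ} (hα : -1 < α) (w : ℝ) :
    |(|w| ^ α * w)| ^ ((2 + α) / (1 + α)) = |w| ^ (2 + α) := by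
  rw [abs_rpow_abs_mul_self hα, ← Real.rpow_mul (abs_nonneg w),
    mul_div_cancel₀ _ (by linarith : 1 + α ≠ 0)]

theorem abs_flux_rpow_sub_two_mul {α : ℝ} (hα : -1 < α) (w : ℝ) :
    |(|w| ^ α * w)| ^ ((2 + α) / (1 + α) - 2) * (|w| ^ α * w) = w := by
  rcases eq_or_ne w 0 with rfl | hw
  · simp
  · have h : (1 + α) * ((2 + α) / (1 + α) - 2) + α = 0 := by
      have : 1 + α ≠ 0 := by linarith
      field_simp
      ring
    rw [abs_rpow_abs_mul_self hα, ← Real.rpow_mul (abs_nonneg w), ← mul_assoc,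
      ← Real.rpow_add (abs_pos.mpr hw), h, Real.rpow_zero, one_mul]

/-- If the flux `|w| ^ α * w` is differentiable, then so is `|w| ^ (2 + α)`, even where `w`
vanishes. -/
theorem hasDerivWithinAt_abs_rpow_of_flux {α : ℝ} (hα : -1 < α) {w : ℝ → ℝ} {s : Set ℝ}
    {x g : ℝ} (h : HasDerivWithinAt (fun y => |w y| ^ α * w y) (-(1 + α) * g) s x) :
    HasDerivWithinAt (fun y => |w y| ^ (2 + α)) (-(2 + α) * (g * w x)) s x := by
  have hpos : 0 < 1 + α := by linarith
  have hp : 1 < (2 + α) / (1 + α) := by rw [one_lt_div hpos]; linarith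
  have key := (hasDerivAt_abs_rpow (|w x| ^ α * w x) hp).comp_hasDerivWithinAt x h
  simp only [Function.comp_def, abs_flux_rpow hα] at key
  refine key.congr_deriv ?_
  rw [mul_assoc ((2 + α) / (1 + α)), abs_flux_rpow_sub_two_mul hα]
  field_simp

/-- **The energy identity** for weak solutions of `-|u'|^α u'' = f_{a,A}(u)` on an
interval `I` (with C¹ derivative `u'` in the sense of `HasDerivWithinAt`):
`|u'(x)|^{2+α} - |u'(y)|^{2+α} = -(2+α) ∫_{u(y)}^{u(x)} f_{a,A}(s) ds`. -/
theorem energy_identity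
    (α a A : ℝ) (hα : -1 < α) (ha : 0 < a) (haA : a ≤ A)
    (f : ℝ → ℝ) (hf : ContDiff ℝ 1 f)
    (hfm1 : f (-1) = 0) (hf0 : f 0 = 0) (hf1 : f 1 = 0)
    (hfpos : ∀ t ∈ Set.Ioo (0:ℝ) 1, 0 < f t)
    (hfneg : ∀ t ∈ Set.Ioo (-1:ℝ) 0, f t < 0)
    (hfge : ∀ t : ℝ, t ≤ -1 → 0 ≤ f t)
    (hfle : ∀ t : ℝ, 1 ≤ t → f t ≤ 0)
    (I : Set ℝ) (hI : I.OrdConnected)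
    (u u' : ℝ → ℝ)
    (hu' : ∀ x ∈ I, HasDerivWithinAt u (u' x) I x)
    (hu'cont : ContinuousOn u' I)
    (hweak : ∀ x ∈ I, HasDerivWithinAt (fun y => |u' y| ^ α * u' y)
      (-(1 + α) * faA a A f (u x)) I x)
    (x y : ℝ) (hx : x ∈ I) (hy : y ∈ I) :
    |u' x| ^ (2 + α) - |u' y| ^ (2 + α) =
      -(2 + α) * ∫ s in (u y)..(u x), faA a A f s := by
  have hcont := continuous_faA a A hf.continuous
  have hderiv : ∀ z ∈ I, HasDerivWithinAt
      (fun z => |u' z| ^ (2 + α) + (2 + α) * ∫ s in (u y)..(u z), faA a A f s) 0 I z := by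
    intro z hz
    have hprimitive := (hcont.integral_hasStrictDerivAt (u y) (u z)).hasDerivAt.comp_hasDerivWithinAt
      z (hu' z hz)
    refine ((hasDerivWithinAt_abs_rpow_of_flux hα (hweak z hz)).add
      (hprimitive.const_mul (2 + α))).congr_deriv ?_
    ring
  have hconst := hI.convex.norm_image_sub_le_of_norm_hasDerivWithin_le (C := 0) hderiv
    (fun _ _ => by simp) hy hx
  rw [zero_mul, norm_le_zero_iff, integral_same] at hconst
  linarith
end
end

section
/- Let 0 < a < A, α > −1, and take f(t) = t − t³ (which satisfies f(±1) = f(0) = 0, f > 0 on (0,1) ∪ (−∞,−1), f < 0 on (−1,0) ∪ (1,∞)). Then there exists no bounded weak solution u : ℝ → ℝ of −|u′|^α u″ = f_{a,A}(u) on ℝ with lim_{x→+∞} u(x) = 1 and lim_{x→−∞} u(x) = −1. (This weak formulation encodes the one-dimensional Pucci equation |u′|^α M⁺_{a,A}(u″) + u − u³ = 0, where M⁺_{a,A}(t) = A·max(t,0) + a·min(t,0); so for a < A this equation admits no one-dimensional solution connecting −1 to 1.) -/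
noncomputable section

open Real Filter Topology intervalIntegral

theorem integral_faA_zero_one (a A : ℝ) :
    ∫ t in (0 : ℝ)..1, faA a A (fun t => t - t ^ 3) t = 1 / (4 * a) := by
  have h : ∫ t in (0 : ℝ)..1, faA a A (fun t => t - t ^ 3) t =
      ∫ t in (0 : ℝ)..1, (t - t ^ 3) / a := by
    refine integral_congr fun t ht => ?_
    rw [Set.uIcc_of_le zero_le_one] at ht
    have h0 : 0 ≤ t - t ^ 3 := by
      have : 0 ≤ t * (1 - t) * (1 + t) :=
        mul_nonneg (mul_nonneg ht.1 (by linarith [ht.2])) (by linarith [ht.1])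
      linarith [show t * (1 - t) * (1 + t) = t - t ^ 3 by ring]
    simp [faA_eq_max_add_min, max_eq_left h0, min_eq_right h0]
  rw [h, integral_div, integral_sub (by simp) (by simp), integral_id, integral_pow]
  ring

theorem integral_faA_zero_neg_one (a A : ℝ) :
    ∫ t in (0 : ℝ)..(-1), faA a A (fun t => t - t ^ 3) t = 1 / (4 * A) := by
  have h : ∫ t in (0 : ℝ)..(-1), faA a A (fun t => t - t ^ 3) t =
      ∫ t in (0 : ℝ)..(-1), (t - t ^ 3) / A := by
    refine integral_congr fun t ht => ?_
    rw [Set.uIcc_of_ge (by norm_num)] at ht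
    have h0 : t - t ^ 3 ≤ 0 := by
      have : 0 ≤ -t * (1 - t) * (1 + t) :=
        mul_nonneg (mul_nonneg (by linarith [ht.2]) (by linarith [ht.2])) (by linarith [ht.1])
      linarith [show -t * (1 - t) * (1 + t) = -(t - t ^ 3) by ring]
    simp [faA_eq_max_add_min, max_eq_right h0, min_eq_left h0]
  rw [h, integral_div, integral_sub (by simp) (by simp), integral_id, integral_pow]
  ring

theorem abs_rpow_mul_self_rpow_mul {α q : ℝ} (hα : -1 < α) (hq : q = (α + 2) / (α + 1)) (v : ℝ) :
    |(|v| ^ α * v)| ^ (q - 2) * (|v| ^ α * v) = v := by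
  rcases eq_or_ne v 0 with rfl | hv
  · simp
  have hv' : 0 < |v| := abs_pos.2 hv
  have hα' : α + 1 ≠ 0 := by linarith
  have h1 : |(|v| ^ α * v)| = |v| ^ (α + 1) := by
    rw [abs_mul, abs_of_pos (rpow_pos_of_pos hv' α), rpow_add_one hv'.ne']
  rw [h1, ← rpow_mul hv'.le, ← mul_assoc, ← rpow_add hv',
    show (α + 1) * (q - 2) + α = 0 by rw [hq]; field_simp; ring, rpow_zero, one_mul]

/-- The conserved energy of a weak solution. -/
theorem IsWeakSolR.exists_energy {α a A : ℝ} {f u : ℝ → ℝ} (hα : -1 < α) (hf : Continuous f)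
    (hu : IsWeakSolR α a A f u) :
    ∃ E : ℝ, ∀ x, |(|deriv u x| ^ α * deriv u x)| ^ ((α + 2) / (α + 1)) +
      (α + 2) * ∫ t in (0 : ℝ)..u x, faA a A f t = E := by
  obtain ⟨hd, -, hp⟩ := hu
  have hα' : 0 < α + 1 := by linarith
  have hq : 1 < (α + 2) / (α + 1) := by rw [lt_div_iff₀ hα']; linarith
  have key : ∀ x, HasDerivAt
      (fun x => |(|deriv u x| ^ α * deriv u x)| ^ ((α + 2) / (α + 1)) +
        (α + 2) * ∫ t in (0 : ℝ)..u x, faA a A f t) 0 x := by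
    intro x
    have hG : HasDerivAt (fun y => ∫ t in (0 : ℝ)..y, faA a A f t) (faA a A f (u x)) (u x) :=
      (continuous_faA a A hf).integral_hasStrictDerivAt 0 (u x) |>.hasDerivAt
    have h1 := (hasDerivAt_abs_rpow (|deriv u x| ^ α * deriv u x) hq).comp x (hp x)
    have h2 := (hG.comp x (hd x).hasDerivAt).const_mul (α + 2)
    refine (h1.add h2).congr_deriv ?_
    rw [mul_assoc ((α + 2) / (α + 1)), abs_rpow_mul_self_rpow_mul hα rfl]
    field_simp
    ring
  exact ⟨_, fun x => is_const_of_deriv_eq_zero (fun x => (key x).differentiableAt)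
    (fun x => (key x).deriv) x 0⟩

/-- If `u` converges along unit steps, its derivative tends to zero along suitable points. -/
theorem exists_tendsto_deriv_zero {u : ℝ → ℝ} {l : Filter ℝ} {L : ℝ} (hd : Differentiable ℝ u)
    (hu : Tendsto u l (𝓝 L)) (hu' : Tendsto (fun x => u (x + 1)) l (𝓝 L)) :
    ∃ ξ : ℝ → ℝ, (∀ x, x ≤ ξ x ∧ ξ x ≤ x + 1) ∧ Tendsto (fun x => deriv u (ξ x)) l (𝓝 0) := by
  have h : ∀ x : ℝ, ∃ c ∈ Set.Ioo x (x + 1), deriv u c = (u (x + 1) - u x) / (x + 1 - x) :=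
    fun x => exists_deriv_eq_slope u (by linarith) hd.continuous.continuousOn hd.differentiableOn
  choose ξ hξ hξ' using h
  refine ⟨ξ, fun x => ⟨(hξ x).1.le, (hξ x).2.le⟩, ?_⟩
  simpa [hξ'] using hu'.sub hu

theorem energy_eq_of_tendsto {α L E : ℝ} {u g : ℝ → ℝ} {l m : Filter ℝ} [NeBot l] (hα : -1 < α)
    (hg : Continuous g) (hu : Tendsto u m (𝓝 L)) {ξ : ℝ → ℝ} (hξ : Tendsto ξ l m)
    (hξ' : Tendsto (fun x => deriv u (ξ x)) l (𝓝 0))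
    (hE : ∀ x, |(|deriv u x| ^ α * deriv u x)| ^ ((α + 2) / (α + 1)) +
      (α + 2) * ∫ t in (0 : ℝ)..u x, g t = E) :
    (α + 2) * ∫ t in (0 : ℝ)..L, g t = E := by
  have hα' : 0 < α + 1 := by linarith
  have hkin : ∀ v : ℝ, |(|v| ^ α * v)| ^ ((α + 2) / (α + 1)) = |v| ^ (α + 2) := by
    intro v
    have h1 : |(|v| ^ α * v)| = |v| ^ (α + 1) := by
      rw [abs_mul, abs_of_nonneg (rpow_nonneg (abs_nonneg v) α),
        rpow_add_one' (abs_nonneg v) hα'.ne']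
    rw [h1, ← rpow_mul (abs_nonneg v), mul_div_cancel₀ _ hα'.ne']
  have hG : Continuous fun y => ∫ t in (0 : ℝ)..y, g t :=
    continuous_primitive (fun a b => hg.intervalIntegrable a b) 0
  have h1 : Tendsto (fun x => |deriv u (ξ x)| ^ (α + 2)) l (𝓝 0) := by
    have := hξ'.abs.rpow_const (p := α + 2) (Or.inr (by linarith))
    rwa [abs_zero, zero_rpow (by linarith)] at this
  have h2 := h1.add (((hG.tendsto L).comp (hu.comp hξ)).const_mul (α + 2))
  rw [zero_add] at h2
  refine tendsto_nhds_unique h2 (tendsto_const_nhds.congr fun x => ?_)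
  rw [← hE (ξ x), hkin]
  rfl

/-- **Nonexistence of one-dimensional heteroclinic solutions for Pucci operators**
(Section 1 and Section 5). For `0 < a < A`, `α > -1` and `f(t) = t - t³`, there is
no bounded weak solution of `-|u'|^α u'' = f_{a,A}(u)` on `ℝ` connecting `-1` to
`1`; equivalently, the equation `|u'|^α M⁺_{a,A}(u'') + u - u³ = 0` has no
one-dimensional solution with limits `±1` at `±∞`. -/
theorem no_heteroclinic_for_pucci
    (α a A : ℝ) (hα : -1 < α) (ha : 0 < a) (haA : a < A) :
    ¬ ∃ u : ℝ → ℝ,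
        IsWeakSolR α a A (fun t => t - t ^ 3) u ∧
        (∃ K : ℝ, ∀ x, |u x| ≤ K) ∧
        Tendsto u atTop (𝓝 1) ∧ Tendsto u atBot (𝓝 (-1)) := by
  rintro ⟨u, hu, -, htop, hbot⟩
  have hf : Continuous fun t : ℝ => t - t ^ 3 := by fun_prop
  have hg := continuous_faA a A hf
  obtain ⟨E, hE⟩ := hu.exists_energy hα hf
  obtain ⟨ξ, hξ, hξ'⟩ := exists_tendsto_deriv_zero hu.1 htop
    (htop.comp (tendsto_atTop_add_const_right _ 1 tendsto_id))
  obtain ⟨η, hη, hη'⟩ := exists_tendsto_deriv_zero hu.1 hbot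
    (hbot.comp (tendsto_atBot_add_const_right _ 1 tendsto_id))
  have h1 := energy_eq_of_tendsto hα hg htop
    (tendsto_atTop_mono (fun x => (hξ x).1) tendsto_id) hξ' hE
  have h2 := energy_eq_of_tendsto hα hg hbot
    (tendsto_atBot_mono (fun x => (hη x).2) (tendsto_atBot_add_const_right _ 1 tendsto_id)) hη' hE
  rw [← h2, integral_faA_zero_one, integral_faA_zero_neg_one] at h1
  have h3 := mul_left_cancel₀ (by linarith : α + 2 ≠ 0) h1
  have hA : 0 < A := ha.trans haA
  rw [div_eq_div_iff (by positivity) (by positivity)] at h3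
  linarith
end
end

section
/- Assume in addition that f is bounded and Lipschitz continuous on ℝ. Then for every α > −1 and every δ ∈ ℝ there exists a weak solution u : ℝ → ℝ of −|u′|^α u″ = f_{a,A}(u) on ℝ with u(0) = 0 and u′(0) = δ. If moreover −1 < α ≤ 0, this solution is unique: any two weak solutions on ℝ with the same initial data u(0) = 0, u′(0) = δ coincide. -/
noncomputable section

open Real Filter Topology intervalIntegral

/-- If every increment of a sequence is `ε h`-close to `h • c`, then the increment over
`j - k` steps is `ε (j - k) h`-close to `((j - k) h) • c`. -/
theorem norm_sub_sub_smul_le_of_forall_succ {E : Type*} [NormedAddCommGroup E] [NormedSpace ℝ E]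
    {z : ℕ → E} {c : E} {h ε : ℝ} {k j : ℕ} (hkj : k ≤ j)
    (hz : ∀ i, k ≤ i → i < j → ‖z (i + 1) - z i - h • c‖ ≤ ε * h) :
    ‖z j - z k - (((j : ℝ) - k) * h) • c‖ ≤ ε * (((j : ℝ) - k) * h) := by
  induction j, hkj using Nat.le_induction with
  | base => simp
  | succ j hkj ih =>
    have h1 := ih fun i hi hij => hz i hi (hij.trans j.lt_succ_self)
    have h2 := hz j hkj j.lt_succ_self
    have h3 : z (j + 1) - z k - ((((j + 1 : ℕ) : ℝ) - k) * h) • c =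
        (z j - z k - (((j : ℝ) - k) * h) • c) + (z (j + 1) - z j - h • c) := by
      push_cast
      module
    rw [h3]
    calc _ ≤ _ := norm_add_le _ _
      _ ≤ ε * (((j : ℝ) - k) * h) + ε * h := add_le_add h1 h2
      _ = _ := by push_cast; ring

/-- The explicit Euler scheme with step `h` for `y' = F y`. -/
def eulerIter {E : Type*} [AddCommGroup E] [Module ℝ E] (F : E → E) (y₀ : E) (h : ℝ) (k : ℕ) : E :=
  (fun y => y + h • F y)^[k] y₀

section Euler

variable {E : Type*} [NormedAddCommGroup E] [NormedSpace ℝ E] {F : E → E} {y₀ : E}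

theorem eulerIter_succ_sub (F : E → E) (y₀ : E) (h : ℝ) (k : ℕ) :
    eulerIter F y₀ h (k + 1) - eulerIter F y₀ h k = h • F (eulerIter F y₀ h k) := by
  simp only [eulerIter, Function.iterate_succ_apply', add_sub_cancel_left]

/-- As long as the Euler iterates stay in a set where `F` is bounded by `M`, they are
Lipschitz in the time variable. -/
theorem norm_eulerIter_sub_le {M h : ℝ} (hh : 0 < h) {k j : ℕ} (hkj : k ≤ j)
    (hM : ∀ i < j, ‖F (eulerIter F y₀ h i)‖ ≤ M) :
    ‖eulerIter F y₀ h j - eulerIter F y₀ h k‖ ≤ M * (((j : ℝ) - k) * h) := by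
  have := norm_sub_sub_smul_le_of_forall_succ (z := eulerIter F y₀ h) (c := 0) (h := h) (ε := M)
    hkj fun i _ hij => by
      rw [eulerIter_succ_sub, smul_zero, sub_zero, norm_smul, Real.norm_of_nonneg hh.le, mul_comm]
      exact mul_le_mul_of_nonneg_right (hM i hij) hh.le
  simpa using this

/-- Uniform first-order consistency of the Euler iterates staying in a compact ball. -/
theorem exists_forall_norm_eulerIter_sub_sub_le [ProperSpace E] (hF : Continuous F) {T R : ℝ}
    (hR : ∀ h : ℝ, 0 < h → ∀ k : ℕ, k * h ≤ T → ‖eulerIter F y₀ h k‖ ≤ R) {ε : ℝ} (hε : 0 < ε) :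
    ∃ η > 0, ∀ h : ℝ, 0 < h → ∀ k m j : ℕ, k ≤ m → m ≤ j → j * h ≤ T → ((j : ℝ) - k) * h ≤ η →
      ‖eulerIter F y₀ h j - eulerIter F y₀ h k
        - (((j : ℝ) - k) * h) • F (eulerIter F y₀ h m)‖ ≤ ε * (((j : ℝ) - k) * h) := by
  have hK : IsCompact (Metric.closedBall (0 : E) R) := isCompact_closedBall _ _
  obtain ⟨M', hM'⟩ := hK.exists_bound_of_continuousOn hF.continuousOn
  set M := max M' 1
  have hMpos : 0 < M := lt_max_of_lt_right one_pos
  obtain ⟨δ, hδ, hunif⟩ := Metric.uniformContinuousOn_iff_le.1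
    (hK.uniformContinuousOn_of_continuous hF.continuousOn) ε hε
  refine ⟨δ / M, by positivity, fun h hh k m j hkm hmj hjT hη => ?_⟩
  have hle : ∀ {i : ℕ}, i ≤ j → eulerIter F y₀ h i ∈ Metric.closedBall (0 : E) R := fun hi =>
    mem_closedBall_zero_iff.2 <| hR h hh _ <|
      (mul_le_mul_of_nonneg_right (Nat.cast_le.2 hi) hh.le).trans hjT
  have hclose : ∀ p q : ℕ, k ≤ p → p ≤ q → q ≤ j →
      dist (eulerIter F y₀ h q) (eulerIter F y₀ h p) ≤ δ := fun p q hkp hpq hqj => by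
    rw [dist_eq_norm]
    refine (norm_eulerIter_sub_le (M := M) hh hpq fun i hi =>
      (hM' _ (hle (hi.le.trans hqj))).trans (le_max_left _ _)).trans ?_
    have h1 : ((q : ℝ) - p) * h ≤ ((j : ℝ) - k) * h := by
      have : (q : ℝ) ≤ j := by exact_mod_cast hqj
      have : (k : ℝ) ≤ p := by exact_mod_cast hkp
      gcongr
    calc M * (((q : ℝ) - p) * h) ≤ M * (δ / M) := by gcongr; exact h1.trans hη
      _ = δ := by field_simp
  refine norm_sub_sub_smul_le_of_forall_succ (hkm.trans hmj) fun i hki hij => ?_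
  rw [eulerIter_succ_sub, ← smul_sub, norm_smul, Real.norm_of_nonneg hh.le, mul_comm]
  refine mul_le_mul_of_nonneg_right ?_ hh.le
  rw [← dist_eq_norm]
  refine hunif _ (hle hij.le) _ (hle hmj) ?_
  rcases le_total i m with him | him
  · rw [dist_comm]; exact hclose i m hki him hmj
  · exact hclose m i hkm him hij.le

/-- **Peano existence theorem**, global forward version: if the Euler iterates of a continuous
vector field stay bounded on bounded time intervals, then `y' = F y` has a solution
on `[0, ∞)`. -/
theorem exists_hasDerivWithinAt_of_eulerIter_bounded [ProperSpace E] (hF : Continuous F)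
    (hb : ∀ T : ℝ, ∃ R : ℝ, ∀ h : ℝ, 0 < h → ∀ k : ℕ, k * h ≤ T → ‖eulerIter F y₀ h k‖ ≤ R) :
    ∃ Y : ℝ → E, Y 0 = y₀ ∧ ∀ t, 0 ≤ t → HasDerivWithinAt Y (F (Y t)) (Set.Ici 0) t := by
  let h : ℕ → ℝ := fun n => 1 / ((n : ℝ) + 1)
  have hh : ∀ n, 0 < h n := fun n => Nat.one_div_pos_of_nat
  let κ : ℝ → ℕ → ℕ := fun t n => ⌊t / h n⌋₊
  have hκle : ∀ t, 0 ≤ t → ∀ n, κ t n * h n ≤ t := fun t ht n => by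
    have := Nat.floor_le (div_nonneg ht (hh n).le)
    exact (le_div_iff₀ (hh n)).1 this
  have hκlim : ∀ t, 0 ≤ t → Tendsto (fun n => κ t n * h n) (hyperfilter ℕ) (𝓝 t) := by
    intro t ht
    have h0 : Tendsto h atTop (𝓝 0) := tendsto_one_div_add_atTop_nhds_zero_nat
    have h1 : Tendsto (fun n => t - h n) atTop (𝓝 t) := by simpa using h0.const_sub t
    refine (tendsto_of_tendsto_of_tendsto_of_le_of_le h1 tendsto_const_nhds (fun n => ?_)
      (hκle t ht)).mono_left Nat.hyperfilter_le_atTop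
    have := (div_lt_iff₀ (hh n)).1 (Nat.lt_floor_add_one (t / h n))
    change t - h n ≤ (⌊t / h n⌋₊ : ℝ) * h n
    linarith
  have hex : ∀ t, ∃ y, 0 ≤ t →
      Tendsto (fun n => eulerIter F y₀ (h n) (κ t n)) (hyperfilter ℕ) (𝓝 y) := by
    intro t
    by_cases ht : 0 ≤ t
    · obtain ⟨R, hR⟩ := hb t
      obtain ⟨y, -, hy⟩ := (isCompact_closedBall (0 : E) R).ultrafilter_le_nhds'
        ((hyperfilter ℕ).map fun n => eulerIter F y₀ (h n) (κ t n))
        (Filter.mem_map.2 <| Filter.univ_mem' fun n =>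
          mem_closedBall_zero_iff.2 (hR _ (hh n) _ (hκle t ht n)))
      exact ⟨y, fun _ => hy⟩
    · exact ⟨0, fun h => absurd h ht⟩
  choose Y hY using hex
  refine ⟨Y, ?_, fun t₀ ht₀ => ?_⟩
  · refine tendsto_nhds_unique (hY 0 le_rfl) ?_
    simp [κ, eulerIter]
  have key : ∀ ε > 0, ∃ η > 0, ∀ s m t, 0 ≤ s → s ≤ m → m ≤ t → t ≤ t₀ + 1 → t - s < η →
      ‖Y t - Y s - (t - s) • F (Y m)‖ ≤ ε * (t - s) := by
    intro ε hε
    obtain ⟨R, hR⟩ := hb (t₀ + 1)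
    obtain ⟨η, hη, H⟩ := exists_forall_norm_eulerIter_sub_sub_le hF hR hε
    refine ⟨η, hη, fun s m t hs hsm hmt htT hts => ?_⟩
    have hm := hs.trans hsm
    have ht := hm.trans hmt
    have hlim : Tendsto (fun n => ((κ t n : ℝ) - κ s n) * h n) (hyperfilter ℕ) (𝓝 (t - s)) := by
      simpa only [sub_mul] using (hκlim t ht).sub (hκlim s hs)
    refine le_of_tendsto_of_tendsto
      (((hY t ht).sub (hY s hs)).sub (hlim.smul ((hF.tendsto _).comp (hY m hm)))).norm
      (hlim.const_mul ε) ?_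
    filter_upwards [hlim.eventually (gt_mem_nhds hts)] with n hn
    have hmono : ∀ {p q : ℝ}, p ≤ q → κ p n ≤ κ q n := fun hpq =>
      Nat.floor_mono (div_le_div_of_nonneg_right hpq (hh n).le)
    exact H _ (hh n) _ _ _ (hmono hsm) (hmono hmt) ((hκle t ht n).trans htT) hn.le
  rw [hasDerivWithinAt_iff_isLittleO, Asymptotics.isLittleO_iff]
  intro ε hε
  obtain ⟨η, hη, H⟩ := key ε hε
  have hnear : ∀ᶠ t in 𝓝[Set.Ici 0] t₀, |t - t₀| < min η 1 :=
    (mem_nhdsWithin_of_mem_nhds (Metric.ball_mem_nhds t₀ (lt_min hη one_pos)))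
  filter_upwards [hnear, self_mem_nhdsWithin] with t ht ht0
  have h1 := abs_lt.1 (ht.trans_le (min_le_left _ _))
  have h2 := abs_lt.1 (ht.trans_le (min_le_right _ _))
  rcases le_total t₀ t with h | h
  · rw [Real.norm_of_nonneg (sub_nonneg.2 h)]
    exact H t₀ t₀ t ht₀ le_rfl h (by linarith) (by linarith)
  · have := H t t₀ t₀ ht0 h le_rfl (by linarith) (by linarith)
    rw [Real.norm_of_nonpos (sub_nonpos.2 h), neg_sub]
    convert this using 1
    rw [← norm_neg]
    congr 1
    module

end Euler

/-- Solutions on `ℝ` of an autonomous equation with locally Lipschitz right-hand side are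
determined by their value at one point. -/
theorem eq_of_hasDerivAt_of_locallyLipschitz {E : Type*} [NormedAddCommGroup E] [NormedSpace ℝ E]
    {F : E → E} (hF : LocallyLipschitz F) {y z : ℝ → E} (hy : ∀ t, HasDerivAt y (F (y t)) t)
    (hz : ∀ t, HasDerivAt z (F (z t)) t) {t₀ : ℝ} (h₀ : y t₀ = z t₀) : y = z := by
  ext t
  set r := |t - t₀| + 1
  have hyc : Continuous y := continuous_iff_continuousAt.2 fun t => (hy t).continuousAt
  have hzc : Continuous z := continuous_iff_continuousAt.2 fun t => (hz t).continuousAt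
  have hI : IsCompact (Set.Icc (t₀ - r) (t₀ + r)) := isCompact_Icc
  obtain ⟨K, hK⟩ := hF.locallyLipschitzOn.exists_lipschitzOnWith_of_compact
    ((hI.image hyc).union (hI.image hzc))
  have hr : 0 < r := by positivity
  have ht := abs_le.1 (lt_add_one |t - t₀|).le
  refine ODE_solution_unique_of_mem_Icc (v := fun _ => F) (s := fun _ => _)
    (fun _ _ => hK) ⟨sub_lt_self t₀ hr, lt_add_of_pos_right t₀ hr⟩ hyc.continuousOn
    (fun t _ => hy t) (fun t ht => ?_) hzc.continuousOn (fun t _ => hz t) (fun t ht => ?_) h₀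
    ⟨by linarith, by linarith⟩
  · exact Or.inl (Set.mem_image_of_mem _ (Set.Ioo_subset_Icc_self ht))
  · exact Or.inr (Set.mem_image_of_mem _ (Set.Ioo_subset_Icc_self ht))

/-- Gluing a function on `[0, ∞)` with the reflection of another one. -/
theorem hasDerivAt_ite_neg {y₁ y₂ d₁ d₂ : ℝ → ℝ}
    (h₁ : ∀ t, 0 ≤ t → HasDerivWithinAt y₁ (d₁ t) (Set.Ici 0) t)
    (h₂ : ∀ t, 0 ≤ t → HasDerivWithinAt y₂ (d₂ t) (Set.Ici 0) t)
    (hy : y₁ 0 = y₂ 0) (hd : d₁ 0 = -d₂ 0) (x : ℝ) :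
    HasDerivAt (fun x => if 0 ≤ x then y₁ x else y₂ (-x))
      (if 0 ≤ x then d₁ x else -d₂ (-x)) x := by
  have hIci : HasDerivWithinAt (fun x => if 0 ≤ x then y₁ x else y₂ (-x))
      (if 0 ≤ x then d₁ x else -d₂ (-x)) (Set.Ici 0) x := by
    by_cases hx : 0 ≤ x
    · rw [if_pos hx]
      exact (h₁ x hx).congr (fun t ht => if_pos ht) (if_pos hx)
    · exact HasFDerivWithinAt.of_notMem_closure (by simpa using hx)
  have hIic : HasDerivWithinAt (fun x => if 0 ≤ x then y₁ x else y₂ (-x))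
      (if 0 ≤ x then d₁ x else -d₂ (-x)) (Set.Iic 0) x := by
    have hf : ∀ t ≤ 0, (if 0 ≤ t then y₁ t else y₂ (-t)) = y₂ (-t) := fun t ht => by
      split_ifs with h
      · rw [le_antisymm ht h, neg_zero, hy]
      · rfl
    have hd' : ∀ t ≤ 0, (if 0 ≤ t then d₁ t else -d₂ (-t)) = -d₂ (-t) := fun t ht => by
      split_ifs with h
      · rw [le_antisymm ht h, neg_zero, hd]
      · rfl
    by_cases hx : x ≤ 0
    · rw [hd' x hx]
      refine HasDerivWithinAt.congr (f := fun t => y₂ (-t)) ?_ hf (hf x hx)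
      have := (h₂ (-x) (neg_nonneg.2 hx)).scomp x (hasDerivAt_neg x).hasDerivWithinAt
        (s := Set.Iic 0) (fun t ht => Set.mem_Ici.2 (neg_nonneg.2 ht))
      simpa [Function.comp_def] using this
    · exact HasFDerivWithinAt.of_notMem_closure (by simpa using hx)
  simpa [Set.Ici_union_Iic] using hIci.union hIic

section PlanarSystem

variable {ψ g : ℝ → ℝ}

/-- Global forward solvability of `u' = ψ(w)`, `w' = g(u)` with `g` bounded. -/
theorem exists_forward_solution_planar (hψ : Continuous ψ) (hg : Continuous g) {B : ℝ}
    (hB : ∀ t, |g t| ≤ B) (w₀ : ℝ) :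
    ∃ u w : ℝ → ℝ, u 0 = 0 ∧ w 0 = w₀ ∧ ∀ t, 0 ≤ t →
      HasDerivWithinAt u (ψ (w t)) (Set.Ici 0) t ∧ HasDerivWithinAt w (g (u t)) (Set.Ici 0) t := by
  let F : ℝ × ℝ → ℝ × ℝ := fun y => (ψ y.2, g y.1)
  have hF : Continuous F := by fun_prop
  have hB0 : 0 ≤ B := (abs_nonneg _).trans (hB 0)
  obtain ⟨Y, hY0, hY⟩ := exists_hasDerivWithinAt_of_eulerIter_bounded (y₀ := (0, w₀)) hF <| by
    intro T
    obtain ⟨M, hM⟩ := (isCompact_closedBall (0 : ℝ) (|w₀| + B * T)).exists_bound_of_continuousOn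
      hψ.continuousOn
    have key : ∀ h : ℝ, 0 < h → ∀ k : ℕ, k * h ≤ T →
        |(eulerIter F (0, w₀) h k).1| ≤ M * (k * h) ∧
        |(eulerIter F (0, w₀) h k).2| ≤ |w₀| + B * (k * h) := by
      intro h hh k
      induction k with
      | zero => simp [eulerIter]
      | succ k ih =>
        intro hk
        push_cast at hk
        obtain ⟨h1, h2⟩ := ih (by linarith)
        rw [eq_add_of_sub_eq (eulerIter_succ_sub F (0, w₀) h k)]
        simp only [F, Prod.fst_add, Prod.snd_add, Prod.smul_fst, Prod.smul_snd, smul_eq_mul]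
        have hψk : |ψ (eulerIter F (0, w₀) h k).2| ≤ M := hM _ <| by
          rw [mem_closedBall_zero_iff]
          refine h2.trans ?_
          gcongr
          linarith
        constructor
        · refine (abs_add_le _ _).trans ?_
          rw [abs_mul, abs_of_pos hh]
          have := mul_le_mul_of_nonneg_left hψk hh.le
          push_cast
          linarith
        · refine (abs_add_le _ _).trans ?_
          rw [abs_mul, abs_of_pos hh]
          have := mul_le_mul_of_nonneg_left (hB (eulerIter F (0, w₀) h k).1) hh.le
          push_cast
          linarith
    refine ⟨max (|M| * T) (|w₀| + B * T), fun h hh k hk => ?_⟩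
    obtain ⟨h1, h2⟩ := key h hh k hk
    refine max_le_max (h1.trans ?_) (h2.trans ?_)
    · exact mul_le_mul (le_abs_self M) hk (by positivity) (abs_nonneg _)
    · gcongr
  refine ⟨fun t => (Y t).1, fun t => (Y t).2, by simp [hY0], by simp [hY0], fun t ht => ⟨?_, ?_⟩⟩
  · exact (ContinuousLinearMap.fst ℝ ℝ ℝ).hasFDerivAt.comp_hasDerivWithinAt t (hY t ht)
  · exact (ContinuousLinearMap.snd ℝ ℝ ℝ).hasFDerivAt.comp_hasDerivWithinAt t (hY t ht)

/-- Global solvability of `u' = ψ(w)`, `w' = g(u)` with `g` bounded and `ψ` odd. -/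
theorem exists_solution_planar (hψ : Continuous ψ) (hodd : ∀ s, ψ (-s) = -ψ s) (hg : Continuous g)
    {B : ℝ} (hB : ∀ t, |g t| ≤ B) (w₀ : ℝ) :
    ∃ u w : ℝ → ℝ, u 0 = 0 ∧ w 0 = w₀ ∧ ∀ t,
      HasDerivAt u (ψ (w t)) t ∧ HasDerivAt w (g (u t)) t := by
  obtain ⟨u₁, w₁, hu₁, hw₁, h₁⟩ := exists_forward_solution_planar hψ hg hB w₀
  obtain ⟨u₂, w₂, hu₂, hw₂, h₂⟩ := exists_forward_solution_planar hψ hg hB (-w₀)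
  refine ⟨fun x => if 0 ≤ x then u₁ x else u₂ (-x), fun x => if 0 ≤ x then w₁ x else -w₂ (-x),
    by simpa using hu₁, by simpa using hw₁, fun t => ⟨?_, ?_⟩⟩
  · convert hasDerivAt_ite_neg (fun t ht => (h₁ t ht).1) (fun t ht => (h₂ t ht).1)
      (by rw [hu₁, hu₂]) (by rw [hw₁, hw₂, hodd, neg_neg]) t using 1
    beta_reduce
    split_ifs
    · rfl
    · exact hodd _
  · convert hasDerivAt_ite_neg (fun t ht => (h₁ t ht).2)
      (y₂ := fun t => -w₂ t) (fun t ht => (h₂ t ht).2.neg)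
      (by simp [hw₁, hw₂]) (by rw [hu₁, hu₂, neg_neg]) t using 1
    beta_reduce
    split_ifs
    · rfl
    · rw [neg_neg]

end PlanarSystem

/-- The odd extension of `s ↦ s ^ p` from `[0, ∞)` to `ℝ`. -/
def oddRpow (p s : ℝ) : ℝ := max s 0 ^ p - max (-s) 0 ^ p

theorem oddRpow_neg (p s : ℝ) : oddRpow p (-s) = -oddRpow p s := by
  simp [oddRpow]

theorem oddRpow_of_nonneg {p s : ℝ} (hp : p ≠ 0) (hs : 0 ≤ s) : oddRpow p s = s ^ p := by
  simp [oddRpow, hs, Real.zero_rpow hp]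

theorem continuous_oddRpow {p : ℝ} (hp : 0 ≤ p) : Continuous (oddRpow p) := by
  unfold oddRpow
  exact ((continuous_id.max continuous_const).rpow_const fun _ => Or.inr hp).sub
    ((continuous_neg.max continuous_const).rpow_const fun _ => Or.inr hp)

theorem locallyLipschitz_oddRpow {p : ℝ} (hp : 1 ≤ p) : LocallyLipschitz (oddRpow p) := by
  have hrpow : LocallyLipschitz fun s : ℝ => s ^ p :=
    (Real.contDiff_rpow_const_of_le (n := 1) (by simpa using hp)).locallyLipschitz
  exact (hrpow.comp (LocallyLipschitz.id.max_const 0)).sub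
    (hrpow.comp (LipschitzWith.id.neg.locallyLipschitz.max_const 0))

section PowerInverse

variable {α : ℝ}

/-- `w ↦ oddRpow (1 + α)⁻¹ w` is a right inverse of `s ↦ |s|^α s`. -/
theorem abs_rpow_mul_oddRpow (hα : -1 < α) (w : ℝ) :
    |oddRpow (1 + α)⁻¹ w| ^ α * oddRpow (1 + α)⁻¹ w = w := by
  have hα' : 0 < 1 + α := by linarith
  wlog hw : 0 ≤ w generalizing w
  · have := this (-w) (by linarith)
    rw [oddRpow_neg, abs_neg] at this
    linarith
  rw [oddRpow_of_nonneg (inv_ne_zero hα'.ne') hw, abs_of_nonneg (Real.rpow_nonneg hw _)]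
  rcases hw.eq_or_lt with rfl | hw
  · simp [Real.zero_rpow (inv_ne_zero hα'.ne')]
  · rw [← Real.rpow_mul hw.le, ← Real.rpow_add hw]
    rw [show (1 + α)⁻¹ * α + (1 + α)⁻¹ = 1 by field_simp; ring, Real.rpow_one]

/-- `w ↦ oddRpow (1 + α)⁻¹ w` is a left inverse of `s ↦ |s|^α s`. -/
theorem oddRpow_abs_rpow_mul (hα : -1 < α) (s : ℝ) :
    oddRpow (1 + α)⁻¹ (|s| ^ α * s) = s := by
  have hα' : 0 < 1 + α := by linarith
  wlog hs : 0 ≤ s generalizing s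
  · have := this (-s) (by linarith)
    rw [abs_neg, mul_neg, oddRpow_neg] at this
    linarith
  rw [oddRpow_of_nonneg (inv_ne_zero hα'.ne') (by positivity), abs_of_nonneg hs]
  rcases hs.eq_or_lt with rfl | hs
  · simp [Real.zero_rpow (inv_ne_zero hα'.ne')]
  · rw [← Real.rpow_add_one hs.ne', ← Real.rpow_mul hs.le, add_comm α 1,
      mul_inv_cancel₀ hα'.ne', Real.rpow_one]

end PowerInverse

theorem faA_eq (a A : ℝ) (f : ℝ → ℝ) :
    faA a A f = fun t => max (f t) 0 * a⁻¹ - max (-f t) 0 * A⁻¹ := by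
  ext t
  unfold faA
  rcases lt_trichotomy (f t) 0 with h | h | h
  · simp [h.not_gt, h, h.le, div_eq_mul_inv]
  · simp [h]
  · simp [h, h.le, div_eq_mul_inv]

theorem abs_faA_le {a A : ℝ} (ha : 0 < a) (haA : a ≤ A) {f : ℝ → ℝ} {K : ℝ}
    (hK : ∀ t, |f t| ≤ K) (t : ℝ) : |faA a A f t| ≤ K / a := by
  have hA : 0 < A := ha.trans_le haA
  have hK0 : 0 ≤ K := (abs_nonneg _).trans (hK t)
  unfold faA
  split_ifs
  · rw [abs_div, abs_of_pos ha]
    exact div_le_div_of_nonneg_right (hK t) ha.le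
  · rw [abs_div, abs_of_pos hA]
    exact div_le_div₀ hK0 (hK t) ha haA
  · simpa using div_nonneg hK0 ha.le

theorem locallyLipschitz_faA (a A : ℝ) {f : ℝ → ℝ} (hf : LocallyLipschitz f) :
    LocallyLipschitz (faA a A f) := by
  have hmul : ∀ c : ℝ, LocallyLipschitz fun x : ℝ => x * c := fun c =>
    (contDiff_id.mul contDiff_const : ContDiff ℝ 1 fun x : ℝ => x * c).locallyLipschitz
  rw [faA_eq]
  exact ((hmul a⁻¹).comp (hf.max_const 0)).sub
    ((hmul A⁻¹).comp ((LipschitzWith.id.neg.locallyLipschitz.comp hf).max_const 0))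

/-- Solutions of the first-order system `u' = ψ(w)`, `w' = -(1+α) f_{a,A}(u)`, where `ψ` inverts
`s ↦ |s|^α s`, are weak solutions. -/
theorem isWeakSolR_of_system {α a A : ℝ} {f u w : ℝ → ℝ} (hα : -1 < α)
    (hu : ∀ t, HasDerivAt u (oddRpow (1 + α)⁻¹ (w t)) t)
    (hw : ∀ t, HasDerivAt w (-(1 + α) * faA a A f (u t)) t) : IsWeakSolR α a A f u := by
  have hderiv : deriv u = fun t => oddRpow (1 + α)⁻¹ (w t) := funext fun t => (hu t).deriv
  have hwc : Continuous w := continuous_iff_continuousAt.2 fun t => (hw t).continuousAt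
  refine ⟨fun t => (hu t).differentiableAt, ?_, fun x => ?_⟩
  · rw [hderiv]
    exact (continuous_oddRpow (inv_nonneg.2 (by linarith))).comp hwc
  · simpa only [hderiv, abs_rpow_mul_oddRpow hα] using hw x

/-- A weak solution together with `|u'|^α u'` solves the first-order system. -/
theorem IsWeakSolR.hasDerivAt_system {α a A : ℝ} {f u : ℝ → ℝ} (hα : -1 < α)
    (h : IsWeakSolR α a A f u) (t : ℝ) :
    HasDerivAt (fun t => (u t, |deriv u t| ^ α * deriv u t))
      (oddRpow (1 + α)⁻¹ (|deriv u t| ^ α * deriv u t), -(1 + α) * faA a A f (u t)) t := by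
  rw [oddRpow_abs_rpow_mul hα]
  exact (h.1 t).hasDerivAt.prodMk (h.2.2 t)

/-- **Existence and uniqueness for the Cauchy problem** (Proposition 5.1).
If `f` is moreover bounded and Lipschitz, then for every `α > -1` and every `δ`
there exists a weak solution of `-|u'|^α u'' = f_{a,A}(u)` on `ℝ` with `u(0) = 0`,
`u'(0) = δ`; if `-1 < α ≤ 0` this solution is unique. -/
theorem cauchy_existence_uniqueness
    (α a A : ℝ) (hα : -1 < α) (ha : 0 < a) (haA : a ≤ A)
    (f : ℝ → ℝ) (hf : ContDiff ℝ 1 f)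
    (hfm1 : f (-1) = 0) (hf0 : f 0 = 0) (hf1 : f 1 = 0)
    (hfpos : ∀ t ∈ Set.Ioo (0:ℝ) 1, 0 < f t)
    (hfneg : ∀ t ∈ Set.Ioo (-1:ℝ) 0, f t < 0)
    (hfge : ∀ t : ℝ, t ≤ -1 → 0 ≤ f t)
    (hfle : ∀ t : ℝ, 1 ≤ t → f t ≤ 0)
    (hfbd : ∃ K : ℝ, ∀ t, |f t| ≤ K)
    (hfLip : ∃ K : NNReal, LipschitzWith K f)
    (δ : ℝ) :
    (∃ u : ℝ → ℝ, IsWeakSolR α a A f u ∧ u 0 = 0 ∧ deriv u 0 = δ) ∧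
    (α ≤ 0 → ∀ u v : ℝ → ℝ, IsWeakSolR α a A f u → IsWeakSolR α a A f v →
      u 0 = 0 → v 0 = 0 → deriv u 0 = δ → deriv v 0 = δ → u = v) := by
  obtain ⟨B, hB⟩ := hfbd
  have hα' : 0 < 1 + α := by linarith
  have hg : LocallyLipschitz fun t => -(1 + α) * faA a A f t :=
    (contDiff_const.mul contDiff_id : ContDiff ℝ 1 fun x : ℝ => -(1 + α) * x).locallyLipschitz.comp
      (locallyLipschitz_faA a A hf.locallyLipschitz)
  constructor
  · obtain ⟨u, w, hu0, hw0, h⟩ := exists_solution_planar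
      (continuous_oddRpow (inv_nonneg.2 hα'.le)) (oddRpow_neg _) hg.continuous
      (B := (1 + α) * (B / a)) (fun t => by
        rw [abs_mul, abs_neg, abs_of_pos hα']
        exact mul_le_mul_of_nonneg_left (abs_faA_le ha haA hB t) hα'.le) (|δ| ^ α * δ)
    refine ⟨u, isWeakSolR_of_system hα (fun t => (h t).1) (fun t => (h t).2), hu0, ?_⟩
    rw [(h 0).1.deriv, hw0, oddRpow_abs_rpow_mul hα]
  · intro hα0 u v hu hv hu0 hv0 hdu hdv
    have hψ : LocallyLipschitz (oddRpow (1 + α)⁻¹) :=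
      locallyLipschitz_oddRpow ((one_le_inv₀ hα').2 (by linarith))
    have hF : LocallyLipschitz fun y : ℝ × ℝ =>
        (oddRpow (1 + α)⁻¹ y.2, -(1 + α) * faA a A f y.1) :=
      (hψ.comp LipschitzWith.prod_snd.locallyLipschitz).prodMk
        (hg.comp LipschitzWith.prod_fst.locallyLipschitz)
    have huv := eq_of_hasDerivAt_of_locallyLipschitz hF (hu.hasDerivAt_system hα)
      (hv.hasDerivAt_system hα) (t₀ := 0) (by rw [hu0, hv0, hdu, hdv])
    exact funext fun t => congrArg Prod.fst (congrFun huv t)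
end
end
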